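/- For every ε > 0 there exists an integer n_1 such that for every n ≥ n_1 and every 2-edge-colouring of the complete 4-graph K_n^{(4)}, there exist a red tight cycle and a blue tight cycle (each possibly degenerate) that are vertex-disjoint and whose vertex sets together cover at least n − εn vertices. -/

import Mathlib

open Finset

/-- `W` is the vertex set of a (possibly degenerate) tight cycle all of whose edges satisfy
the predicate `E` (e.g. "is a red edge"): either `|W| < k` (degenerate case), or `W` admits a
cyclic ordering all of whose sets of `k` consecutive vertices satisfy `E`. -/
def IsTightCycleSetOn {V : Type*} [DecidableEq V] (k : ℕ) (E : Finset V → Prop)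
    (W : Finset V) : Prop :=
  W.card < k ∨
    ∃ f : ℕ → V,
      (∀ i, f (i + W.card) = f i) ∧
      (∀ i, f i ∈ W) ∧
      (∀ i j, i < W.card → j < W.card → f i = f j → i = j) ∧
      (∀ v ∈ W, ∃ i, f i = v) ∧
      (∀ i, E ((Finset.range k).image (fun j => f (i + j))))

/-- sorted matching lemma, no exceptional set -/
lemma sm_aux (q : ℕ) (h : ℕ → ℝ) (h0 : ∀ i, 0 ≤ h i)
    (hm : ∀ i j, i ≤ j → j < 4 * q → h i ≤ h j)
    (hs : ∑ i ∈ range (4 * q), h i < q) (i : ℕ) (hi : i < q) :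
    h i + h (2 * q - 1 - i) + h (2 * q + i) < 1 := by
  obtain ⟨a, ha⟩ : ∃ a, a = 2 * q - 1 - 2 * i := ⟨_, rfl⟩
  obtain ⟨d, hd⟩ : ∃ d, d = 2 * q - i := ⟨_, rfl⟩
  have e1 : 4 * q = i + a + (2 * i + 1) + d := by omega
  have hb : (2 * q - 1 - i) = i + a := by omega
  have hc : (2 * q + i) = i + a + (2 * i + 1) := by omega
  rw [e1] at hm
  rw [e1, sum_range_add, sum_range_add, sum_range_add] at hs
  rw [hb, hc]
  have s1 : 0 ≤ ∑ x ∈ range i, h x := sum_nonneg (fun _ _ => h0 _)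
  have s2 : (a : ℝ) * h i ≤ ∑ x ∈ range a, h (i + x) := by
    have := card_nsmul_le_sum (range a) (fun x => h (i + x)) (h i)
      (fun x hx => hm _ _ (by omega) (by simp at hx; omega))
    simpa using this
  have s3 : ((2 * i + 1 : ℕ) : ℝ) * h (i + a) ≤ ∑ x ∈ range (2 * i + 1), h (i + a + x) := by
    have := card_nsmul_le_sum (range (2 * i + 1)) (fun x => h (i + a + x)) (h (i + a))
      (fun x hx => hm _ _ (by omega) (by simp at hx; omega))
    simpa using this
  have s4 : (d : ℝ) * h (i + a + (2 * i + 1)) ≤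
      ∑ x ∈ range d, h (i + a + (2 * i + 1) + x) := by
    have := card_nsmul_le_sum (range d) (fun x => h (i + a + (2 * i + 1) + x))
      (h (i + a + (2 * i + 1)))
      (fun x hx => hm _ _ (by omega) (by simp at hx; omega))
    simpa using this
  have l1 : h i ≤ h (i + a) := hm _ _ (by omega) (by omega)
  have l2 : h (i + a) ≤ h (i + a + (2 * i + 1)) := hm _ _ (by omega) (by omega)
  have l0 := h0 i
  generalize h i = A at *
  generalize h (i + a) = B at *
  generalize h (i + a + (2 * i + 1)) = C at *
  have hq : (0 : ℝ) < q := by exact_mod_cast (by omega : 0 < q)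
  have ha' : (a : ℝ) = 2 * q - 1 - 2 * i := by
    have : a + 1 + 2 * i = 2 * q := by omega
    have : (a : ℝ) + 1 + 2 * i = 2 * q := by exact_mod_cast this
    linarith
  have hd' : (d : ℝ) = 2 * q - i := by
    have : d + i = 2 * q := by omega
    have : (d : ℝ) + i = 2 * q := by exact_mod_cast this
    linarith
  have hi' : (i : ℝ) + 1 ≤ q := by exact_mod_cast hi
  have hi0 : (0 : ℝ) ≤ i := by positivity
  push_cast at s3
  rw [ha'] at s2
  rw [hd'] at s4
  have key : (q : ℝ) * (A + B + C) < q * 1 := by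
    have : 0 ≤ (q - i : ℝ) * C + (2 * i + 1 - q) * B + (q - 1 - 2 * i) * A := by
      rcases le_total (q : ℝ) (2 * i + 1) with h | h
      · have p1 : 0 ≤ (2 * i + 1 - q : ℝ) * (B - A) := mul_nonneg (by linarith) (by linarith)
        have p2 : 0 ≤ (q - i : ℝ) * C := mul_nonneg (by linarith) (by linarith)
        nlinarith
      · have p1 : 0 ≤ (q - i : ℝ) * (C - B) := mul_nonneg (by linarith) (by linarith)
        have p2 : 0 ≤ (i + 1 : ℝ) * B := mul_nonneg (by linarith) (by linarith)
        have p3 : 0 ≤ (q - 1 - 2 * i : ℝ) * A := mul_nonneg (by linarith) (by linarith)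
        nlinarith
    nlinarith
  exact lt_of_mul_lt_mul_left key hq.le

lemma sm_aux2 (q : ℕ) (g : ℕ → ℝ) : ∑ i ∈ range (4 * q), g i =
    ∑ i ∈ range q, (g i + g (2 * q - 1 - i) + g (2 * q + i) + g (4 * q - 1 - i)) := by
  have e1 : 4 * q = q + q + q + q := by ring
  rw [e1, sum_range_add, sum_range_add, sum_range_add]
  rw [sum_add_distrib, sum_add_distrib, sum_add_distrib]
  congr 1
  · congr 1
    · congr 1
      rw [← sum_range_reflect]
      apply sum_congr rfl
      intro x hx
      simp at hx
      congr 1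
      omega
    · apply sum_congr rfl
      intro x hx
      congr 1
      omega
  · rw [← sum_range_reflect]
    apply sum_congr rfl
    intro x hx
    simp at hx
    congr 1
    omega

lemma sm_lemma {α : Type*} [Fintype α] [DecidableEq α] (q : ℕ) (hα : Fintype.card α = 4 * q)
    (w w' : α → ℝ) (hw : ∀ a, 0 ≤ w a) (hs : ∑ a, w a < q)
    (hw' : ∀ a, 0 ≤ w' a) (S : Finset α)
    (H : ∀ a b c x, a ∉ S → b ∉ S → c ∉ S → a ≠ b → a ≠ c → b ≠ c → x ≠ a → x ≠ b → x ≠ c →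
      w a + w b + w c < 1 → 1 ≤ w' a + w' b + w' c + w' x) :
    (q : ℝ) - S.card ≤ ∑ a, w' a := by
  classical
  let e0 : Fin (4 * q) ≃ α := (Fintype.equivFinOfCardEq hα).symm
  let v : Fin (4 * q) ≃ α := (Tuple.sort (w ∘ e0)).trans e0
  have hmono : Monotone (fun i => w (v i)) := Tuple.monotone_sort (w ∘ e0)
  let ext (u : α → ℝ) (i : ℕ) : ℝ := if h : i < 4 * q then u (v ⟨i, h⟩) else 0
  have hext : ∀ u : α → ℝ, ∑ a, u a = ∑ i ∈ range (4 * q), ext u i := by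
    intro u
    rw [← Equiv.sum_comp v, Finset.sum_range]
    apply sum_congr rfl
    intro i _
    simp [ext]
  let u : α → ℝ := fun a => w' a + if a ∈ S then 1 else 0
  have hu0 : ∀ a, 0 ≤ u a := fun a => by
    simp only [u]; split_ifs <;> linarith [hw' a]
  have hsum : ∑ a, u a = ∑ a, w' a + S.card := by
    simp [u, sum_add_distrib]
  have : (q : ℝ) ≤ ∑ a, u a := by
    rw [hext, sm_aux2]
    have : (q : ℝ) = ∑ i ∈ range q, (1 : ℝ) := by simp
    rw [this]
    apply sum_le_sum
    intro i hi
    simp at hi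
    have key := sm_aux q (ext w) (fun i => by simp only [ext]; split_ifs <;> simp [hw])
      (fun i j hij hj => by
        have hi' : i < 4 * q := lt_of_le_of_lt hij hj
        simp only [ext, hj, hi', dif_pos]
        exact hmono (by simpa using hij)) (by rw [← hext]; exact hs) i hi
    have h1 : i < 4 * q := by omega
    have h2 : 2 * q - 1 - i < 4 * q := by omega
    have h3 : 2 * q + i < 4 * q := by omega
    have h4 : 4 * q - 1 - i < 4 * q := by omega
    simp only [ext, h1, h2, h3, h4, dif_pos] at key ⊢
    have ne : ∀ (i j : ℕ) (hi : i < 4 * q) (hj : j < 4 * q), i ≠ j → v ⟨i, hi⟩ ≠ v ⟨j, hj⟩ := by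
      intro i j hi hj hij h
      exact hij (by simpa using v.injective h)
    have n12 := ne _ _ h1 h2 (by omega)
    have n13 := ne _ _ h1 h3 (by omega)
    have n23 := ne _ _ h2 h3 (by omega)
    have n41 := ne _ _ h4 h1 (by omega)
    have n42 := ne _ _ h4 h2 (by omega)
    have n43 := ne _ _ h4 h3 (by omega)
    generalize v ⟨i, h1⟩ = a at *
    generalize v ⟨2 * q - 1 - i, h2⟩ = b at *
    generalize v ⟨2 * q + i, h3⟩ = c at *
    generalize v ⟨4 * q - 1 - i, h4⟩ = x at *
    have u1 := hu0 a
    have u2 := hu0 b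
    have u3 := hu0 c
    have u4 := hu0 x
    have uS : ∀ y ∈ S, 1 ≤ u y := fun y hy => by simp [u, hy, hw' y]
    have uw : ∀ y, w' y ≤ u y := fun y => by simp only [u]; split_ifs <;> linarith
    by_cases ha : a ∈ S
    · linarith [uS a ha]
    by_cases hb : b ∈ S
    · linarith [uS b hb]
    by_cases hc : c ∈ S
    · linarith [uS c hc]
    linarith [H a b c x ha hb hc n12 n13 n23 n41 n42 n43 key, uw a, uw b, uw c, uw x]
  linarith

/-- a cover of small weight can be replaced by one with many zeroes -/
lemma zero_cover {α : Type*} [Fintype α] [DecidableEq α] (q : ℕ) (hα : Fintype.card α = 4 * q)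
    (F : Finset α → Prop) (W : ℝ)
    (w : α → ℝ) (hw : ∀ a, 0 ≤ w a) (hc : ∀ e : Finset α, e.card = 4 → F e → 1 ≤ ∑ a ∈ e, w a)
    (hW : ∑ a, w a ≤ W) :
    ∃ w : α → ℝ, (∀ a, 0 ≤ w a) ∧ (∀ e : Finset α, e.card = 4 → F e → 1 ≤ ∑ a ∈ e, w a) ∧
      ∑ a, w a ≤ W ∧ (4 * q : ℝ) - 4 * W ≤ ((univ.filter (fun a => w a = 0)).card : ℝ) := by
  classical
  let K : Set (α → ℝ) := {w | (∀ a, 0 ≤ w a) ∧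
    (∀ e : Finset α, e.card = 4 → F e → 1 ≤ ∑ a ∈ e, w a) ∧ ∑ a, w a ≤ W}
  have hKc : IsCompact K := by
    apply IsCompact.of_isClosed_subset (isCompact_univ_pi (fun _ : α => isCompact_Icc (a := (0:ℝ)) (b := W)))
    · have : K = (⋂ a, {w : α → ℝ | 0 ≤ w a}) ∩
        ((⋂ e : Finset α, ⋂ _ : e.card = 4, ⋂ _ : F e, {w : α → ℝ | 1 ≤ ∑ a ∈ e, w a}) ∩
          {w | ∑ a, w a ≤ W}) := by
        ext w; simp [K]
      rw [this]
      refine IsClosed.inter (isClosed_iInter fun a => ?_) (IsClosed.inter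
        (isClosed_iInter fun e => isClosed_iInter fun _ => isClosed_iInter fun _ => ?_) ?_)
      · exact isClosed_le continuous_const (continuous_apply a)
      · exact isClosed_le continuous_const (by fun_prop)
      · exact isClosed_le (by fun_prop) continuous_const
    · rintro w ⟨h1, -, h3⟩ a -
      exact ⟨h1 a, le_trans (single_le_sum (fun i _ => h1 i) (mem_univ a)) h3⟩
  obtain ⟨w, hwK, hmin⟩ := hKc.exists_isMinOn ⟨w, hw, hc, hW⟩
    (f := fun w : α → ℝ => ∑ a, w a) (by fun_prop)
  obtain ⟨h1, h2, h3⟩ := hwK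
  refine ⟨w, h1, h2, h3, ?_⟩
  by_contra hlt
  push Not at hlt
  set Z := univ.filter (fun a => w a = 0) with hZ
  -- choose η
  obtain ⟨η, hη0, hη1, hη⟩ : ∃ η : ℝ, 0 < η ∧ η < 1 / 8 ∧ ∀ a, w a ≠ 0 → η ≤ w a := by
    rcases (univ.filter (fun a => w a ≠ 0)).eq_empty_or_nonempty with he | hne
    · refine ⟨1/16, by norm_num, by norm_num, fun a ha => ?_⟩
      have : a ∈ (univ.filter (fun a => w a ≠ 0)) := by simp [ha]
      rw [he] at this; simp at this
    · obtain ⟨b, hb, hbm⟩ := exists_min_image _ w hne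
      refine ⟨min (w b) (1/16), ?_, ?_, ?_⟩
      · have : w b ≠ 0 := by simpa using hb
        exact lt_min (lt_of_le_of_ne (h1 b) (Ne.symm this)) (by norm_num)
      · exact lt_of_le_of_lt (min_le_right _ _) (by norm_num)
      · intro a ha
        exact le_trans (min_le_left _ _) (hbm a (by simp [ha]))
  have hd : 0 < 1 - 4 * η := by linarith
  let w2 : α → ℝ := fun a => (if w a = 0 then 0 else w a - η) / (1 - 4 * η)
  have hsum2 : ∑ a, w2 a = (∑ a, w a - η * (4 * q - Z.card)) / (1 - 4 * η) := by
    simp only [w2]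
    rw [← sum_div]
    congr 1
    have : ∀ a, (if w a = 0 then 0 else w a - η) = w a - η + (if w a = 0 then η else 0) := by
      intro a; split_ifs with h <;> simp [h]
    simp only [this]
    rw [sum_add_distrib, sum_sub_distrib, ← sum_filter]
    simp [hα, ← hZ]
    ring
  have hlt2 : ∑ a, w2 a < ∑ a, w a := by
    rw [hsum2, div_lt_iff₀ hd]
    nlinarith
  have := hmin (a := w2) ?_
  · simp only [Set.mem_setOf_eq] at this
    linarith
  · refine ⟨fun a => ?_, fun e he hF => ?_, by linarith⟩
    · simp only [w2]
      apply div_nonneg _ hd.le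
      split_ifs with h
      · exact le_rfl
      · linarith [hη a h]
    · simp only [w2]
      rw [← sum_div, le_div_iff₀ hd]
      have h4 : ∑ a ∈ e, (w a - η) ≤ ∑ a ∈ e, (if w a = 0 then 0 else w a - η) := by
        apply sum_le_sum
        intro a _
        split_ifs with h
        · linarith
        · exact le_rfl
      rw [sum_sub_distrib] at h4
      have := h2 e he hF
      simp [he] at h4
      linarith

theorem gc_lemma {α Λ : Type*} (S : Set α) (k : α → α → Bool) (l : α → α → Λ)
    (ks : ∀ x y, k x y = k y x) (ls : ∀ x y, l x y = l y x)
    (h : ∀ x ∈ S, ∀ y ∈ S, ∀ z ∈ S, x ≠ y → x ≠ z → k x y = k x z → l x y = l x z)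
    (hS : ∃ x ∈ S, ∃ y ∈ S, x ≠ y) :
    ∃ κ ℓ, ∀ x ∈ S, ∃ y ∈ S, y ≠ x ∧ k x y = κ ∧ l x y = ℓ := by
  by_cases h1 : ∀ κ : Bool, ∀ x ∈ S, ∃ y ∈ S, y ≠ x ∧ k x y = κ
  · by_contra hcon
    push Not at hcon
    obtain ⟨x0, hx0, -⟩ := hS
    obtain ⟨a0, ha0, ha0n, ha0k⟩ := h1 true x0 hx0
    obtain ⟨b0, hb0, hb0n, hb0k⟩ := h1 false x0 hx0
    obtain ⟨z, hz, hz2⟩ := hcon true (l x0 a0)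
    obtain ⟨a1, ha1, ha1n, ha1k⟩ := h1 true z hz
    have hne : l z a1 ≠ l x0 a0 := hz2 a1 ha1 ha1n ha1k
    -- x0 and z have different red labels
    have red : ∀ x ∈ S, x ≠ x0 → x ≠ z → ¬ (k x x0 = true ∧ k x z = true) := by
      rintro x hx hxx hxz ⟨e1, e2⟩
      have e3 := h x hx x0 hx0 z hz hxx hxz (e1.trans e2.symm)
      have e4 := h x0 hx0 x hx a0 ha0 (Ne.symm hxx) (Ne.symm ha0n) (by rw [ks, e1, ha0k])
      have e5 := h z hz x hx a1 ha1 (Ne.symm hxz) (Ne.symm ha1n) (by rw [ks, e2, ha1k])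
      rw [ls] at e4 e5
      exact hne (by rw [← e5, ← e4, e3])
    have hzx : z ≠ x0 := by
      rintro rfl
      exact hne (h _ hz _ ha1 _ ha0 (Ne.symm ha1n) (Ne.symm ha0n) (by rw [ha1k, ha0k]))
    have hzb : k z x0 = false := by
      by_contra hh
      have hh : k z x0 = true := by simpa using hh
      have e4 := h x0 hx0 z hz a0 ha0 (Ne.symm hzx) (Ne.symm ha0n) (by rw [ks, hh, ha0k])
      have e5 := h z hz x0 hx0 a1 ha1 hzx (Ne.symm ha1n) (by rw [hh, ha1k])
      rw [ls] at e4
      exact hne (by rw [← e5, ← e4])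
    obtain ⟨y, hy, hy2⟩ := hcon false (l x0 z)
    have hyx : y ≠ x0 := by
      rintro rfl
      exact hy2 z hz hzx (by rw [ks]; exact hzb) rfl
    have hyz : y ≠ z := by
      rintro rfl
      exact hy2 x0 hx0 (Ne.symm hzx) hzb (ls _ _)
    have := red y hy hyx hyz
    by_cases hk : k y x0 = false
    · apply hy2 x0 hx0 (Ne.symm hyx) hk
      rw [ls]
      exact h x0 hx0 y hy z hz (Ne.symm hyx) (Ne.symm hzx) (by rw [ks, hk, ks, hzb])
    · have hk2 : k y z = false := by
        by_contra hh
        exact this ⟨by simpa using hk, by simpa using hh⟩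
      apply hy2 z hz (Ne.symm hyz) hk2
      rw [ls, ls x0 z]
      exact h z hz y hy x0 hx0 (Ne.symm hyz) hzx (by rw [ks, hk2, hzb])
  · push Not at h1
    obtain ⟨κ, x, hx, hxy⟩ := h1
    have hb : ∀ y ∈ S, y ≠ x → k x y = !κ := by
      intro y hy hyx
      have := hxy y hy hyx
      revert this
      cases k x y <;> cases κ <;> simp
    obtain ⟨y0, hy0, hy0n⟩ : ∃ y ∈ S, y ≠ x := by
      obtain ⟨u, hu, v, hv, huv⟩ := hS
      by_cases e : u = x
      · exact ⟨v, hv, fun e2 => huv (e.trans e2.symm)⟩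
      · exact ⟨u, hu, e⟩
    refine ⟨!κ, l x y0, fun z hz => ?_⟩
    by_cases e : z = x
    · subst e
      exact ⟨y0, hy0, hy0n, hb _ hy0 hy0n, rfl⟩
    · refine ⟨x, hx, Ne.symm e, by rw [ks]; exact hb z hz e, ?_⟩
      rw [ls]
      exact h x hx z hz y0 hy0 (Ne.symm e) (Ne.symm hy0n) (by rw [hb z hz e, hb y0 hy0 hy0n])

theorem core_aux {α Λ : Type*} [Fintype α] [DecidableEq α] (q : ℕ)
    (hα : Fintype.card α = 4 * q) (hq : 10 ≤ q)
    (C : α → α → α → α → Bool) (Lb : α → α → α → α → Λ)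
    (c12 : ∀ a b c d, C a b c d = C b a c d) (c23 : ∀ a b c d, C a b c d = C a c b d)
    (c34 : ∀ a b c d, C a b c d = C a b d c)
    (l12 : ∀ a b c d, Lb a b c d = Lb b a c d) (l23 : ∀ a b c d, Lb a b c d = Lb a c b d)
    (l34 : ∀ a b c d, Lb a b c d = Lb a b d c)
    (hadj : ∀ a b c d e, a ≠ b → a ≠ c → b ≠ c → d ≠ a → d ≠ b → d ≠ c → e ≠ a → e ≠ b → e ≠ c →
      C a b c d = C a b c e → Lb a b c d = Lb a b c e)
    (hcov : ∀ κ : Bool, ∀ R B : Λ, ∃ w : α → ℝ, (∀ a, 0 ≤ w a) ∧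
      (∀ a b c d, a ≠ b → a ≠ c → b ≠ c → d ≠ a → d ≠ b → d ≠ c →
        ((C a b c d = κ ∧ Lb a b c d = R) ∨ (C a b c d ≠ κ ∧ Lb a b c d = B)) →
        1 ≤ w a + w b + w c + w d) ∧ ∑ a, w a < q - 10 ∧
        ∃ z1 z2 z3 z4, w z1 = 0 ∧ w z2 = 0 ∧ w z3 = 0 ∧ w z4 = 0 ∧ z1 ≠ z2 ∧ z1 ≠ z3 ∧ z1 ≠ z4 ∧
         z2 ≠ z3 ∧ z2 ≠ z4 ∧ z3 ≠ z4 ∧ True ∧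
         ∀ z z', w z = 0 → w z' = 0 → z ≠ z' → ∃ z3 z4, w z3 = 0 ∧ w z4 = 0 ∧ z3 ≠ z ∧ z3 ≠ z' ∧
           z4 ≠ z ∧ z4 ≠ z' ∧ z3 ≠ z4) : False := by
  have crot : ∀ a b c d, C a b c d = C d a b c := by
    intro a b c d; rw [c34, c23, c12]
  have lrot : ∀ a b c d, Lb a b c d = Lb d a b c := by
    intro a b c d; rw [l34, l23, l12]
  have cblk : ∀ a b c d, C a b c d = C c d a b := by
    intro a b c d; rw [crot, crot]
  have lblk : ∀ a b c d, Lb a b c d = Lb c d a b := by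
    intro a b c d; rw [lrot, lrot]
  have hbig : ∀ T : Finset α, T.card < 40 → ∃ x, x ∉ T := by
    intro T hT
    by_contra hh
    push Not at hh
    have : T = univ := by ext; simp [hh]
    rw [this, card_univ] at hT
    omega
  -- blueprint
  let P : α → α → Bool × Λ → Prop := fun a b p => ∀ x, x ≠ a → x ≠ b →
    ∃ y, y ≠ a ∧ y ≠ b ∧ y ≠ x ∧ C a b x y = p.1 ∧ Lb a b x y = p.2
  have hPsym : ∀ a b, P a b = P b a := by
    intro a b
    funext p
    apply propext
    constructor <;> intro h x hxa hxb
    · obtain ⟨y, h1, h2, h3, h4, h5⟩ := h x hxb hxa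
      exact ⟨y, h2, h1, h3, by rw [c12]; exact h4, by rw [l12]; exact h5⟩
    · obtain ⟨y, h1, h2, h3, h4, h5⟩ := h x hxb hxa
      exact ⟨y, h2, h1, h3, by rw [c12]; exact h4, by rw [l12]; exact h5⟩
  have hPex : ∀ a b, a ≠ b → ∃ p, P a b p := by
    intro a b hab
    have := gc_lemma {x | x ≠ a ∧ x ≠ b} (fun x y => C a b x y) (fun x y => Lb a b x y)
      (fun x y => c34 _ _ _ _) (fun x y => l34 _ _ _ _)
      (by
        intro x hx y hy z hz hxy hxz hk
        exact hadj a b x y z hab (Ne.symm hx.1) (Ne.symm hx.2) hy.1 hy.2 (Ne.symm hxy)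
          hz.1 hz.2 (Ne.symm hxz) hk)
      (by
        obtain ⟨x, hx⟩ := hbig {a, b} (lt_of_le_of_lt (card_le_two) (by norm_num))
        obtain ⟨y, hy⟩ := hbig {a, b, x} (lt_of_le_of_lt (card_le_three) (by norm_num))
        simp only [mem_insert, mem_singleton, not_or] at hx hy
        exact ⟨x, hx, y, ⟨hy.1, hy.2.1⟩, Ne.symm hy.2.2⟩)
    obtain ⟨κ, ℓ, h⟩ := this
    refine ⟨(κ, ℓ), fun x h1 h2 => ?_⟩
    obtain ⟨y, hy, h3, h4, h5⟩ := h x ⟨h1, h2⟩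
    exact ⟨y, hy.1, hy.2, h3, h4, h5⟩
  obtain ⟨a0, -⟩ := hbig ∅ (by simp)
  obtain ⟨b0, hb0⟩ := hbig {a0} (by simp)
  obtain ⟨p0, -⟩ := hPex a0 b0 (by simpa using Ne.symm (by simpa using hb0))
  haveI : Nonempty (Bool × Λ) := ⟨p0⟩
  let G : α → α → Bool × Λ := fun a b => Classical.epsilon (P a b)
  have hG : ∀ a b, a ≠ b → P a b (G a b) := fun a b hab => Classical.epsilon_spec (hPex a b hab)
  have hGs : ∀ a b, G a b = G b a := fun a b => by simp only [G, hPsym a b]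
  let g : α → α → Bool := fun a b => (G a b).1
  let l : α → α → Λ := fun a b => (G a b).2
  have gs : ∀ a b, g a b = g b a := fun a b => by simp only [g, hGs a b]
  have ls : ∀ a b, l a b = l b a := fun a b => by simp only [l, hGs a b]
  have F2 : ∀ a b c d, a ≠ b → a ≠ c → b ≠ c → d ≠ a → d ≠ b → d ≠ c → C a b c d = g a b →
      Lb a b c d = l a b := by
    intro a b c d hab hac hbc hda hdb hdc h
    obtain ⟨y, h1, h2, h3, h4, h5⟩ := hG a b hab c (Ne.symm hac) (Ne.symm hbc)
    rw [← show Lb a b c y = l a b from h5]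
    exact hadj a b c d y hab hac hbc hda hdb hdc h1 h2 h3 (h.trans h4.symm)
  have F1 : ∀ a b c, a ≠ b → a ≠ c → g a b = g a c → l a b = l a c := by
    intro a b c hab hac h
    by_cases hbc : b = c
    · rw [hbc]
    obtain ⟨y, h1, h2, h3, h4, h5⟩ := hG a b hab c (Ne.symm hac) (Ne.symm hbc)
    have h4' : C a b c y = g a b := h4
    have h5' : Lb a b c y = l a b := h5
    rw [← h5', l23]
    apply F2 a c b y hac hab (Ne.symm hbc) h1 h3 h2
    rw [c23, h4', h]
  obtain ⟨κ, R, hR⟩ := gc_lemma (Set.univ) g l gs ls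
    (fun x _ y _ z _ hxy hxz hk => F1 x y z hxy hxz hk) (by
      exact ⟨a0, trivial, b0, trivial, by simpa using Ne.symm (by simpa using hb0)⟩)
  have Rp : ∀ a b, a ≠ b → g a b = κ → l a b = R := by
    intro a b hab h
    obtain ⟨y, -, h1, h2, h3⟩ := hR a trivial
    rw [← h3]
    exact F1 a b y hab (Ne.symm h1) (by rw [h, h2])
  have eqb : ∀ x y : Bool, x ≠ κ → y ≠ κ → x = y := by
    intro x y; cases x <;> cases y <;> cases κ <;> simp
  have fa : ∀ a b c d, a ≠ b → a ≠ c → b ≠ c → d ≠ a → d ≠ b → d ≠ c → C a b c d = κ →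
      g a b = κ → Lb a b c d = R := by
    intro a b c d hab hac hbc hda hdb hdc h h'
    rw [F2 a b c d hab hac hbc hda hdb hdc (by rw [h, h']), Rp a b hab h']
  have fb : ∀ a b c d, a ≠ b → a ≠ c → b ≠ c → d ≠ a → d ≠ b → d ≠ c → C a b c d ≠ κ →
      g a b ≠ κ → Lb a b c d = l a b := by
    intro a b c d hab hac hbc hda hdb hdc h h'
    exact F2 a b c d hab hac hbc hda hdb hdc (eqb _ _ h h')
  have cross : ∀ p p' r r', p ≠ p' → p ≠ r → p ≠ r' → p' ≠ r → p' ≠ r' → r ≠ r' →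
      g p p' ≠ κ → g r r' ≠ κ → l p p' ≠ l r r' → C p p' r r' = κ ∧ Lb p p' r r' = R := by
    intro p p' r r' h1 h2 h3 h4 h5 h6 hp hr hl
    have hpr : g p r = κ := by
      by_contra hh
      apply hl
      rw [F1 p p' r h1 h2 (eqb _ _ hp hh), ls p r]
      exact F1 r p r' (Ne.symm h2) h6 (eqb _ _ (by rwa [gs]) hr)
    have hC : C p p' r r' = κ := by
      by_contra hh
      apply hl
      rw [← fb p p' r r' h1 h2 h4 (Ne.symm h3) (Ne.symm h5) (Ne.symm h6) hh hp, lblk]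
      exact fb r r' p p' h6 (Ne.symm h2) (Ne.symm h3) h4 h5 (Ne.symm h1) (by rwa [cblk]) hr
    refine ⟨hC, ?_⟩
    rw [l23]
    exact fa p r p' r' h2 h1 (Ne.symm h4) (Ne.symm h3) (Ne.symm h6) (Ne.symm h5)
      (by rw [c23]; exact hC) hpr
  -- covers
  choose W W0 Wc Ws Z1 Z2 Z3 Z4 hZ1 hZ2 hZ3 hZ4 h12 h13 h14 h23 h24 h34 _ hZext using hcov κ R
  by_cases case1 : ∃ B z1 z2, z1 ≠ z2 ∧ W B z1 = 0 ∧ W B z2 = 0 ∧ g z1 z2 ≠ κ ∧ l z1 z2 = B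
  · obtain ⟨B, z1, z2, h12, w1, w2, hg, hl⟩ := case1
    obtain ⟨z3, z4, w3, w4, h31, h32, h41, h42, h34⟩ := hZext B z1 z2 w1 w2 h12
    have unc : ∀ a b c d, a ≠ b → a ≠ c → b ≠ c → d ≠ a → d ≠ b → d ≠ c →
        W B a + W B b + W B c + W B d < 1 →
        ¬ ((C a b c d = κ ∧ Lb a b c d = R) ∨ (C a b c d ≠ κ ∧ Lb a b c d = B)) := by
      intro a b c d e1 e2 e3 e4 e5 e6 hlt hh
      linarith [Wc B a b c d e1 e2 e3 e4 e5 e6 hh]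
    have hzc : C z1 z2 z3 z4 = κ := by
      by_contra hh
      exact unc z1 z2 z3 z4 h12 (Ne.symm h31) (Ne.symm h32) h41 h42 (Ne.symm h34)
        (by linarith) (Or.inr ⟨hh, by
          rw [fb z1 z2 z3 z4 h12 (Ne.symm h31) (Ne.symm h32) h41 h42 (Ne.symm h34) hh hg, hl]⟩)
    obtain ⟨w', w'0, w'c, w's, -⟩ := hcov κ (Lb z1 z2 z3 z4) B
    have key : (q : ℝ) - (({z1, z2, z3, z4} : Finset α).card : ℝ) ≤ ∑ a, w' a := by
      apply sm_lemma q hα (W B) w' (W0 B) (by linarith [Ws B]) w'0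
      intro a b c x ha hb hc hab hac hbc hxa hxb hxc hlt
      simp only [mem_insert, mem_singleton, not_or] at ha hb hc
      obtain ⟨ha1, ha2, ha3, ha4⟩ := ha
      obtain ⟨hb1, hb2, hb3, hb4⟩ := hb
      obtain ⟨hc1, hc2, hc3, hc4⟩ := hc
      have p0 := W0 B a
      have p1 := W0 B b
      have p2 := W0 B c
      have st1 : ∀ y, y ≠ z1 → y ≠ z2 → y ≠ z3 → y ≠ z4 → W B y < 1 →
          C z1 z2 z3 y = κ ∧ Lb z1 z2 z3 y = Lb z1 z2 z3 z4 ∧ g z1 y ≠ κ ∧ l z1 y = B ∧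
          Lb z1 z2 z3 z4 ≠ R := by
        intro y y1 y2 y3 y4 hy
        have hn := unc z1 z2 z3 y h12 (Ne.symm h31) (Ne.symm h32) y1 y2 y3 (by linarith)
        have e1 : C z1 z2 z3 y = κ := by
          by_contra hh
          exact hn (Or.inr ⟨hh, by
            rw [fb z1 z2 z3 y h12 (Ne.symm h31) (Ne.symm h32) y1 y2 y3 hh hg, hl]⟩)
        have e2 : Lb z1 z2 z3 y = Lb z1 z2 z3 z4 :=
          hadj z1 z2 z3 y z4 h12 (Ne.symm h31) (Ne.symm h32) y1 y2 y3 h41 h42 (Ne.symm h34)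
            (by rw [e1, hzc])
        have e3 : Lb z1 z2 z3 z4 ≠ R := by
          intro hh
          exact hn (Or.inl ⟨e1, by rw [e2, hh]⟩)
        have e4 : g z1 y ≠ κ := by
          intro hh
          apply e3
          rw [← e2, lrot, l12]
          apply fa z1 y z2 z3 (Ne.symm y1) h12 y2 h31 (Ne.symm y3) h32 _ hh
          rw [c12, ← crot]; exact e1
        refine ⟨e1, e2, e4, ?_, e3⟩
        rw [← hl]
        exact F1 z1 y z2 (Ne.symm y1) h12 (eqb _ _ e4 hg)
      obtain ⟨sa1, sa2, sa3, sa4, hRR⟩ := st1 a ha1 ha2 ha3 ha4 (by linarith)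
      obtain ⟨sb1, sb2, sb3, sb4, -⟩ := st1 b hb1 hb2 hb3 hb4 (by linarith)
      have e1 : C z1 z2 a b = κ := by
        by_contra hh
        exact unc z1 z2 a b h12 (Ne.symm ha1) (Ne.symm ha2) hb1 hb2 (Ne.symm hab)
          (by linarith) (Or.inr ⟨hh, by
            rw [fb z1 z2 a b h12 (Ne.symm ha1) (Ne.symm ha2) hb1 hb2 (Ne.symm hab) hh hg, hl]⟩)
      have e2 : Lb z1 z2 a b = Lb z1 z2 z3 z4 := by
        rw [← sa2, l34 z1 z2 z3 a]
        apply hadj z1 z2 a b z3 h12 (Ne.symm ha1) (Ne.symm ha2) hb1 hb2 (Ne.symm hab) h31 h32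
          (Ne.symm ha3)
        rw [e1, c34, sa1]
      have e3 : g a b ≠ κ := by
        intro hh
        apply hRR
        rw [← e2, lblk]
        exact fa a b z1 z2 hab ha1 hb1 (Ne.symm ha2) (Ne.symm hb2) (Ne.symm h12)
          (by rw [cblk]; exact e1) hh
      have e4 : l a b = B := by
        rw [← sa4, ls z1 a]
        exact F1 a b z1 hab ha1 (eqb _ _ e3 (by rw [gs]; exact sa3))
      have e5 : C a b c z1 = κ := by
        by_contra hh
        exact unc a b c z1 hab hac hbc (Ne.symm ha1) (Ne.symm hb1) (Ne.symm hc1)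
          (by linarith) (Or.inr ⟨hh, by
            rw [fb a b c z1 hab hac hbc (Ne.symm ha1) (Ne.symm hb1) (Ne.symm hc1) hh e3, e4]⟩)
      have e6 : Lb a b c z1 = Lb z1 z2 z3 z4 := by
        rw [← e2, l34, lblk z1 z2]
        apply hadj a b z1 c z2 hab ha1 hb1 (Ne.symm hac) (Ne.symm hbc) hc1 (Ne.symm ha2)
          (Ne.symm hb2) (Ne.symm h12)
        rw [← c34, e5, cblk, e1]
      apply w'c a b c x hab hac hbc hxa hxb hxc
      by_cases hx : C a b c x = κ
      · left
        refine ⟨hx, ?_⟩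
        rw [← e6]
        exact hadj a b c x z1 hab hac hbc hxa hxb hxc (Ne.symm ha1) (Ne.symm hb1) (Ne.symm hc1)
          (by rw [hx, e5])
      · right
        exact ⟨hx, by rw [fb a b c x hab hac hbc hxa hxb hxc hx e3, e4]⟩
    have hcard : (({z1, z2, z3, z4} : Finset α).card : ℝ) ≤ 4 := by
      exact_mod_cast card_le_four
    linarith
  · push Not at case1
    have st0 : ∀ B p p', p ≠ p' → p ≠ Z1 B → p ≠ Z2 B → p' ≠ Z1 B → p' ≠ Z2 B → g p p' ≠ κ →
        l p p' = B → 1 ≤ W B p + W B p' := by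
      intro B p p' hp h1 h2 h3 h4 hg hl
      have := Wc B p p' (Z1 B) (Z2 B) hp h1 h3 (Ne.symm h2) (Ne.symm h4) (Ne.symm (h12 B)) (by
        by_cases hz : g (Z1 B) (Z2 B) = κ
        · by_cases hC : C p p' (Z1 B) (Z2 B) = κ
          · left
            refine ⟨hC, ?_⟩
            rw [lblk]
            exact fa _ _ _ _ (h12 B) (Ne.symm h1) (Ne.symm h2) h3 h4 (Ne.symm hp)
              (by rw [cblk]; exact hC) hz
          · right
            exact ⟨hC, by
              rw [fb _ _ _ _ hp h1 h3 (Ne.symm h2) (Ne.symm h4) (Ne.symm (h12 B)) hC hg, hl]⟩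
        · left
          exact cross p p' _ _ hp h1 h2 h3 h4 (h12 B) hg hz (by
            rw [hl]
            exact Ne.symm (case1 B _ _ (h12 B) (hZ1 B) (hZ2 B) hz)))
      rw [hZ1, hZ2] at this
      linarith
    -- main: find B', z1, z2
    have unc : ∀ a b c d, a ≠ b → a ≠ c → b ≠ c → d ≠ a → d ≠ b → d ≠ c →
        W R a + W R b + W R c + W R d < 1 →
        ¬ ((C a b c d = κ ∧ Lb a b c d = R) ∨ (C a b c d ≠ κ ∧ Lb a b c d = R)) := by
      intro a b c d e1 e2 e3 e4 e5 e6 hlt hh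
      linarith [Wc R a b c d e1 e2 e3 e4 e5 e6 hh]
    have main : ∃ B' z1 z2 z3 z4, z1 ≠ z2 ∧ W R z1 = 0 ∧ W R z2 = 0 ∧
        ∀ a b, a ≠ b → a ≠ z1 → a ≠ z2 → a ≠ z3 → a ≠ z4 → b ≠ z1 → b ≠ z2 → b ≠ z3 → b ≠ z4 →
          W R a + W R b < 1 →
          (g a b = κ → C z1 z2 a b ≠ κ ∧ Lb z1 z2 a b = B') ∧ (g a b ≠ κ → l a b = B') := by
      by_cases hred : ∃ z1 z2, z1 ≠ z2 ∧ W R z1 = 0 ∧ W R z2 = 0 ∧ g z1 z2 = κ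
      · obtain ⟨z1, z2, h12, w1, w2, hg⟩ := hred
        obtain ⟨z3, z4, w3, w4, h31, h32, h41, h42, h34⟩ := hZext R z1 z2 w1 w2 h12
        refine ⟨Lb z1 z2 z3 z4, z1, z2, z3, z4, h12, w1, w2, ?_⟩
        intro a b hab ha1 ha2 ha3 ha4 hb1 hb2 hb3 hb4 hlt
        have p0 := W0 R a
        have p1 := W0 R b
        have nr : ∀ x y, x ≠ z1 → x ≠ z2 → y ≠ z1 → y ≠ z2 → y ≠ x → W R x + W R y < 1 →
            C z1 z2 x y ≠ κ := by
          intro x y x1 x2 y1 y2 hyx hxy hh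
          exact unc z1 z2 x y h12 (Ne.symm x1) (Ne.symm x2) y1 y2 hyx (by linarith)
            (Or.inl ⟨hh, fa z1 z2 x y h12 (Ne.symm x1) (Ne.symm x2) y1 y2 hyx hh hg⟩)
        have n1 := nr z3 z4 h31 h32 h41 h42 (Ne.symm h34) (by linarith)
        have n2 := nr z3 a h31 h32 ha1 ha2 ha3 (by linarith)
        have n3 := nr a b ha1 ha2 hb1 hb2 (Ne.symm hab) (by linarith)
        have e1 : Lb z1 z2 z3 a = Lb z1 z2 z3 z4 :=
          hadj z1 z2 z3 a z4 h12 (Ne.symm h31) (Ne.symm h32) ha1 ha2 ha3 h41 h42 (Ne.symm h34)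
            (eqb _ _ n2 n1)
        have e2 : Lb z1 z2 a b = Lb z1 z2 z3 z4 := by
          rw [← e1, l34 z1 z2 z3 a]
          apply hadj z1 z2 a b z3 h12 (Ne.symm ha1) (Ne.symm ha2) hb1 hb2 (Ne.symm hab) h31 h32
            (Ne.symm ha3)
          exact eqb _ _ n3 (by rw [c34]; exact n2)
        refine ⟨fun _ => ⟨n3, e2⟩, fun hh => ?_⟩
        rw [← e2, lblk]
        exact (fb a b z1 z2 hab ha1 hb1 (Ne.symm ha2) (Ne.symm hb2) (Ne.symm h12)
          (by rw [cblk]; exact n3) hh).symm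
      · push Not at hred
        have hg := hred _ _ (h12 R) (hZ1 R) (hZ2 R)
        refine ⟨l (Z1 R) (Z2 R), Z1 R, Z2 R, Z3 R, Z4 R, h12 R, hZ1 R, hZ2 R, ?_⟩
        intro a b hab ha1 ha2 ha3 ha4 hb1 hb2 hb3 hb4 hlt
        have un := unc (Z1 R) (Z2 R) a b (h12 R) (Ne.symm ha1) (Ne.symm ha2) hb1 hb2 (Ne.symm hab)
          (by rw [hZ1, hZ2]; linarith)
        constructor
        · intro hh
          have n3 : C (Z1 R) (Z2 R) a b ≠ κ := by
            intro h3
            apply un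
            left
            refine ⟨h3, ?_⟩
            rw [lblk]
            exact fa a b _ _ hab ha1 hb1 (Ne.symm ha2) (Ne.symm hb2) (Ne.symm (h12 R))
              (by rw [cblk]; exact h3) hh
          exact ⟨n3, fb _ _ _ _ (h12 R) (Ne.symm ha1) (Ne.symm ha2) hb1 hb2 (Ne.symm hab) n3 hg⟩
        · intro hh
          by_contra hne
          exact un (Or.inl (cross _ _ a b (h12 R) (Ne.symm ha1) (Ne.symm hb1) (Ne.symm ha2)
            (Ne.symm hb2) hab hg hh (Ne.symm hne)))
    obtain ⟨B, z1, z2, z3, z4, h12', w1, w2, hm⟩ := main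
    have key : (q : ℝ) - (({z1, z2, z3, z4} ∪ {Z1 B, Z2 B} : Finset α).card : ℝ) ≤ ∑ a, W B a := by
      apply sm_lemma q hα (W R) (W B) (W0 R) (by linarith [Ws R]) (W0 B)
      intro a b c x ha hb hc hab hac hbc hxa hxb hxc hlt
      simp only [mem_union, mem_insert, mem_singleton, not_or] at ha hb hc
      obtain ⟨⟨ha1, ha2, ha3, ha4⟩, ha5, ha6⟩ := ha
      obtain ⟨⟨hb1, hb2, hb3, hb4⟩, hb5, hb6⟩ := hb
      obtain ⟨⟨hc1, hc2, hc3, hc4⟩, hc5, hc6⟩ := hc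
      have p0 := W0 R a
      have p1 := W0 R b
      have p2 := W0 R c
      have red : ∀ a b c, a ≠ z1 → a ≠ z2 → b ≠ z1 → b ≠ z2 → c ≠ z1 → c ≠ z2 → a ≠ b → a ≠ c →
          b ≠ c → x ≠ a → x ≠ b → x ≠ c → W R a + W R b + W R c < 1 →
          g a b = κ → C z1 z2 a b ≠ κ → Lb z1 z2 a b = B →
          1 ≤ W B a + W B b + W B c + W B x := by
        intro a b c ha1 ha2 hb1 hb2 hc1 hc2 hab hac hbc hxa hxb hxc hlt hg hC hL
        have e1 : C a b c z1 ≠ κ := by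
          intro hh
          exact unc a b c z1 hab hac hbc (Ne.symm ha1) (Ne.symm hb1) (Ne.symm hc1)
            (by linarith) (Or.inl ⟨hh,
              fa a b c z1 hab hac hbc (Ne.symm ha1) (Ne.symm hb1) (Ne.symm hc1) hh hg⟩)
        have e2 : Lb a b c z1 = B := by
          rw [← hL, l34, lblk z1 z2]
          apply hadj a b z1 c z2 hab ha1 hb1 (Ne.symm hac) (Ne.symm hbc) hc1 (Ne.symm ha2)
            (Ne.symm hb2) (Ne.symm h12')
          exact eqb _ _ (by rw [← c34]; exact e1) (by rw [cblk]; exact hC)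
        apply Wc B a b c x hab hac hbc hxa hxb hxc
        by_cases hx : C a b c x = κ
        · left
          exact ⟨hx, fa a b c x hab hac hbc hxa hxb hxc hx hg⟩
        · right
          refine ⟨hx, ?_⟩
          rw [← e2]
          exact hadj a b c x z1 hab hac hbc hxa hxb hxc (Ne.symm ha1) (Ne.symm hb1) (Ne.symm hc1)
            (eqb _ _ hx e1)
      have m1 := hm a b hab ha1 ha2 ha3 ha4 hb1 hb2 hb3 hb4 (by linarith)
      by_cases g1 : g a b = κ
      · exact red a b c ha1 ha2 hb1 hb2 hc1 hc2 hab hac hbc hxa hxb hxc hlt g1 (m1.1 g1).1 (m1.1 g1).2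
      · have := st0 B a b hab ha5 ha6 hb5 hb6 g1 (m1.2 g1)
        linarith [W0 B c, W0 B x]
    have hcard : (({z1, z2, z3, z4} ∪ {Z1 B, Z2 B} : Finset α).card : ℝ) ≤ 6 := by
      have h1 := card_union_le ({z1, z2, z3, z4} : Finset α) {Z1 B, Z2 B}
      have h2 : ({z1, z2, z3, z4} : Finset α).card ≤ 4 := card_le_four
      have h3 : ({Z1 B, Z2 B} : Finset α).card ≤ 2 := card_le_two
      exact_mod_cast (by omega : ({z1, z2, z3, z4} ∪ {Z1 B, Z2 B} : Finset α).card ≤ 6)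
    linarith [Ws B]

theorem core_thm {α Λ : Type*} [Fintype α] [DecidableEq α] (q : ℕ)
    (hα : Fintype.card α = 4 * q) (hq : 10 ≤ q)
    (col : Finset α → Bool) (lab : Finset α → Λ)
    (hadj : ∀ a b c d e, a ≠ b → a ≠ c → b ≠ c → d ≠ a → d ≠ b → d ≠ c → e ≠ a → e ≠ b → e ≠ c →
      col {a, b, c, d} = col {a, b, c, e} → lab {a, b, c, d} = lab {a, b, c, e}) :
    ∃ L : Bool → Λ, ∀ w : α → ℝ, (∀ a, 0 ≤ w a) →
      (∀ e : Finset α, e.card = 4 → lab e = L (col e) → 1 ≤ ∑ a ∈ e, w a) →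
      (q : ℝ) - 10 ≤ ∑ a, w a := by
  by_contra hcon
  push Not at hcon
  have p12 : ∀ a b c d : α, ({a, b, c, d} : Finset α) = {b, a, c, d} := fun a b c d => by
    ext; simp only [mem_insert, mem_singleton]; tauto
  have p23 : ∀ a b c d : α, ({a, b, c, d} : Finset α) = {a, c, b, d} := fun a b c d => by
    ext; simp only [mem_insert, mem_singleton]; tauto
  have p34 : ∀ a b c d : α, ({a, b, c, d} : Finset α) = {a, b, d, c} := fun a b c d => by
    ext; simp only [mem_insert, mem_singleton]; tauto
  refine core_aux q hα hq (fun a b c d => col {a, b, c, d}) (fun a b c d => lab {a, b, c, d})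
    (fun a b c d => by simp only [p12 a b c d]) (fun a b c d => by simp only [p23 a b c d])
    (fun a b c d => by simp only [p34 a b c d])
    (fun a b c d => by simp only [p12 a b c d]) (fun a b c d => by simp only [p23 a b c d])
    (fun a b c d => by simp only [p34 a b c d]) hadj ?_
  intro κ R B
  obtain ⟨w0, hw0, hc0, hs0⟩ := hcon (fun b => if b = κ then R else B)
  obtain ⟨w, hw, hc, hs, hz⟩ := zero_cover q hα
    (fun e => lab e = (fun b => if b = κ then R else B) (col e)) (∑ a, w0 a) w0 hw0 hc0 le_rfl
  have hz' : 40 ≤ (univ.filter (fun a => w a = 0)).card := by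
    have : (40 : ℝ) ≤ ((univ.filter (fun a => w a = 0)).card : ℝ) := by linarith
    exact_mod_cast this
  have ext : ∀ T : Finset α, T.card < 40 → ∃ z, w z = 0 ∧ z ∉ T := by
    intro T hT
    by_contra hh
    push Not at hh
    have : (univ.filter (fun a => w a = 0)) ⊆ T := fun x hx => hh x (by simpa using hx)
    have := card_le_card this
    omega
  refine ⟨w, hw, ?_, by linarith, ?_⟩
  · intro a b c d hab hac hbc hda hdb hdc h
    have hcard : ({a, b, c, d} : Finset α).card = 4 := by
      rw [card_insert_of_notMem, card_insert_of_notMem, card_insert_of_notMem, card_singleton] <;>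
      simp only [mem_insert, mem_singleton, not_or]
      · exact Ne.symm hdc
      · exact ⟨hbc, Ne.symm hdb⟩
      · exact ⟨hab, hac, Ne.symm hda⟩
    have := hc {a, b, c, d} hcard (by
      rcases h with ⟨h1, h2⟩ | ⟨h1, h2⟩
      · rw [h2, h1]; simp
      · rw [h2]; simp [h1])
    rw [sum_insert, sum_insert, sum_insert, sum_singleton] at this
    · linarith
    all_goals simp only [mem_insert, mem_singleton, not_or]
    · exact Ne.symm hdc
    · exact ⟨hbc, Ne.symm hdb⟩
    · exact ⟨hab, hac, Ne.symm hda⟩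
  · obtain ⟨z1, w1, -⟩ := ext ∅ (by simp)
    obtain ⟨z2, w2, n2⟩ := ext {z1} (by simp)
    obtain ⟨z3, w3, n3⟩ := ext {z1, z2} (lt_of_le_of_lt (card_le_two) (by norm_num))
    obtain ⟨z4, w4, n4⟩ := ext {z1, z2, z3} (lt_of_le_of_lt (card_le_three) (by norm_num))
    simp only [mem_insert, mem_singleton, not_or] at n2 n3 n4
    refine ⟨z1, z2, z3, z4, w1, w2, w3, w4, Ne.symm n2, Ne.symm n3.1, Ne.symm n4.1, Ne.symm n3.2,
      Ne.symm n4.2.1, Ne.symm n4.2.2, trivial, ?_⟩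
    intro z z' _ _ _
    obtain ⟨z3, w3, n3⟩ := ext {z, z'} (lt_of_le_of_lt (card_le_two) (by norm_num))
    obtain ⟨z4, w4, n4⟩ := ext {z, z', z3} (lt_of_le_of_lt (card_le_three) (by norm_num))
    simp only [mem_insert, mem_singleton, not_or] at n3 n4
    exact ⟨z3, z4, w3, w4, n3.1, n3.2, n4.1, n4.2.1, Ne.symm n4.2.2⟩

def mix {k : ℕ} {V : Type*} (x x' : Fin k → V) (A : Fin k → Bool) : Fin k → V :=
  fun i => if A i then x' i else x i

theorem ss_num1 (n f S : ℝ) (k : ℕ) (hn : 0 < n) (h : f ^ 2 ≤ n ^ k * S) :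
    (f / n ^ (k+1)) ^ 2 ≤ (n ^ 2)⁻¹ * (S / n ^ k) := by
  rw [div_pow, div_le_iff₀ (by positivity)]
  refine h.trans (le_of_eq ?_)
  field_simp
  ring

theorem ss_num2 (n S : ℝ) (k : ℕ) (hn : 0 < n) :
    ((n ^ 2)⁻¹ * S) * n ^ (2 * (k + 1)) = S * n ^ (2 * k) := by
  field_simp
  ring

open Classical in
theorem supersat {V : Type*} [Fintype V] (hV : 0 < Fintype.card V) (k : ℕ) :
    ∀ F : Finset (Fin k → V),
    ((F.card : ℝ) / (Fintype.card V : ℝ) ^ k) ^ (2 ^ k) * (Fintype.card V : ℝ) ^ (2 * k) ≤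
      ((univ.filter (fun p : (Fin k → V) × (Fin k → V) => ∀ A, mix p.1 p.2 A ∈ F)).card : ℝ) := by
  set n : ℝ := (Fintype.card V : ℝ) with hn
  have hn0 : 0 < n := by rw [hn]; exact_mod_cast hV
  induction k with
  | zero =>
    intro F
    simp only [pow_zero, pow_one, mul_zero, div_one, mul_one]
    have : F.card ≤ (univ.filter (fun p : (Fin 0 → V) × (Fin 0 → V) => ∀ A, mix p.1 p.2 A ∈ F)).card := by
      apply card_le_card_of_injOn (fun x => (x, x))
      · intro x hx
        simp only [coe_filter, mem_univ, true_and, Set.mem_ofPred_eq]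
        intro A
        have : mix x x A = x := Subsingleton.elim _ _
        rw [this]; exact hx
      · intro x _ y _ h
        exact (Prod.mk.inj h).1
    exact_mod_cast this
  | succ k ih =>
    intro F
    let sl : V → Finset (Fin k → V) := fun u => univ.filter (fun y => (Fin.cons u y : Fin (k+1) → V) ∈ F)
    have hcount : ((univ.filter (fun p : (Fin (k+1) → V) × (Fin (k+1) → V) =>
        ∀ A, mix p.1 p.2 A ∈ F)).card : ℝ) = ∑ u : V × V,
        ((univ.filter (fun p : (Fin k → V) × (Fin k → V) =>
          ∀ A, mix p.1 p.2 A ∈ sl u.1 ∩ sl u.2)).card : ℝ) := by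
      rw [← Nat.cast_sum, Nat.cast_inj, ← card_sigma]
      symm
      refine card_bij (fun q _ => (Fin.cons q.1.1 q.2.1, Fin.cons q.1.2 q.2.2)) ?_ ?_ ?_
      · rintro ⟨⟨u, u'⟩, y, y'⟩ h
        simp only [mem_sigma, mem_univ, true_and, mem_filter, mem_inter, sl] at h ⊢
        intro A
        have h2 := h (fun i => A i.succ)
        have : mix (Fin.cons u y : Fin (k+1) → V) (Fin.cons u' y') A =
            Fin.cons (if A 0 then u' else u) (mix y y' (fun i => A i.succ)) := by
          funext i
          refine Fin.cases ?_ (fun j => ?_) i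
          · simp [mix]
          · simp [mix]
        rw [this]
        split_ifs
        · exact h2.2
        · exact h2.1
      · rintro ⟨⟨u, u'⟩, y, y'⟩ _ ⟨⟨v, v'⟩, z, z'⟩ _ h
        simp only [Prod.mk.injEq, Fin.cons_inj] at h
        obtain ⟨⟨rfl, rfl⟩, rfl, rfl⟩ := h
        rfl
      · rintro ⟨x, x'⟩ h
        simp only [mem_filter, mem_univ, true_and] at h
        refine ⟨⟨(x 0, x' 0), (Fin.tail x, Fin.tail x')⟩, ?_, ?_⟩
        · simp only [mem_sigma, mem_univ, true_and, mem_filter, mem_inter, sl]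
          intro A
          constructor
          · have := h (Fin.cons false A)
            convert this using 1
            funext i
            refine Fin.cases ?_ (fun j => ?_) i
            · simp [mix]
            · simp [mix, Fin.tail]
          · have := h (Fin.cons true A)
            convert this using 1
            funext i
            refine Fin.cases ?_ (fun j => ?_) i
            · simp [mix]
            · simp [mix, Fin.tail]
        · simp
    rw [hcount]
    have h1 : ∑ u : V × V, (((sl u.1 ∩ sl u.2).card : ℝ) / n ^ k) ^ (2 ^ k) * n ^ (2 * k) ≤ ∑ u : V × V,
        ((univ.filter (fun p : (Fin k → V) × (Fin k → V) =>
          ∀ A, mix p.1 p.2 A ∈ sl u.1 ∩ sl u.2)).card : ℝ) := sum_le_sum (fun u _ => ih _)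
    refine le_trans ?_ h1
    have h2 := Real.pow_arith_mean_le_arith_mean_pow (univ : Finset (V × V)) (fun _ => (n ^ 2)⁻¹)
      (fun u => (((sl u.1 ∩ sl u.2).card : ℝ) / n ^ k)) (fun _ _ => by positivity)
      (by
        rw [sum_const, card_univ, Fintype.card_prod, nsmul_eq_mul]
        push_cast
        rw [← hn]
        field_simp) (fun _ _ => by positivity) (2 ^ k)
    rw [← mul_sum, ← mul_sum, ← sum_div] at h2
    -- degree sums
    have hd : (∑ u : V × V, ((sl u.1 ∩ sl u.2).card : ℝ)) =
        ∑ y : Fin k → V, (∑ u : V, if (Fin.cons u y : Fin (k+1) → V) ∈ F then (1:ℝ) else 0) ^ 2 := by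
      have : ∀ u : V × V, ((sl u.1 ∩ sl u.2).card : ℝ) = ∑ y : Fin k → V,
          (if (Fin.cons u.1 y : Fin (k+1) → V) ∈ F then (1:ℝ) else 0) *
          (if (Fin.cons u.2 y : Fin (k+1) → V) ∈ F then (1:ℝ) else 0) := by
        intro u
        simp only [sl]
        rw [← filter_and, card_filter]
        push_cast
        apply sum_congr rfl
        intro y _
        split_ifs <;> simp_all
      rw [sum_congr rfl (fun u _ => this u), sum_comm]
      apply sum_congr rfl
      intro y _
      rw [sq, sum_mul_sum, ← sum_product', univ_product_univ]
    have hF : (F.card : ℝ) = ∑ y : Fin k → V,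
        (∑ u : V, if (Fin.cons u y : Fin (k+1) → V) ∈ F then (1:ℝ) else 0) := by
      rw [sum_comm, ← sum_product', univ_product_univ,
        ← (Fin.consEquiv (fun _ : Fin (k+1) => V)).symm.sum_comp]
      have : (F.card : ℝ) = ∑ x : Fin (k+1) → V, if x ∈ F then (1:ℝ) else 0 := by simp
      rw [this]
      apply sum_congr rfl
      intro x _
      simp [Fin.consEquiv]
    have h3 := sq_sum_le_card_mul_sum_sq (s := (univ : Finset (Fin k → V)))
      (f := fun y => (∑ u : V, if (Fin.cons u y : Fin (k+1) → V) ∈ F then (1:ℝ) else 0))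
    rw [← hF, ← hd, card_univ, Fintype.card_fun, Fintype.card_fin] at h3
    push_cast at h3
    rw [← hn] at h3
    have h4 : ((F.card : ℝ) / n ^ (k+1)) ^ 2 ≤
        (n ^ 2)⁻¹ * ((∑ u : V × V, ((sl u.1 ∩ sl u.2).card : ℝ)) / n ^ k) := by
      exact ss_num1 n _ _ k hn0 h3
    have h5 : ((F.card : ℝ) / n ^ (k+1)) ^ (2 ^ (k+1)) ≤
        ((n ^ 2)⁻¹ * ((∑ u : V × V, ((sl u.1 ∩ sl u.2).card : ℝ)) / n ^ k)) ^ (2 ^ k) := by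
      rw [pow_succ 2 k, mul_comm (2 ^ k) 2, pow_mul]
      exact pow_le_pow_left₀ (by positivity) h4 _
    have h6 := h5.trans h2
    rw [← sum_mul]
    calc _ ≤ ((n ^ 2)⁻¹ * ∑ i : V × V, (((sl i.1 ∩ sl i.2).card : ℝ) / n ^ k) ^ 2 ^ k) * n ^ (2 * (k + 1)) :=
          mul_le_mul_of_nonneg_right h6 (by positivity)
      _ = _ := ss_num2 n _ k hn0

open Classical in
theorem supersat_rich {V : Type*} [Fintype V] (hV : 0 < Fintype.card V) (k : ℕ)
    (F : Finset (Fin k → V)) (δ : ℝ) (hδ : 0 < δ) :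
    ((F.filter (fun x => ((univ.filter (fun x' => ∀ A, mix x x' A ∈ F)).card : ℝ) <
      δ ^ (2 ^ k) * (Fintype.card V : ℝ) ^ k)).card : ℝ) ≤ δ * (Fintype.card V : ℝ) ^ k := by
  set n : ℝ := (Fintype.card V : ℝ) with hn
  have hn0 : 0 < n := by rw [hn]; exact_mod_cast hV
  set F' := (F.filter (fun x => ((univ.filter (fun x' => ∀ A, mix x x' A ∈ F)).card : ℝ) <
      δ ^ (2 ^ k) * n ^ k)) with hF'
  by_contra hcon
  push Not at hcon
  have h1 := supersat hV k F'
  rw [← hn] at h1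
  have h2 : (univ.filter (fun p : (Fin k → V) × (Fin k → V) => ∀ A, mix p.1 p.2 A ∈ F')) ⊆
      (F'.sigma (fun x => univ.filter (fun x' => ∀ A, mix x x' A ∈ F))).map
        (Equiv.sigmaEquivProd _ _).toEmbedding := by
    rintro ⟨x, x'⟩ h
    simp only [mem_filter, mem_univ, true_and] at h
    simp only [mem_map, mem_sigma, mem_filter, mem_univ, true_and]
    refine ⟨⟨x, x'⟩, ⟨?_, fun A => ?_⟩, rfl⟩
    · have := h (fun _ => false)
      have e : mix x x' (fun _ => false) = x := by funext i; simp [mix]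
      rwa [e] at this
    · exact (mem_filter.1 (h A)).1
  have h3 := card_le_card h2
  rw [card_map, card_sigma] at h3
  have h4 : (∑ x ∈ F', ((univ.filter (fun x' => ∀ A, mix x x' A ∈ F)).card : ℝ)) ≤
      ∑ x ∈ F', δ ^ (2 ^ k) * n ^ k := sum_le_sum (fun x hx => (mem_filter.1 hx).2.le)
  rw [sum_const, nsmul_eq_mul] at h4
  have h5 : ((F'.card : ℝ) / n ^ k) ^ (2 ^ k) * n ^ (2 * k) ≤ F'.card * (δ ^ 2 ^ k * n ^ k) := by
    refine h1.trans (le_trans ?_ h4)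
    exact_mod_cast h3
  have h6 : δ < (F'.card : ℝ) / n ^ k := by rw [lt_div_iff₀ (by positivity)]; exact hcon
  have h7 : δ ^ (2 ^ k) < ((F'.card : ℝ) / n ^ k) ^ (2 ^ k) :=
    pow_lt_pow_left₀ h6 hδ.le (by positivity)
  have h8 : (F'.card : ℝ) ≤ n ^ k := by
    have := card_le_univ F'
    rw [Fintype.card_fun, Fintype.card_fin] at this
    rw [hn]; exact_mod_cast this
  have h9 : F'.card * (δ ^ 2 ^ k * n ^ k) ≤ δ ^ 2 ^ k * n ^ (2 * k) := by
    have : δ ^ 2 ^ k * n ^ (2 * k) = n ^ k * (δ ^ 2 ^ k * n ^ k) := by ring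
    rw [this]
    exact mul_le_mul_of_nonneg_right h8 (by positivity)
  have h10 := mul_lt_mul_of_pos_right h7 (show 0 < n ^ (2 * k) by positivity)
  linarith

open Classical in
theorem decomp {X : Type*} [Fintype X] (hX : 0 < Fintype.card X) (Γ : X → X → Prop)
    (Γs : ∀ r s, Γ r s → Γ s r) (κ ξ : ℝ) (hκ : 0 < κ) (hκ1 : κ ≤ 1) (hξ : 0 < ξ) (K : ℕ)
    (hK : 1 / κ < K) :
    ∃ lab : X → Fin K,
      ((univ.filter (fun p : X × X => Γ p.1 p.2 ∧ lab p.1 ≠ lab p.2)).card : ℝ) ≤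
        ξ / κ * (Fintype.card X : ℝ) ^ 2 ∧
      ∀ P1 P2 : Finset X, ∀ ℓ, Disjoint P1 P2 → (∀ r, lab r = ℓ ↔ (r ∈ P1 ∨ r ∈ P2)) →
        κ * Fintype.card X ≤ P1.card → κ * Fintype.card X ≤ P2.card →
        ξ / 2 * (Fintype.card X : ℝ) ^ 2 ≤
          ((P1 ×ˢ P2).filter (fun p => Γ p.1 p.2)).card := by
  set N : ℝ := (Fintype.card X : ℝ) with hN
  have hN0 : 0 < N := by rw [hN]; exact_mod_cast hX
  have hK0 : 0 < K := by
    have : (0:ℝ) < K := lt_trans (by positivity) hK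
    exact_mod_cast this
  let good : (X → Fin K) → Prop := fun lab => ∀ ℓ, (∃ r, lab r = ℓ) →
    κ * N ≤ (univ.filter (fun r => lab r = ℓ)).card
  let cr : (X → Fin K) → Finset (X × X) := fun lab =>
    univ.filter (fun p : X × X => Γ p.1 p.2 ∧ lab p.1 ≠ lab p.2)
  let Φ : (X → Fin K) → ℝ := fun lab => ξ * N ^ 2 * (univ.image lab).card - (cr lab).card
  have hgood0 : good (fun _ => ⟨0, hK0⟩) := by
    rintro ℓ ⟨r, rfl⟩
    simp only [filter_true, card_univ, ← hN]
    nlinarith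
  obtain ⟨lab, hlab, hmax⟩ := exists_max_image (univ.filter good) Φ ⟨_, mem_filter.2 ⟨mem_univ _, hgood0⟩⟩
  replace hlab := (mem_filter.1 hlab).2
  replace hmax : ∀ lab', good lab' → Φ lab' ≤ Φ lab := fun l h => hmax l (mem_filter.2 ⟨mem_univ _, h⟩)
  have hcls : ((univ.image lab).card : ℝ) ≤ 1 / κ := by
    rw [le_div_iff₀ hκ]
    have h1 : (Fintype.card X) = ∑ ℓ ∈ univ.image lab, (univ.filter (fun r => lab r = ℓ)).card := by
      rw [← card_univ]
      exact card_eq_sum_card_image lab univ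
    have h2 : ∑ ℓ ∈ univ.image lab, κ * N ≤ N := by
      conv_rhs => rw [hN, h1]
      push_cast
      apply sum_le_sum
      intro ℓ hℓ
      obtain ⟨r, -, hr⟩ := mem_image.1 hℓ
      exact hlab ℓ ⟨r, hr⟩
    rw [sum_const, nsmul_eq_mul] at h2
    have h3 : ((univ.image lab).card : ℝ) * κ * N ≤ 1 * N := by linarith
    exact le_of_mul_le_mul_right h3 hN0
  refine ⟨lab, ?_, ?_⟩
  · have h1 := hmax _ hgood0
    have h2 : Φ (fun _ => ⟨0, hK0⟩) = ξ * N ^ 2 := by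
      simp only [Φ, cr]
      have e1 : (univ.filter (fun p : X × X => Γ p.1 p.2 ∧ (⟨0, hK0⟩ : Fin K) ≠ ⟨0, hK0⟩)) = ∅ := by
        ext; simp
      have : Nonempty X := Fintype.card_pos_iff.1 hX
      rw [e1, image_const univ_nonempty]
      simp
    rw [h2] at h1
    have h3 : ((cr lab).card : ℝ) ≤ ξ * N ^ 2 * (univ.image lab).card - ξ * N ^ 2 := by
      simp only [Φ] at h1
      linarith
    have h4 : ξ * N ^ 2 * (univ.image lab).card ≤ ξ * N ^ 2 * (1 / κ) :=
      mul_le_mul_of_nonneg_left hcls (by positivity)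
    have h5 : ξ / κ * N ^ 2 = ξ * N ^ 2 * (1 / κ) := by ring
    rw [h5]
    have : 0 ≤ ξ * N ^ 2 := by positivity
    exact h3.trans (by linarith)
  · intro P1 P2 ℓ hd hu0 hP1 hP2
    have hu : P1 ∪ P2 = univ.filter (fun r => lab r = ℓ) := by
      ext r; simp [hu0]
    have hlt : (univ.image lab).card < K := by
      have := lt_of_le_of_lt hcls hK
      exact_mod_cast this
    obtain ⟨ν, hν⟩ : ∃ ν, ν ∉ univ.image lab := by
      by_contra hh
      push Not at hh
      have : univ.image lab = univ := by ext; simp only [hh, mem_univ]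
      rw [this, card_univ, Fintype.card_fin] at hlt
      omega
    have hν' : ∀ r, lab r ≠ ν := fun r hr => hν (mem_image.2 ⟨r, mem_univ _, hr⟩)
    let lab' : X → Fin K := fun r => if r ∈ P1 then ν else lab r
    have hP1ℓ : ∀ r ∈ P1, lab r = ℓ := by
      intro r hr
      have : r ∈ P1 ∪ P2 := mem_union_left _ hr
      rw [hu] at this
      exact (mem_filter.1 this).2
    have hcard : ∀ P : Finset X, κ * N ≤ P.card → P.Nonempty := by
      intro P hP
      rw [← card_pos]
      have : (0:ℝ) < P.card := lt_of_lt_of_le (by positivity) hP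
      exact_mod_cast this
    obtain ⟨p1, hp1⟩ := hcard P1 hP1
    obtain ⟨p2, hp2⟩ := hcard P2 hP2
    have hcl : ∀ ℓ', ℓ' ≠ ν → ℓ' ≠ ℓ → univ.filter (fun r => lab' r = ℓ') = univ.filter (fun r => lab r = ℓ') := by
      intro ℓ' h1 h2
      ext r
      simp only [mem_filter, mem_univ, true_and, lab']
      split_ifs with hr
      · rw [hP1ℓ r hr]
        constructor
        · intro e; exact absurd e.symm h1
        · intro e; exact absurd e.symm h2
      · rfl
    have hclν : univ.filter (fun r => lab' r = ν) = P1 := by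
      ext r
      simp only [mem_filter, mem_univ, true_and, lab']
      split_ifs with hr
      · simp [hr]
      · simp [hr, hν']
    have hℓν : ℓ ≠ ν := by rw [← hP1ℓ p1 hp1]; exact hν' _
    have hclℓ : univ.filter (fun r => lab' r = ℓ) = P2 := by
      ext r
      have h1 : r ∈ P1 ∪ P2 ↔ lab r = ℓ := by rw [hu]; simp
      simp only [mem_filter, mem_univ, true_and, lab']
      split_ifs with hr
      · constructor
        · intro e; exact absurd e.symm hℓν
        · intro e; exact absurd e (disjoint_left.1 hd hr)
      · rw [← h1, mem_union]
        tauto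
    have hgood' : good lab' := by
      rintro ℓ' ⟨r, hr⟩
      by_cases e1 : ℓ' = ν
      · rw [e1, hclν]; exact hP1
      by_cases e2 : ℓ' = ℓ
      · rw [e2, hclℓ]; exact hP2
      rw [hcl ℓ' e1 e2]
      apply hlab ℓ'
      have : r ∈ univ.filter (fun r => lab' r = ℓ') := by simp [hr]
      rw [hcl ℓ' e1 e2] at this
      exact ⟨r, (mem_filter.1 this).2⟩
    have himg : univ.image lab' = insert ν (univ.image lab) := by
      ext ℓ'
      have key : ∀ f : X → Fin K, ℓ' ∈ univ.image f ↔ (univ.filter (fun r => f r = ℓ')).Nonempty := by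
        intro f
        simp [Finset.Nonempty]
      rw [mem_insert, key, key]
      by_cases e1 : ℓ' = ν
      · rw [e1, hclν]; simp [show P1.Nonempty from ⟨p1, hp1⟩]
      by_cases e2 : ℓ' = ℓ
      · rw [e2, hclℓ, ← hu]; simp [show P2.Nonempty from ⟨p2, hp2⟩]
      rw [hcl ℓ' e1 e2]; simp [e1]
    have h1 := hmax lab' hgood'
    simp only [Φ] at h1
    rw [himg, card_insert_of_notMem hν] at h1
    have h2 : cr lab' ⊆ cr lab ∪ ((P1 ×ˢ P2).filter (fun p => Γ p.1 p.2) ∪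
        ((P1 ×ˢ P2).filter (fun p => Γ p.1 p.2)).image Prod.swap) := by
      rintro ⟨r, s⟩ h
      simp only [cr, mem_filter, mem_univ, true_and] at h
      obtain ⟨hΓ, hne⟩ := h
      by_cases hl : lab r = lab s
      · have memP2 : ∀ u v, u ∈ P1 → v ∉ P1 → lab u = lab v → v ∈ P2 := by
          intro u v hu' hv huv
          have : v ∈ P1 ∪ P2 := by
            rw [hu, mem_filter]; exact ⟨mem_univ _, by rw [← huv, hP1ℓ u hu']⟩
          exact (mem_union.1 this).resolve_left hv
        apply mem_union_right
        by_cases hr : r ∈ P1 <;> by_cases hs : s ∈ P1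
        · simp [lab', hr, hs] at hne
        · apply mem_union_left
          exact mem_filter.2 ⟨mem_product.2 ⟨hr, memP2 r s hr hs hl⟩, hΓ⟩
        · apply mem_union_right
          exact mem_image.2 ⟨(s, r), mem_filter.2 ⟨mem_product.2 ⟨hs, memP2 s r hs hr hl.symm⟩,
            Γs _ _ hΓ⟩, rfl⟩
        · simp [lab', hr, hs, hl] at hne
      · apply mem_union_left
        simp [cr, hΓ, hl]
    have h3 := (card_le_card h2).trans (card_union_le _ _)
    have h4 := card_union_le ((P1 ×ˢ P2).filter (fun p => Γ p.1 p.2))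
      (((P1 ×ˢ P2).filter (fun p => Γ p.1 p.2)).image Prod.swap)
    have h5 := card_image_le (s := (P1 ×ˢ P2).filter (fun p => Γ p.1 p.2)) (f := Prod.swap)
    have h6 : (cr lab').card ≤ (cr lab).card + 2 * ((P1 ×ˢ P2).filter (fun p => Γ p.1 p.2)).card := by
      omega
    have h7 : ((cr lab').card : ℝ) ≤ (cr lab).card + 2 * (((P1 ×ˢ P2).filter (fun p => Γ p.1 p.2)).card : ℝ) := by
      exact_mod_cast h6
    push_cast at h1
    linarith

def Gm {V : Type*} (Col : (Fin 4 → V) → Prop) (r s : Fin 4 → V) : Prop := ∀ A, Col (mix r s A)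

theorem Gm_symm {V : Type*} (Col : (Fin 4 → V) → Prop) (r s : Fin 4 → V) (h : Gm Col r s) :
    Gm Col s r := by
  intro A
  have := h (fun i => !A i)
  convert this using 1
  funext i
  simp only [mix]
  by_cases h : A i = true
  · simp [h]
  · simp [h]

open Classical in
theorem touch_card {V : Type*} [Fintype V] (X0 : Finset V) :
    (univ.filter (fun z : Fin 4 → V => ∃ i, z i ∈ X0)).card ≤ 4 * (X0.card * Fintype.card V ^ 3) := by
  have h1 : (univ.filter (fun z : Fin 4 → V => ∃ i, z i ∈ X0)) ⊆
      univ.biUnion (fun i : Fin 4 => Fintype.piFinset (fun j => if j = i then X0 else univ)) := by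
    intro z hz
    obtain ⟨i, hi⟩ := (mem_filter.1 hz).2
    refine mem_biUnion.2 ⟨i, mem_univ _, Fintype.mem_piFinset.2 fun j => ?_⟩
    split_ifs with h
    · rw [h]; exact hi
    · exact mem_univ _
  refine (card_le_card h1).trans (card_biUnion_le.trans ?_)
  have h2 : ∀ i : Fin 4, (Fintype.piFinset (fun j : Fin 4 => if j = i then X0 else univ)).card =
      X0.card * Fintype.card V ^ 3 := by
    intro i
    rw [Fintype.card_piFinset, Fin.prod_univ_four]
    fin_cases i <;> simp <;> ring
  rw [sum_congr rfl (fun i _ => h2 i)]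
  simp

def rowDisj {V : Type*} (r s : Fin 4 → V) : Prop := ∀ i j, r i ≠ s j

open Classical in
theorem connect {V : Type*} [Fintype V] (Col : (Fin 4 → V) → Prop) (r : Fin 4 → V)
    (A : ℕ → Finset (Fin 4 → V)) (θ : ℝ) (h0 : ∀ z ∈ A 0, Gm Col r z)
    (hA : ∀ i, ∀ z ∈ A (i+1), z ∈ A 0 ∨
      θ * (Fintype.card V : ℝ) ^ 4 ≤ ((A i).filter (fun s => Gm Col z s)).card) (i : ℕ) :
    ∀ y, θ * (Fintype.card V : ℝ) ^ 4 ≤ ((A i).filter (fun s => Gm Col y s)).card →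
    ∀ X0 : Finset V, 4 * ((X0.card : ℝ) + 4 * i) < θ * (Fintype.card V : ℝ) →
    ∃ l : List (Fin 4 → V), List.IsChain (Gm Col) (y :: (l ++ [r])) ∧
      (∀ z ∈ l, ∀ j, z j ∉ X0) ∧ l.Pairwise rowDisj ∧ l.length ≤ i + 1 := by
  have pick : ∀ (i : ℕ) (y : Fin 4 → V),
      θ * (Fintype.card V : ℝ) ^ 4 ≤ ((A i).filter (fun s => Gm Col y s)).card →
      ∀ X0 : Finset V, 4 * (X0.card : ℝ) < θ * (Fintype.card V : ℝ) →
      ∃ z ∈ A i, Gm Col y z ∧ ∀ j, z j ∉ X0 := by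
    intro i y hy X0 hX
    by_contra hcon
    push Not at hcon
    have h1 : (A i).filter (fun s => Gm Col y s) ⊆ (univ.filter (fun z : Fin 4 → V => ∃ i, z i ∈ X0)) := by
      intro z hz
      rw [mem_filter] at hz
      exact mem_filter.2 ⟨mem_univ _, hcon z hz.1 hz.2⟩
    have h2 := (card_le_card h1).trans (touch_card X0)
    have h3 : (((A i).filter (fun s => Gm Col y s)).card : ℝ) ≤ 4 * (X0.card * (Fintype.card V : ℝ) ^ 3) := by
      exact_mod_cast h2
    have hn : 0 < (Fintype.card V : ℝ) := by
      rcases Nat.eq_zero_or_pos (Fintype.card V) with h | h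
      · rw [h] at hX
        have : (0:ℝ) ≤ X0.card := Nat.cast_nonneg _
        simp at hX
        linarith
      · exact_mod_cast h
    have h4 := mul_lt_mul_of_pos_right hX (show 0 < (Fintype.card V : ℝ) ^ 3 by positivity)
    nlinarith
  induction i with
  | zero =>
    intro y hy X0 hX
    obtain ⟨z, hz, hyz, hzX⟩ := pick 0 y hy X0 (by simpa using hX)
    refine ⟨[z], ?_, ?_, by simp, by simp⟩
    · simp [hyz, Gm_symm _ _ _ (h0 z hz)]
    · simpa using hzX
  | succ i ih =>
    intro y hy X0 hX
    push_cast at hX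
    have hi : (0:ℝ) ≤ i := Nat.cast_nonneg _
    obtain ⟨z, hz, hyz, hzX⟩ := pick (i+1) y hy X0 (by linarith)
    rcases hA i z hz with hz0 | hzi
    · refine ⟨[z], ?_, ?_, by simp, by simp⟩
      · simp [hyz, Gm_symm _ _ _ (h0 z hz0)]
      · simpa using hzX
    · have hc : ((X0 ∪ univ.image z).card : ℝ) ≤ X0.card + 4 := by
        have h1 := card_union_le X0 (univ.image z)
        have h2 : (univ.image z).card ≤ 4 := by
          simpa using card_image_le (s := (univ : Finset (Fin 4))) (f := z)
        exact_mod_cast (by omega : (X0 ∪ univ.image z).card ≤ X0.card + 4)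
      obtain ⟨l, l1, l2, l3, l4⟩ := ih z hzi (X0 ∪ univ.image z) (by linarith)
      refine ⟨z :: l, ?_, ?_, ?_, by simpa using l4⟩
      · rw [List.cons_append, List.isChain_cons_cons]
        exact ⟨hyz, l1⟩
      · intro x hx
        rcases List.mem_cons.1 hx with rfl | hx
        · exact hzX
        · intro j hj
          exact l2 x hx j (mem_union_left _ hj)
      · rw [List.pairwise_cons]
        refine ⟨fun x hx a b hab => ?_, l3⟩
        exact l2 x hx b (mem_union_right _ (mem_image.2 ⟨a, mem_univ _, hab⟩))

set_option maxHeartbeats 1000000 in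
open Classical in
theorem robust {δ : ℝ} (hδ : 0 < δ) (hδ1 : δ ≤ 1) (K : ℕ) (hK : 4 / δ ^ 32 < K) :
    ∃ η : ℝ, 0 < η ∧ ∃ L n0 : ℕ, ∀ (V : Type) [Fintype V], 0 < Fintype.card V →
    ∀ Col : (Fin 4 → V) → Prop,
    ∃ (lab : (Fin 4 → V) → Fin K) (Typ : (Fin 4 → V) → Prop),
      (∀ r, Typ r → Col r) ∧
      ((univ.filter (fun r => Col r ∧ ¬ Typ r)).card : ℝ) ≤ 2 * δ * (Fintype.card V : ℝ) ^ 4 ∧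
      (∀ r r', Typ r → Typ r' → δ ^ 32 * (Fintype.card V : ℝ) ^ 4 ≤
        (univ.filter (fun s => Gm Col r s ∧ Gm Col r' s)).card → lab r = lab r') ∧
      (n0 ≤ Fintype.card V → ∀ r r', Typ r → Typ r' → lab r = lab r' → ∀ X0 : Finset V,
        (X0.card : ℝ) ≤ η * Fintype.card V →
        ∃ l : List (Fin 4 → V), List.IsChain (Gm Col) (r :: (l ++ [r'])) ∧
          (∀ z ∈ l, ∀ j, z j ∉ X0) ∧ l.Pairwise rowDisj ∧ l.length ≤ L) := by
  set c : ℝ := δ ^ 32 with hc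
  have hc0 : 0 < c := by positivity
  have hc1 : c ≤ 1 := pow_le_one₀ hδ.le hδ1
  set ξ : ℝ := δ * c ^ 2 / 16 with hξ
  have hξ0 : 0 < ξ := by positivity
  have hξc : ξ ≤ c / 16 := by
    have : δ * c ^ 2 ≤ c := by
      have h1 : δ * c ≤ 1 := by nlinarith
      nlinarith
    rw [hξ]; linarith
  obtain ⟨J, hJ⟩ := exists_nat_gt (4 / ξ)
  obtain ⟨n0, hn0⟩ := exists_nat_gt ((16 * J + 1) / (ξ / 8))
  refine ⟨ξ / 32, by positivity, J + 1, n0, ?_⟩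
  intro V _ hV Col
  set n : ℝ := (Fintype.card V : ℝ) with hn
  have hnp : 0 < n := by rw [hn]; exact_mod_cast hV
  have hXc : ((Fintype.card (Fin 4 → V) : ℕ) : ℝ) = n ^ 4 := by
    rw [Fintype.card_fun, Fintype.card_fin]; push_cast; rfl
  obtain ⟨lab, hcr, hsplit⟩ := decomp (X := Fin 4 → V)
    (by rw [Fintype.card_fun, Fintype.card_fin]; positivity) (Gm Col) (Gm_symm Col) (c / 4) ξ
    (by positivity) (by linarith) hξ0 K (by rw [one_div_div]; exact hK)
  rw [hXc] at hcr hsplit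
  set N : ℝ := n ^ 4 with hN
  have hNp : 0 < N := by positivity
  let cn : (Fin 4 → V) → Finset (Fin 4 → V) := fun r =>
    univ.filter (fun s => Gm Col r s ∧ lab r ≠ lab s)
  let nb : (Fin 4 → V) → Finset (Fin 4 → V) := fun r => univ.filter (fun s => Gm Col r s)
  obtain ⟨Typ, hTyp⟩ : ∃ Typ : (Fin 4 → V) → Prop, ∀ r, Typ r ↔
    (Col r ∧ c * N ≤ (nb r).card ∧ ((cn r).card : ℝ) ≤ c / 4 * N) := ⟨_, fun r => Iff.rfl⟩
  refine ⟨lab, Typ, fun r h => ((hTyp r).1 h).1, ?_, ?_, ?_⟩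
  · -- count non-typical
    have h1 : univ.filter (fun r => Col r ∧ ¬ Typ r) ⊆
        ((univ.filter Col).filter (fun x => ((univ.filter (fun x' => ∀ A, mix x x' A ∈ univ.filter Col)).card : ℝ) <
          δ ^ (2 ^ 4) * n ^ 4)) ∪ univ.filter (fun r => c / 4 * N < ((cn r).card : ℝ)) := by
      intro r hr
      obtain ⟨hr1, hr2⟩ := (mem_filter.1 hr).2
      by_contra hcon
      rw [mem_union, not_or] at hcon
      apply hr2
      rw [hTyp]
      refine ⟨hr1, ?_, ?_⟩
      · have := hcon.1
        rw [mem_filter, not_and] at this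
        have h2 := this (by simp [hr1])
        push Not at h2
        have e : univ.filter (fun x' => ∀ A, mix r x' A ∈ univ.filter Col) = nb r := by
          ext x
          constructor
          · intro h
            exact mem_filter.2 ⟨mem_univ _, fun A => (mem_filter.1 ((mem_filter.1 h).2 A)).2⟩
          · intro h
            exact mem_filter.2 ⟨mem_univ _, fun A =>
              mem_filter.2 ⟨mem_univ _, (mem_filter.1 h).2 A⟩⟩
        rw [e] at h2
        refine le_trans ?_ h2
        apply mul_le_mul_of_nonneg_right _ hNp.le
        rw [hc]
        exact pow_le_pow_of_le_one hδ.le hδ1 (by norm_num)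
      · have := hcon.2
        simpa using this
    have h2 := (card_le_card h1).trans (card_union_le _ _)
    have h3 := supersat_rich hV 4 (univ.filter Col) δ hδ
    rw [← hn] at h3
    have h3' : (((univ.filter Col).filter (fun x => ((univ.filter (fun x' => ∀ A, mix x x' A ∈ univ.filter Col)).card : ℝ) <
          δ ^ (2 ^ 4) * n ^ 4)).card : ℝ) ≤ δ * n ^ 4 := by
      convert h3
    have h4 : ((univ.filter (fun r => c / 4 * N < ((cn r).card : ℝ))).card : ℝ) * (c / 4 * N) ≤
        ξ / (c / 4) * N ^ 2 := by
      refine le_trans ?_ hcr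
      have e1 : (univ.filter (fun p : (Fin 4 → V) × (Fin 4 → V) => Gm Col p.1 p.2 ∧ lab p.1 ≠ lab p.2)).card =
          ∑ r, (cn r).card := by
        rw [← card_sigma]
        apply card_bij (fun p _ => ⟨p.1, p.2⟩)
        · rintro ⟨r, s⟩ h
          simpa [cn] using h
        · rintro ⟨r, s⟩ _ ⟨r', s'⟩ _ h
          simp only [Sigma.mk.injEq, heq_eq_eq] at h
          rw [h.1, h.2]
        · rintro ⟨r, s⟩ h
          exact ⟨(r, s), by simpa [cn] using h, rfl⟩
      rw [e1]
      push_cast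
      rw [← nsmul_eq_mul, ← sum_const]
      refine le_trans (sum_le_sum (fun r hr => (mem_filter.1 hr).2.le)) ?_
      exact sum_le_sum_of_subset_of_nonneg (filter_subset _ _) (fun _ _ _ => Nat.cast_nonneg _)
    have h5 : ((univ.filter (fun r => c / 4 * N < ((cn r).card : ℝ))).card : ℝ) ≤ δ * N := by
      have e : ξ / (c / 4) * N ^ 2 = (δ * N) * (c / 4 * N) := by
        rw [hξ]; field_simp; ring
      rw [e] at h4
      exact le_of_mul_le_mul_right h4 (by positivity)
    have h6 : ((univ.filter (fun r => Col r ∧ ¬ Typ r)).card : ℝ) ≤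
        (((univ.filter Col).filter (fun x => ((univ.filter (fun x' => ∀ A, mix x x' A ∈ univ.filter Col)).card : ℝ) <
          δ ^ (2 ^ 4) * n ^ 4)).card : ℝ) + ((univ.filter (fun r => c / 4 * N < ((cn r).card : ℝ))).card : ℝ) := by
      exact_mod_cast h2
    have h8 : δ * n ^ 4 + δ * N = 2 * δ * N := by rw [hN]; ring
    have h9 := h6.trans (add_le_add h3' h5)
    rw [h8] at h9
    refine le_trans (le_of_eq ?_) h9
    congr
  · intro r r' htr htr' hcom
    obtain ⟨_, _, hr⟩ := (hTyp r).1 htr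
    obtain ⟨_, _, hr'⟩ := (hTyp r').1 htr'
    have : ∃ s, Gm Col r s ∧ Gm Col r' s ∧ s ∉ cn r ∪ cn r' := by
      by_contra hcon
      push Not at hcon
      have h1 : univ.filter (fun s => Gm Col r s ∧ Gm Col r' s) ⊆ cn r ∪ cn r' := by
        intro s hs
        have := (mem_filter.1 hs).2
        exact hcon s this.1 this.2
      have h2 : ((univ.filter (fun s => Gm Col r s ∧ Gm Col r' s)).card : ℝ) ≤ (cn r).card + (cn r').card := by
        exact_mod_cast (card_le_card h1).trans (card_union_le _ _)
      nlinarith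
    obtain ⟨s, h1, h2, h3⟩ := this
    simp only [cn, mem_union, mem_filter, mem_univ, true_and, not_or, not_and, not_not] at h3
    rw [h3.1 h1, h3.2 h2]
  · intro hcard r' r hr' hr hlab X0 hX0
    have hbig : 16 * (J:ℝ) + 1 < ξ / 8 * n := by
      rw [div_lt_iff₀ (by positivity)] at hn0
      have : (n0 : ℝ) ≤ n := by rw [hn]; exact_mod_cast hcard
      nlinarith
    let P : Finset (Fin 4 → V) := univ.filter (fun s => lab s = lab r)
    obtain ⟨A, hA0, hAs⟩ : ∃ A : ℕ → Finset (Fin 4 → V), A 0 = P.filter (fun s => Gm Col r s) ∧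
        ∀ i, A (i+1) = A 0 ∪
          P.filter (fun z => ξ / 4 * N ≤ ((A i).filter (fun s => Gm Col z s)).card) :=
      ⟨fun i => Nat.rec (P.filter (fun s => Gm Col r s))
        (fun _ B => P.filter (fun s => Gm Col r s) ∪
        P.filter (fun z => ξ / 4 * N ≤ (B.filter (fun s => Gm Col z s)).card)) i, rfl, fun i => rfl⟩
    have hAmono : ∀ i, A i ⊆ A (i+1) := by
      intro i
      induction i with
      | zero => rw [hAs 0]; exact subset_union_left
      | succ i ih =>
        intro z hz
        rw [hAs i] at hz
        rw [hAs (i+1)]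
        rcases mem_union.1 hz with hz | hz
        · exact mem_union_left _ hz
        apply mem_union_right
        rw [mem_filter] at hz ⊢
        refine ⟨hz.1, hz.2.trans ?_⟩
        have := card_le_card (filter_subset_filter (fun s => Gm Col z s) ih)
        exact_mod_cast this
    have hAP : ∀ i, A i ⊆ P := by
      intro i
      cases i with
      | zero => rw [hA0]; exact filter_subset _ _
      | succ i => rw [hAs, hA0]; exact union_subset (filter_subset _ _) (filter_subset _ _)
    have hdeg : ∀ y, Typ y → lab y = lab r → 3 * c / 4 * N ≤ (P.filter (fun s => Gm Col y s)).card := by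
      intro y hty hy
      obtain ⟨_, h1, h2⟩ := (hTyp y).1 hty
      have h3 : nb y ⊆ P.filter (fun s => Gm Col y s) ∪ cn y := by
        intro s hs
        have hs := (mem_filter.1 hs).2
        by_cases e : lab y = lab s
        · apply mem_union_left; simp [P, hs, ← e, hy]
        · apply mem_union_right; simp [cn, hs, e]
      have h4 : ((nb y).card : ℝ) ≤ (P.filter (fun s => Gm Col y s)).card + (cn y).card := by
        exact_mod_cast (card_le_card h3).trans (card_union_le _ _)
      linarith
    have hA0c : ∀ i, c / 4 * N ≤ (A i).card := by
      intro i
      have h1 : A 0 ⊆ A i := by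
        induction i with
        | zero => exact subset_rfl
        | succ i ih => exact ih.trans (hAmono i)
      have h2 : ((A 0).card : ℝ) ≤ (A i).card := by exact_mod_cast card_le_card h1
      have h3 := hdeg r hr rfl
      rw [← hA0] at h3
      nlinarith
    have hgrow : ∀ i, c / 4 * N ≤ (P \ A i).card → ((A i).card : ℝ) + ξ / 4 * N ≤ (A (i+1)).card := by
      intro i hi
      have h1 := hsplit (P \ A i) (A i) (lab r) sdiff_disjoint (fun x => by
        have e1 : x ∈ P ↔ lab x = lab r := by simp [P]
        have e2 := @hAP i x
        rw [mem_sdiff, e1] at *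
        tauto) hi (hA0c i)
      have e1 : (((P \ A i) ×ˢ A i).filter (fun p => Gm Col p.1 p.2)).card =
          ∑ z ∈ P \ A i, ((A i).filter (fun s => Gm Col z s)).card := by
        rw [← card_sigma]
        apply card_bij (fun p _ => ⟨p.1, p.2⟩)
        · rintro ⟨r, s⟩ h
          simp only [mem_filter, mem_product, mem_sigma] at h ⊢
          tauto
        · rintro ⟨r, s⟩ _ ⟨r', s'⟩ _ h
          simp only [Sigma.mk.injEq, heq_eq_eq] at h
          rw [h.1, h.2]
        · rintro ⟨r, s⟩ h
          simp only [mem_filter, mem_sigma] at h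
          exact ⟨(r, s), by simp only [mem_filter, mem_product]; tauto, rfl⟩
      rw [e1] at h1
      push_cast at h1
      set Q := (P \ A i).filter (fun z => ξ / 4 * N ≤ ((A i).filter (fun s => Gm Col z s)).card) with hQ
      have hub : ∀ B : Finset (Fin 4 → V), (B.card : ℝ) ≤ N := by
        intro B
        rw [← hXc]; exact_mod_cast card_le_univ B
      have h2 : ∑ z ∈ P \ A i, (((A i).filter (fun s => Gm Col z s)).card : ℝ) ≤ Q.card * N + N * (ξ / 4 * N) := by
        rw [← sum_filter_add_sum_filter_not (P \ A i) (fun z => ξ / 4 * N ≤ ((A i).filter (fun s => Gm Col z s)).card)]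
        apply add_le_add
        · rw [← nsmul_eq_mul, ← sum_const]
          exact sum_le_sum (fun z _ => hub _)
        · refine le_trans (sum_le_sum (fun z hz => (not_le.1 (mem_filter.1 hz).2).le)) ?_
          rw [sum_const, nsmul_eq_mul]
          exact mul_le_mul_of_nonneg_right (hub _) (by positivity)
      have h3 : ξ / 4 * N ≤ Q.card := by
        have : (ξ / 4 * N) * N ≤ Q.card * N := by nlinarith
        exact le_of_mul_le_mul_right this hNp
      have h4 : A i ∪ Q ⊆ A (i+1) := by
        apply union_subset (hAmono i)
        rw [hAs]
        exact subset_trans (filter_subset_filter _ sdiff_subset) subset_union_right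
      have h5 : Disjoint (A i) Q :=
        disjoint_sdiff.mono_right (filter_subset _ _)
      have h6 := card_le_card h4
      rw [card_union_of_disjoint h5] at h6
      have h7 : ((A i).card : ℝ) + Q.card ≤ (A (i+1)).card := by exact_mod_cast h6
      linarith
    have hex : ∃ i ≤ J, ((P \ A i).card : ℝ) < c / 4 * N := by
      by_contra hcon
      push Not at hcon
      have : ∀ i ≤ J, (i : ℝ) * (ξ / 4 * N) ≤ (A i).card := by
        intro i
        induction i with
        | zero => intro _; simp
        | succ i ih =>
          intro hi
          have h1 := ih (by omega)
          have h2 := hgrow i (hcon i (by omega))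
          push_cast
          linarith
      have h1 := this J le_rfl
      have h2 : ((A J).card : ℝ) ≤ N := by
        rw [← hXc]; exact_mod_cast card_le_univ _
      rw [div_lt_iff₀ hξ0] at hJ
      nlinarith
    obtain ⟨i, hiJ, hi⟩ := hex
    have hr'A : ξ / 4 * n ^ 4 ≤ ((A i).filter (fun s => Gm Col r' s)).card := by
      have h1 := hdeg r' hr' hlab
      have h2 : P.filter (fun s => Gm Col r' s) ⊆ (A i).filter (fun s => Gm Col r' s) ∪ (P \ A i) := by
        intro s hs
        rw [mem_filter] at hs
        by_cases e : s ∈ A i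
        · exact mem_union_left _ (mem_filter.2 ⟨e, hs.2⟩)
        · exact mem_union_right _ (mem_sdiff.2 ⟨hs.1, e⟩)
      have h3 : ((P.filter (fun s => Gm Col r' s)).card : ℝ) ≤
          ((A i).filter (fun s => Gm Col r' s)).card + (P \ A i).card := by
        exact_mod_cast (card_le_card h2).trans (card_union_le _ _)
      rw [← hN]
      nlinarith
    obtain ⟨l, l1, l2, l3, l4⟩ := connect Col r A (ξ / 4) (fun z hz => by rw [hA0] at hz; exact (mem_filter.1 hz).2)
      (by
        intro j z hz
        rw [hAs] at hz
        rcases mem_union.1 hz with h | h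
        · exact Or.inl h
        · exact Or.inr (mem_filter.1 h).2) i r' hr'A X0 (by
          rw [← hn]
          have : (i : ℝ) ≤ J := by exact_mod_cast hiJ
          nlinarith)
    exact ⟨l, l1, l2, l3, by omega⟩

open Classical in
theorem kst (k : ℕ) : ∀ (ρ : ℝ), 0 < ρ → ∀ m : ℕ, ∃ M0 : ℕ, ∀ M : ℕ, M0 ≤ M →
    ∀ A : Finset (Fin k → Fin M), ρ * (M : ℝ) ^ k ≤ A.card →
    ∃ S : Fin k → Finset (Fin M), (∀ i, (S i).card = m) ∧ ∀ x, (∀ i, x i ∈ S i) → x ∈ A := by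
  induction k with
  | zero =>
    intro ρ hρ m
    refine ⟨0, fun M _ A hA => ⟨fun i => i.elim0, fun i => i.elim0, fun x _ => ?_⟩⟩
    have h1 : (0:ℝ) < A.card := lt_of_lt_of_le (by simpa using hρ) hA
    have h2 : 0 < A.card := by exact_mod_cast h1
    obtain ⟨y, hy⟩ := card_pos.1 h2
    rwa [Subsingleton.elim x y]
  | succ k ih =>
    intro ρ hρ m
    obtain ⟨M1, hM1⟩ := exists_nat_gt (4 * m / ρ)
    obtain ⟨M0, hM0⟩ := ih (ρ / 4 / 2 ^ M1) (by positivity) m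
    obtain ⟨M2, hM2⟩ := exists_nat_gt (2 * M1 / ρ)
    refine ⟨max (max M0 M2) 1, fun M hM A hA => ?_⟩
    have hMM0 : M0 ≤ M := le_trans (le_trans (le_max_left _ _) (le_max_left _ _)) hM
    have hMM2 : M2 ≤ M := le_trans (le_trans (le_max_right _ _) (le_max_left _ _)) hM
    have hMp : 0 < M := le_trans (le_max_right _ _) hM
    have hMR : (0:ℝ) < M := by exact_mod_cast hMp
    have hM1p : (0:ℝ) < M1 := lt_of_le_of_lt (by positivity) hM1
    rw [div_lt_iff₀ hρ] at hM1 hM2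
    have hM2' : 2 * (M1:ℝ) < M * ρ := by
      have : (M2 : ℝ) ≤ M := by exact_mod_cast hMM2
      nlinarith
    let sl : Fin M → Finset (Fin k → Fin M) := fun u =>
      univ.filter (fun y => (Fin.cons u y : Fin (k+1) → Fin M) ∈ A)
    have hub : ∀ B : Finset (Fin k → Fin M), (B.card : ℝ) ≤ (M:ℝ) ^ k := by
      intro B
      have := card_le_univ B
      rw [Fintype.card_fun, Fintype.card_fin, Fintype.card_fin] at this
      exact_mod_cast this
    have hsum : (A.card : ℝ) = ∑ u, ((sl u).card : ℝ) := by
      rw [← Nat.cast_sum, Nat.cast_inj, ← card_sigma]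
      refine card_bij' (fun x _ => ⟨x 0, Fin.tail x⟩) (fun q _ => Fin.cons q.1 q.2) ?_ ?_ ?_ ?_
      · intro x hx; simp [sl, hx]
      · rintro ⟨u, y⟩ h; simpa [sl] using h
      · intro x hx; simp
      · rintro ⟨u, y⟩ h; simp
    let G := univ.filter (fun u => ρ / 2 * (M:ℝ) ^ k ≤ (sl u).card)
    have hG : (M1 : ℝ) ≤ G.card := by
      have h1 : (A.card : ℝ) ≤ G.card * (M:ℝ) ^ k + M * (ρ / 2 * (M:ℝ) ^ k) := by
        rw [hsum, ← sum_filter_add_sum_filter_not univ (fun u => ρ / 2 * (M:ℝ) ^ k ≤ (sl u).card)]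
        apply add_le_add
        · rw [← nsmul_eq_mul, ← sum_const]
          exact sum_le_sum (fun z _ => hub _)
        · refine le_trans (sum_le_sum (fun z hz => (not_le.1 (mem_filter.1 hz).2).le)) ?_
          rw [sum_const, nsmul_eq_mul]
          apply mul_le_mul_of_nonneg_right _ (by positivity)
          exact_mod_cast (card_le_univ _).trans (by simp)
      have h2 : (M1:ℝ) * (M:ℝ)^k ≤ G.card * (M:ℝ)^k := by
        have h3 : ρ * (M:ℝ) ^ (k+1) = 2 * ((M * ρ / 2) * (M:ℝ)^k) := by ring
        have h4 : (M1:ℝ) * (M:ℝ)^k ≤ (M * ρ / 2) * (M:ℝ)^k :=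
          mul_le_mul_of_nonneg_right (by linarith) (by positivity)
        nlinarith
      exact le_of_mul_le_mul_right h2 (by positivity)
    obtain ⟨W, hWG, hW⟩ := exists_subset_card_eq (show M1 ≤ G.card by exact_mod_cast hG)
    let nbr : (Fin k → Fin M) → Finset (Fin M) := fun y => W.filter (fun u => y ∈ sl u)
    have hnle : ∀ y, ((nbr y).card : ℝ) ≤ M1 := by
      intro y; rw [← hW]; exact_mod_cast card_filter_le _ _
    let Y := univ.filter (fun y => ρ / 4 * M1 ≤ ((nbr y).card : ℝ))
    have hY : ρ / 4 * (M:ℝ) ^ k ≤ Y.card := by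
      have h1 : (M1:ℝ) * (ρ / 2 * (M:ℝ) ^ k) ≤ ∑ y, ((nbr y).card : ℝ) := by
        have e : ∑ y, ((nbr y).card : ℝ) = ∑ u ∈ W, ((sl u).card : ℝ) := by
          have e1 : ∀ y, ((nbr y).card : ℝ) = ∑ u ∈ W, if y ∈ sl u then (1:ℝ) else 0 := by
            intro y; simp [nbr]
          simp_rw [e1]
          rw [sum_comm]
          apply sum_congr rfl
          intro u _
          simp
        rw [e, ← hW, ← nsmul_eq_mul, ← sum_const]
        exact sum_le_sum (fun u hu => (mem_filter.1 (hWG hu)).2)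
      have h2 : ∑ y, ((nbr y).card : ℝ) ≤ Y.card * M1 + (M:ℝ)^k * (ρ / 4 * M1) := by
        rw [← sum_filter_add_sum_filter_not univ (fun y => ρ / 4 * M1 ≤ ((nbr y).card : ℝ))]
        apply add_le_add
        · rw [← nsmul_eq_mul, ← sum_const]
          exact sum_le_sum (fun z _ => hnle _)
        · refine le_trans (sum_le_sum (fun z hz => (not_le.1 (mem_filter.1 hz).2).le)) ?_
          rw [sum_const, nsmul_eq_mul]
          exact mul_le_mul_of_nonneg_right (hub _) (by positivity)
      have h3 : (ρ / 4 * (M:ℝ) ^ k) * M1 ≤ Y.card * M1 := by nlinarith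
      exact le_of_mul_le_mul_right h3 hM1p
    obtain ⟨T, hT, hTc⟩ := exists_le_card_fiber_of_nsmul_le_card_of_maps_to (s := Y) (t := W.powerset)
      (f := nbr) (b := ρ / 4 / 2 ^ M1 * (M:ℝ)^k) (fun y _ => mem_powerset.2 (filter_subset _ _))
      ⟨∅, by simp⟩ (by
        rw [card_powerset, hW, nsmul_eq_mul]
        push_cast
        refine le_trans (le_of_eq ?_) hY
        field_simp)
    obtain ⟨S, hS, hSA⟩ := hM0 M hMM0 _ hTc
    have hTm : m ≤ T.card := by
      have h1 : 0 < (Y.filter (fun y => nbr y = T)).card := by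
        have : (0:ℝ) < (Y.filter (fun y => nbr y = T)).card := lt_of_lt_of_le (by positivity) hTc
        exact_mod_cast this
      obtain ⟨y, hy⟩ := card_pos.1 h1
      rw [mem_filter] at hy
      have h2 := (mem_filter.1 hy.1).2
      rw [hy.2] at h2
      have : (m:ℝ) ≤ T.card := by nlinarith
      exact_mod_cast this
    obtain ⟨S0, hS0, hS0c⟩ := exists_subset_card_eq hTm
    refine ⟨Fin.cons S0 S, fun i => ?_, fun x hx => ?_⟩
    · refine Fin.cases ?_ (fun j => ?_) i
      · simpa using hS0c
      · simpa using hS j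
    · have h1 := hSA (Fin.tail x) (fun i => by simpa [Fin.tail] using hx i.succ)
      have h2 := (mem_filter.1 h1).2
      have h3 : x 0 ∈ T := hS0 (by simpa using hx 0)
      rw [← h2, mem_filter] at h3
      have h4 := (mem_filter.1 h3.2).2
      simpa using h4

theorem lpdual {I : Type} [Fintype I] [DecidableEq I] (H : Finset (Fin 4 → I)) (Θ : ℝ) (hΘ : 0 < Θ)
    (h : ∀ w : I → ℝ, (∀ a, 0 ≤ w a) → ∑ a, w a ≤ Θ → ∃ x ∈ H, ∑ i, w (x i) < 1) :
    ∃ (ι : Type) (_ : Fintype ι) (y : ι → Fin 4 → I) (l : ι → ℝ),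
      Fintype.card ι ≤ Fintype.card I + 1 ∧ (∀ k, y k ∈ H) ∧ (∀ k, 0 ≤ l k) ∧ ∑ k, l k = 1 ∧
      ∀ a, ∑ k, l k * ((univ.filter (fun i => y k i = a)).card : ℝ) ≤ 1 / Θ := by
  classical
  obtain ⟨v, hv⟩ : ∃ v : (Fin 4 → I) → (I → ℝ),
      ∀ x a, v x a = ((univ.filter (fun i => x i = a)).card : ℝ) := ⟨fun x a => _, fun _ _ => rfl⟩
  have hvw : ∀ (w : I → ℝ) x, ∑ a, w a * v x a = ∑ i, w (x i) := by
    intro w x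
    rw [← Finset.sum_fiberwise (s := univ) (g := x) (f := fun i => w (x i))]
    refine sum_congr rfl fun a _ => ?_
    rw [hv, sum_congr rfl (g := fun _ => w a)]
    · simp [mul_comm]
    · intro i hi; rw [(mem_filter.1 hi).2]
  set C : Set (I → ℝ) := convexHull ℝ (v '' (H : Set (Fin 4 → I))) with hC
  set D : Set (I → ℝ) := {y | ∀ a, y a ≤ 1 / Θ} with hD
  by_cases hdis : Disjoint C D
  · exfalso
    have hCc : IsCompact C := Set.Finite.isCompact_convexHull (𝕜 := ℝ) (H.finite_toSet.image v)
    have hDc : IsClosed D := by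
      have : D = Set.Iic (fun _ => 1 / Θ) := by ext y; simp [hD, Pi.le_def]
      rw [this]; exact isClosed_Iic
    have hDx : Convex ℝ D := by
      have : D = Set.Iic (fun _ => 1 / Θ) := by ext y; simp [hD, Pi.le_def]
      rw [this]; exact convex_Iic _
    obtain ⟨f, u, u', h1, h2, h3⟩ := geometric_hahn_banach_compact_closed (convex_convexHull ℝ _) hCc hDx hDc hdis
    have hf : ∀ y : I → ℝ, f y = ∑ a, y a * f (Pi.single a 1) := by
      intro y
      conv_lhs => rw [pi_eq_sum_univ' y]
      rw [map_sum]
      refine sum_congr rfl fun a _ => ?_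
      rw [map_smul, smul_eq_mul]
    obtain ⟨w, hw⟩ : ∃ w : I → ℝ, ∀ a, w a = - f (Pi.single a 1) := ⟨fun a => _, fun _ => rfl⟩
    have hf' : ∀ y, f y = - ∑ a, w a * y a := by
      intro y; rw [hf, ← sum_neg_distrib]
      refine sum_congr rfl fun a _ => ?_
      rw [hw]; ring
    have hw0 : ∀ a, 0 ≤ w a := by
      intro a
      by_contra hneg
      push Not at hneg
      -- y = -M e_a
      obtain ⟨M, hM⟩ := exists_nat_gt ((-u') / (- w a))
      have hM' := (div_lt_iff₀ (by linarith)).1 hM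
      have := h3 (Pi.single a (-(M:ℝ))) (by
        intro b
        by_cases hb : b = a
        · subst hb; simp only [Pi.single_eq_same]
          have : (0:ℝ) ≤ 1/Θ := by positivity
          have : (0:ℝ) ≤ M := by positivity
          linarith
        · rw [Pi.single_eq_of_ne hb]; positivity)
      rw [hf', sum_eq_single a (by intro b _ hb; rw [Pi.single_eq_of_ne hb]; ring) (by simp)] at this
      simp only [Pi.single_eq_same] at this
      nlinarith
    have hx : ∀ x ∈ H, (∑ a, w a) / Θ < ∑ i, w (x i) := by
      intro x hx
      have e1 := h1 (v x) (subset_convexHull ℝ _ ⟨x, hx, rfl⟩)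
      have e2 := h3 (fun _ => 1/Θ) (by intro a; exact le_rfl)
      rw [hf'] at e1 e2
      rw [hvw] at e1
      rw [← sum_mul] at e2
      rw [div_eq_mul_one_div]
      linarith
    have hS : 0 < ∑ a, w a := by
      rcases (sum_nonneg (fun a (_ : a ∈ univ) => hw0 a)).lt_or_eq with h' | h'
      · exact h'
      · exfalso
        have hz : ∀ a, w a = 0 := by
          intro a; exact (sum_eq_zero_iff_of_nonneg (fun a _ => hw0 a)).1 h'.symm a (mem_univ _)
        obtain ⟨x, hx1, -⟩ := h (fun _ => 0) (fun _ => le_rfl) (by simpa using hΘ.le)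
        have := hx x hx1
        simp [hz] at this
    obtain ⟨x, hx1, hx2⟩ := h (fun a => w a * (Θ / ∑ a, w a)) (fun a => mul_nonneg (hw0 a) (by positivity))
      (by rw [← sum_mul]; field_simp; exact le_rfl)
    have := hx x hx1
    rw [← sum_mul] at hx2
    rw [div_lt_iff₀ hΘ] at this
    rw [← mul_div_assoc, div_lt_one hS] at hx2
    linarith
  · rw [Set.not_disjoint_iff] at hdis
    obtain ⟨y, hyC, hyD⟩ := hdis
    obtain ⟨ι, hι, z, l, hz1, hz2, hl1, hl2, hl3⟩ := eq_pos_convex_span_of_mem_convexHull hyC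
    have hz3 : ∀ k, ∃ x ∈ H, v x = z k := fun k => hz1 ⟨k, rfl⟩
    choose x hxH hxz using hz3
    refine ⟨ι, hι, x, l, ?_, hxH, fun k => (hl1 k).le, hl2, ?_⟩
    · have := hz2.card_le_finrank_succ
      refine this.trans ?_
      refine Nat.succ_le_succ ?_
      refine (Submodule.finrank_le _).trans ?_
      simp
    · intro a
      have : y a ≤ 1/Θ := hyD a
      rw [← hl3] at this
      simp only [Finset.sum_apply, Pi.smul_apply, smul_eq_mul, ← hxz, hv] at this
      exact this

theorem chunk {V : Type} [DecidableEq V] (m : ℕ) : ∀ (h : ℕ) (U : Finset V), m * h ≤ U.card →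
    ∃ Q : Fin h → Finset V, (∀ k, Q k ⊆ U) ∧ (∀ k, (Q k).card = m) ∧
      ∀ k k', k ≠ k' → Disjoint (Q k) (Q k') := by
  intro h
  induction h with
  | zero => intro U _; exact ⟨fun i => i.elim0, fun i => i.elim0, fun i => i.elim0, fun i => i.elim0⟩
  | succ h ih =>
    intro U hU
    obtain ⟨S, hS, hSc⟩ := exists_subset_card_eq (s := U) (n := m) (by nlinarith)
    obtain ⟨Q, h1, h2, h3⟩ := ih (U \ S) (by rw [card_sdiff_of_subset hS, hSc]; rw [mul_add] at hU; omega)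
    have hd : ∀ k, Disjoint S (Q k) := fun k => (disjoint_sdiff).mono_right (h1 k)
    refine ⟨Fin.cons S Q, ?_, ?_, ?_⟩
    · intro k; refine Fin.cases ?_ (fun k => ?_) k
      · simpa using hS
      · simpa using (h1 k).trans sdiff_subset
    · intro k; refine Fin.cases ?_ (fun k => ?_) k
      · simpa using hSc
      · simpa using h2 k
    · intro k k'
      refine Fin.cases ?_ (fun k => ?_) k <;> refine Fin.cases ?_ (fun k' => ?_) k'
      · simp
      · intro _; simpa using hd k'
      · intro _; simpa using (hd k).symm
      · intro hne; simpa using h3 k k' (fun hh => hne (by rw [hh]))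

open Classical in
theorem kst_set (ρ : ℝ) (hρ : 0 < ρ) (m : ℕ) : ∃ M0 : ℕ, ∀ M : ℕ, M0 ≤ M →
    ∀ (V : Type) (p : Fin 4 → Finset V) (_ : ∀ i, (p i).card = M) (A : Finset (Fin 4 → V)),
    (∀ r ∈ A, ∀ i, r i ∈ p i) → ρ * (M:ℝ)^4 ≤ A.card →
    ∃ S : Fin 4 → Finset V, (∀ i, S i ⊆ p i) ∧ (∀ i, (S i).card = m) ∧
      ∀ x, (∀ i, x i ∈ S i) → x ∈ A := by
  obtain ⟨M0, h0⟩ := kst 4 ρ hρ m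
  refine ⟨M0, fun M hM V p hp A hA hAc => ?_⟩
  have e : ∀ i, Fin M ≃ p i := fun i => ((p i).equivFinOfCardEq (hp i)).symm
  obtain ⟨F, hF⟩ : ∃ F : (Fin 4 → Fin M) → (Fin 4 → V), ∀ x i, F x i = (e i (x i) : V) :=
    ⟨fun x i => e i (x i), fun _ _ => rfl⟩
  have hcard : A.card ≤ (univ.filter (fun x => F x ∈ A)).card := by
    have : A ⊆ (univ.filter (fun x => F x ∈ A)).image F := by
      intro r hr
      have : F (fun i => (e i).symm ⟨r i, hA r hr i⟩) = r := by ext i; rw [hF]; simp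
      rw [mem_image]
      exact ⟨_, by rw [mem_filter, this]; exact ⟨mem_univ _, hr⟩, this⟩
    exact (card_le_card this).trans card_image_le
  obtain ⟨S, hS1, hS2⟩ := h0 M hM (univ.filter (fun x => F x ∈ A))
    (hAc.trans (by exact_mod_cast hcard))
  refine ⟨fun i => (S i).image (fun k => (e i k : V)), ?_, ?_, ?_⟩
  · intro i v hv
    obtain ⟨k, -, rfl⟩ := mem_image.1 hv
    exact (e i k).2
  · intro i
    rw [card_image_of_injective, hS1]
    exact Subtype.val_injective.comp (e i).injective
  · intro x hx
    have : ∀ i, ∃ k ∈ S i, (e i k : V) = x i := fun i => mem_image.1 (hx i)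
    choose k hk hkx using this
    have h := hS2 k hk
    rw [mem_filter] at h
    have : F k = x := by ext i; rw [hF, hkx]
    rw [← this]; exact h.2

def IsBlock {V : Type} (P : Bool → (Fin 4 → V) → Prop) (m : ℕ) (β : Bool × (Fin 4 → Finset V)) : Prop :=
  (∀ i, (β.2 i).card = m) ∧ ∀ x : Fin 4 → V, (∀ i, x i ∈ β.2 i) → P β.1 x

def IsTiling {V : Type} (P : Bool → (Fin 4 → V) → Prop) (m : ℕ) {ι : Type}
    (T : ι → Bool × (Fin 4 → Finset V)) : Prop :=
  (∀ j, IsBlock P m (T j)) ∧ ∀ j j', j ≠ j' → ∀ i i', Disjoint ((T j).2 i) ((T j').2 i')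

theorem load_bd {V : Type} [DecidableEq V] {I J : Type} [DecidableEq I] (p : I → Finset V)
    (hpd : ∀ a b, a ≠ b → Disjoint (p a) (p b)) (y : J → Fin 4 → I) (s : Finset J) (m : ℕ)
    (T : J → Bool × (Fin 4 → Finset V)) (hT1 : ∀ j ∈ s, ∀ i, ((T j).2 i).card = m)
    (hT3 : ∀ j ∈ s, ∀ i, (T j).2 i ⊆ p (y j i)) (a : I) :
    (p a ∩ s.biUnion (fun j => univ.biUnion (fun i => (T j).2 i))).card ≤
      ∑ j ∈ s, m * (univ.filter (fun i => y j i = a)).card := by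
  have : p a ∩ s.biUnion (fun j => univ.biUnion (fun i => (T j).2 i)) ⊆
      s.biUnion (fun j => (univ.filter (fun i => y j i = a)).biUnion (fun i => (T j).2 i)) := by
    intro v hv
    rw [mem_inter, mem_biUnion] at hv
    obtain ⟨hv1, j, hj, hv2⟩ := hv
    obtain ⟨i, -, hv3⟩ := mem_biUnion.1 hv2
    refine mem_biUnion.2 ⟨j, hj, mem_biUnion.2 ⟨i, ?_, hv3⟩⟩
    rw [mem_filter]
    refine ⟨mem_univ _, ?_⟩
    by_contra hne
    exact (disjoint_left.1 (hpd _ _ hne)) (hT3 j hj i hv3) hv1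
  refine (card_le_card this).trans (card_biUnion_le.trans (sum_le_sum fun j hj => ?_))
  refine card_biUnion_le.trans ?_
  rw [sum_congr rfl (fun i _ => hT1 j hj i)]
  simp [mul_comm]

/-- the greedy selection -/
theorem greedy (ρ : ℝ) (hρ : 0 < ρ) (m : ℕ) (hm : 0 < m) : ∃ M0 : ℕ, ∀ M : ℕ, M0 ≤ M →
    ∀ (V : Type) [DecidableEq V] [Fintype V] (P : Bool → (Fin 4 → V) → Prop)
      (I : Type) [DecidableEq I] (p : I → Finset V) (_ : ∀ a, (p a).card = M)
      (_ : ∀ a b, a ≠ b → Disjoint (p a) (p b)) (J : Type) [DecidableEq J] (y : J → Fin 4 → I)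
      (_ : ∀ j, ∃ κ, ∃ A : Finset (Fin 4 → V), (∀ r ∈ A, P κ r ∧ ∀ i, r i ∈ p (y j i)) ∧
        ρ * (M:ℝ)^4 ≤ A.card) (s : Finset J)
      (_ : ∀ a, ((∑ j ∈ s, m * (univ.filter (fun i => y j i = a)).card : ℕ) : ℝ) ≤ ρ / 8 * M),
      ∃ T : J → Bool × (Fin 4 → Finset V), (∀ j ∈ s, IsBlock P m (T j)) ∧
        (∀ j ∈ s, ∀ j' ∈ s, j ≠ j' → ∀ i i', Disjoint ((T j).2 i) ((T j').2 i')) ∧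
        (∀ j ∈ s, ∀ i, (T j).2 i ⊆ p (y j i)) := by
  obtain ⟨M0, h0⟩ := kst_set (ρ / 2) (by positivity) m
  refine ⟨M0, fun M hM V _ _ P I _ p hp hpd J _ y hy s => ?_⟩
  classical
  induction s using Finset.induction_on with
  | empty =>
    intro _
    exact ⟨fun j => (true, fun i => ∅), by simp, by simp, by simp⟩
  | insert j0 s hj0 ih =>
    intro hs
    obtain ⟨T, hT1, hT2, hT3⟩ := ih (by
      intro a
      refine le_trans ?_ (hs a)
      rw [sum_insert hj0]
      push_cast
      have : (0:ℝ) ≤ m * ((univ.filter (fun i => y j0 i = a)).card : ℝ) := by positivity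
      linarith)
    set Us : Finset V := s.biUnion (fun j => univ.biUnion (fun i => (T j).2 i)) with hUs
    have hload : ∀ a, ((p a ∩ Us).card : ℝ) ≤ ρ / 8 * M := by
      intro a
      refine le_trans ?_ (hs a)
      norm_cast
      rw [sum_insert hj0]
      refine le_trans ?_ (Nat.le_add_left _ _)
      exact load_bd p hpd y s m T (fun j hj => (hT1 j hj).1) hT3 a
    obtain ⟨κ, A, hA1, hA2⟩ := hy j0
    -- bad tuples
    have hbad : ((A.filter (fun r => ∃ i, r i ∈ Us)).card : ℝ) ≤ 4 * (ρ / 8 * M * M^3) := by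
      have hsub : A.filter (fun r => ∃ i, r i ∈ Us) ⊆
          univ.biUnion (fun i : Fin 4 => Fintype.piFinset (fun i' => if i' = i then p (y j0 i) ∩ Us else p (y j0 i'))) := by
        intro r hr
        rw [mem_filter] at hr
        obtain ⟨hr1, i, hi⟩ := hr
        rw [mem_biUnion]
        refine ⟨i, mem_univ _, ?_⟩
        rw [Fintype.mem_piFinset]
        intro i'
        have := (hA1 r hr1).2 i'
        split_ifs with h
        · subst h; exact mem_inter.2 ⟨this, hi⟩
        · exact this
      have h1 : (A.filter (fun r => ∃ i, r i ∈ Us)).card ≤ ∑ i : Fin 4, (p (y j0 i) ∩ Us).card * M^3 := by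
        refine (card_le_card hsub).trans (card_biUnion_le.trans (sum_le_sum fun i _ => ?_))
        rw [Fintype.card_piFinset, ← mul_prod_erase univ _ (mem_univ i)]
        rw [if_pos rfl]
        refine Nat.mul_le_mul le_rfl ?_
        rw [prod_congr rfl (g := fun _ => M)]
        · simp
        · intro i' hi'
          rw [if_neg (ne_of_mem_erase hi'), hp]
      have h2 : ((A.filter (fun r => ∃ i, r i ∈ Us)).card : ℝ) ≤ ∑ i : Fin 4, ((p (y j0 i) ∩ Us).card:ℝ) * M^3 := by
        exact_mod_cast h1
      refine h2.trans ?_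
      have : ∀ i ∈ (univ : Finset (Fin 4)), ((p (y j0 i) ∩ Us).card:ℝ) * (M:ℝ)^3 ≤ ρ / 8 * M * M^3 :=
        fun i _ => mul_le_mul_of_nonneg_right (hload _) (by positivity)
      refine (sum_le_sum this).trans ?_
      simp
    have hA' : ρ / 2 * (M:ℝ)^4 ≤ ((A.filter (fun r => ¬ ∃ i, r i ∈ Us)).card : ℝ) := by
      have := card_filter_add_card_filter_not (s := A) (fun r => ∃ i, r i ∈ Us)
      have h : ((A.filter (fun r => ∃ i, r i ∈ Us)).card : ℝ) + ((A.filter (fun r => ¬ ∃ i, r i ∈ Us)).card : ℝ) = A.card := by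
        exact_mod_cast this
      nlinarith
    obtain ⟨S, hS1, hS2, hS3⟩ := h0 M hM V (fun i => p (y j0 i)) (fun i => hp _) _
      (fun r hr i => (hA1 r (mem_filter.1 hr).1).2 i) hA'
    have hSU : ∀ i, Disjoint (S i) Us := by
      intro i
      rw [disjoint_left]
      intro v hv hvU
      have : ∀ i, ∃ z, z ∈ S i := fun i => card_pos.1 (by rw [hS2]; exact hm)
      choose z hz using this
      have := hS3 (Function.update z i v) (by
        intro i'
        by_cases h : i' = i
        · subst h; simpa using hv
        · rw [Function.update_of_ne h]; exact hz _)
      rw [mem_filter] at this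
      exact this.2 ⟨i, by simpa using hvU⟩
    have hTU : ∀ j ∈ s, ∀ i, (T j).2 i ⊆ Us := by
      intro j hj i v hv
      exact mem_biUnion.2 ⟨j, hj, mem_biUnion.2 ⟨i, mem_univ _, hv⟩⟩
    have hne : ∀ j ∈ s, j ≠ j0 := fun j hj h => hj0 (h ▸ hj)
    refine ⟨Function.update T j0 (κ, S), ?_, ?_, ?_⟩
    · intro j hj
      rcases mem_insert.1 hj with rfl | hj
      · rw [Function.update_self]
        exact ⟨hS2, fun x hx => (hA1 x (mem_filter.1 (hS3 x hx)).1).1⟩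
      · rw [Function.update_of_ne (hne j hj)]; exact hT1 j hj
    · intro j hjs j' hjs' hjj i i'
      rcases mem_insert.1 hjs with h | hj <;> rcases mem_insert.1 hjs' with h' | hj'
      · exact absurd (h.trans h'.symm) hjj
      · rw [h, Function.update_self, Function.update_of_ne (hne j' hj')]
        exact (hSU i).mono_right (hTU j' hj' i')
      · rw [h', Function.update_self, Function.update_of_ne (hne j hj)]
        exact ((hSU i').mono_right (hTU j hj i)).symm
      · rw [Function.update_of_ne (hne j hj), Function.update_of_ne (hne j' hj')]
        exact hT2 j hj j' hj' hjj i i'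
    · intro j hj i
      rcases mem_insert.1 hj with rfl | hj
      · rw [Function.update_self]; exact hS1 i
      · rw [Function.update_of_ne (hne j hj)]; exact hT3 j hj i

open Classical in
def NonBad {V : Type} [Fintype V] (P : Bool → (Fin 4 → V) → Prop) (ε μ : ℝ) : Prop :=
  ∀ w : V → ℝ, (∀ v, 0 ≤ w v) → ∑ v, w v ≤ (1 - ε) * (Fintype.card V : ℝ) / 4 →
    μ * (Fintype.card V : ℝ)^4 <
      ((univ.filter (fun r : Fin 4 → V => (∃ κ, P κ r) ∧ ∑ i, w (r i) < 1)).card : ℝ)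

open Classical in
theorem dense_tuple {V : Type} [Fintype V] (P : Bool → (Fin 4 → V) → Prop) (ε μ : ℝ) (hμ : 0 < μ)
    (hP : NonBad P ε μ) (M : ℕ) (hM : 0 < M) (hn : 16 * (M:ℝ) ≤ μ * Fintype.card V) (I : Type) [Fintype I]
    (p : I → Finset V) (hp : ∀ a, (p a).card = M) (hpd : ∀ a b, a ≠ b → Disjoint (p a) (p b))
    (hI : Fintype.card V ≤ Fintype.card I * M + M) (w : I → ℝ) (hw : ∀ a, 0 ≤ w a)
    (hws : ∑ a, w a ≤ (1 - ε) * (Fintype.card V : ℝ) / (4 * M)) :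
    ∃ x : Fin 4 → I, (∃ κ, μ / 4 * (M:ℝ)^4 ≤
      ((univ.filter (fun r : Fin 4 → V => P κ r ∧ ∀ i, r i ∈ p (x i))).card : ℝ)) ∧
      ∑ i, w (x i) < 1 := by
  set n : ℝ := (Fintype.card V : ℝ) with hndef
  have hMR : (0:ℝ) < M := by exact_mod_cast hM
  have hn0 : 0 < n := by
    by_contra h
    have : n ≤ 0 := by linarith
    nlinarith
  obtain ⟨W, hW⟩ : ∃ W : V → ℝ, ∀ v, W v = ∑ a, if v ∈ p a then w a else 0 := ⟨_, fun _ => rfl⟩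
  have hWp : ∀ a, ∀ v ∈ p a, W v = w a := by
    intro a v hv
    rw [hW, sum_eq_single a]
    · rw [if_pos hv]
    · intro b _ hb
      rw [if_neg]
      intro hvb
      exact disjoint_left.1 (hpd _ _ hb) hvb hv
    · simp
  have hWs : ∑ v, W v = M * ∑ a, w a := by
    simp_rw [hW]
    rw [sum_comm, mul_sum]
    refine sum_congr rfl fun a _ => ?_
    rw [← sum_filter, sum_const]
    rw [show (univ.filter (fun v => v ∈ p a)) = p a by ext; simp, hp]
    simp
  have hb := hP W (fun v => by rw [hW]; exact sum_nonneg fun a _ => by split_ifs; exacts [hw a, le_rfl])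
    (by
      rw [hWs]
      calc (M:ℝ) * ∑ a, w a ≤ M * ((1 - ε) * n / (4 * M)) := by gcongr
        _ = _ := by rw [← hndef]; field_simp)
  by_contra hcon
  push Not at hcon
  set X0 : Finset V := univ \ univ.biUnion p with hX0
  have hUc : (univ.biUnion p).card = Fintype.card I * M := by
    rw [card_biUnion (fun a _ b _ h => hpd a b h)]
    simp [hp]
  have hX0c : X0.card ≤ M := by
    rw [hX0, card_sdiff_of_subset (subset_univ _), hUc, card_univ]; omega
  have hIn : (Fintype.card I : ℝ) * M ≤ n := by
    have : (univ.biUnion p).card ≤ Fintype.card V := card_le_univ _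
    rw [hUc] at this
    rw [hndef]; exact_mod_cast this
  set Bd := univ.filter (fun x : Fin 4 → I => ∑ i, w (x i) < 1) with hBd
  have hsub : univ.filter (fun r : Fin 4 → V => (∃ κ, P κ r) ∧ ∑ i, W (r i) < 1) ⊆
      univ.filter (fun z : Fin 4 → V => ∃ i, z i ∈ X0) ∪
      Bd.biUnion (fun x => (univ.filter (fun r : Fin 4 → V => P true r ∧ ∀ i, r i ∈ p (x i))) ∪
        (univ.filter (fun r : Fin 4 → V => P false r ∧ ∀ i, r i ∈ p (x i)))) := by
    intro r hr
    rw [mem_filter] at hr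
    obtain ⟨-, ⟨κ, hκ⟩, hr⟩ := hr
    rw [mem_union]
    by_cases hX : ∃ i, r i ∈ X0
    · left; simpa using hX
    · right
      push Not at hX
      have : ∀ i, ∃ a, r i ∈ p a := by
        intro i
        have := hX i
        rw [hX0] at this
        simpa using this
      choose x hx using this
      rw [mem_biUnion]
      refine ⟨x, ?_, ?_⟩
      · rw [hBd, mem_filter]
        refine ⟨mem_univ _, ?_⟩
        rw [sum_congr rfl (fun i _ => (hWp (x i) (r i) (hx i)).symm)]
        exact hr
      · rw [mem_union, mem_filter, mem_filter]
        cases κ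
        · right; exact ⟨mem_univ _, hκ, hx⟩
        · left; exact ⟨mem_univ _, hκ, hx⟩
  have h1 : ((univ.filter (fun z : Fin 4 → V => ∃ i, z i ∈ X0)).card : ℝ) ≤ μ / 4 * n^4 := by
    have h := touch_card X0
    have h' : ((univ.filter (fun z : Fin 4 → V => ∃ i, z i ∈ X0)).card : ℝ) ≤ 4 * (X0.card * n^3) := by
      rw [hndef]; exact_mod_cast h
    have h2 : (X0.card : ℝ) ≤ M := by exact_mod_cast hX0c
    have h3 : (X0.card : ℝ) * n^3 ≤ (μ * n / 16) * n^3 := by gcongr; linarith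
    nlinarith
  have h2 : ((Bd.biUnion (fun x => (univ.filter (fun r : Fin 4 → V => P true r ∧ ∀ i, r i ∈ p (x i))) ∪
        (univ.filter (fun r : Fin 4 → V => P false r ∧ ∀ i, r i ∈ p (x i))))).card : ℝ) ≤ μ / 2 * n^4 := by
    calc _ ≤ ((∑ x ∈ Bd, ((univ.filter (fun r : Fin 4 → V => P true r ∧ ∀ i, r i ∈ p (x i))).card +
        (univ.filter (fun r : Fin 4 → V => P false r ∧ ∀ i, r i ∈ p (x i))).card) : ℕ) : ℝ) := by
          exact_mod_cast card_biUnion_le.trans (sum_le_sum fun x _ => card_union_le _ _)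
      _ ≤ ∑ x ∈ Bd, (μ / 2 * (M:ℝ)^4) := by
          push_cast
          refine sum_le_sum fun x hx => ?_
          have hx' := (mem_filter.1 hx).2
          have e1 : ∀ κ, ((univ.filter (fun r : Fin 4 → V => P κ r ∧ ∀ i, r i ∈ p (x i))).card : ℝ) < μ / 4 * (M:ℝ)^4 := by
            intro κ
            by_contra hk
            push Not at hk
            exact absurd (hcon x ⟨κ, hk⟩) (not_le.2 hx')
          have := e1 true
          have := e1 false
          linarith
      _ ≤ (Fintype.card I : ℝ)^4 * (μ / 2 * (M:ℝ)^4) := by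
          rw [sum_const, nsmul_eq_mul]
          gcongr
          have : Bd.card ≤ (Fintype.card I)^4 := by
            refine (card_le_univ _).trans ?_
            simp
          exact_mod_cast this
      _ = μ / 2 * ((Fintype.card I : ℝ) * M)^4 := by ring
      _ ≤ _ := by gcongr
  have h3 : ((univ.filter (fun r : Fin 4 → V => (∃ κ, P κ r) ∧ ∑ i, W (r i) < 1)).card : ℝ) ≤
      μ / 4 * n^4 + μ / 2 * n^4 := by
    refine le_trans ?_ (add_le_add h1 h2)
    exact_mod_cast (card_le_card hsub).trans (card_union_le _ _)
  have : 0 < μ * n^4 := by positivity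
  linarith

open Classical in
theorem augment (ε μ : ℝ) (hε1 : ε < 1) (hμ : 0 < μ) (m : ℕ) (hm : 0 < m) :
    ∃ M0 : ℕ, ∀ M : ℕ, M0 ≤ M → 0 < M → ∀ (V : Type) [Fintype V] (P : Bool → (Fin 4 → V) → Prop),
    NonBad P ε μ → 16 * (M:ℝ) ≤ μ * Fintype.card V → ∀ (I : Type) [Fintype I]
    (p : I → Finset V), (∀ a, (p a).card = M) → (∀ a b, a ≠ b → Disjoint (p a) (p b)) →
    (Fintype.card V ≤ Fintype.card I * M + M) →
    ∃ (J : Type) (_ : Fintype J) (T : J → Bool × (Fin 4 → Finset V)), IsTiling P m T ∧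
      (∀ a, ((p a ∩ univ.biUnion (fun j => univ.biUnion (fun i => (T j).2 i))).card : ℝ) ≤ μ / 32 * M) ∧
      μ / 32 * (1 - ε) * (Fintype.card V : ℝ) - 4 * m * (Fintype.card I + 1) ≤ 4 * m * Fintype.card J := by
  obtain ⟨M0, h0⟩ := greedy (μ / 4) (by positivity) m hm
  refine ⟨M0, fun M hM hMp V _ P hP hn I _ p hp hpd hI => ?_⟩
  set n : ℝ := (Fintype.card V : ℝ) with hndef
  have hMR : (0:ℝ) < M := by exact_mod_cast hMp
  have hmR : (0:ℝ) < m := by exact_mod_cast hm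
  have hn0 : 0 < n := by
    by_contra h
    have : n ≤ 0 := by linarith
    nlinarith
  have he : 0 < 1 - ε := by linarith
  set Θ : ℝ := (1 - ε) * n / (4 * M) with hΘ
  have hΘ0 : 0 < Θ := by positivity
  obtain ⟨ι, _, y, l, hc, hyH, hl0, hl1, hload⟩ := lpdual
    (univ.filter (fun x : Fin 4 → I => ∃ κ, μ / 4 * (M:ℝ)^4 ≤
      ((univ.filter (fun r : Fin 4 → V => P κ r ∧ ∀ i, r i ∈ p (x i))).card : ℝ))) Θ hΘ0 (by
      intro w hw hws
      obtain ⟨x, hx1, hx2⟩ := dense_tuple P ε μ hμ hP M hMp hn I p hp hpd hI w hw hws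
      exact ⟨x, by rw [mem_filter]; exact ⟨mem_univ _, hx1⟩, hx2⟩)
  obtain ⟨N, hN⟩ : ∃ N : ι → ℕ, ∀ k, N k = ⌊l k * (Θ * (μ / 32) * M / m)⌋₊ := ⟨fun k => _, fun _ => rfl⟩
  have hN1 : ∀ k, (N k : ℝ) ≤ l k * (Θ * (μ / 32) * M / m) := by
    intro k; rw [hN]; exact Nat.floor_le (mul_nonneg (hl0 k) (by positivity))
  have hN2 : ∀ k, l k * (Θ * (μ / 32) * M / m) - 1 ≤ (N k : ℝ) := by
    intro k; rw [hN]; exact (Nat.sub_one_lt_floor _).le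
  have hld : ∀ a, ((∑ j : (k : ι) × Fin (N k), m * (univ.filter (fun i => y j.1 i = a)).card : ℕ) : ℝ) ≤ μ / 32 * M := by
    intro a
    rw [Fintype.sum_sigma]
    push_cast
    simp only [sum_const, card_univ, Fintype.card_fin, nsmul_eq_mul]
    calc ∑ k, (N k : ℝ) * (m * ((univ.filter (fun i => y k i = a)).card : ℝ)) ≤
        ∑ k, (l k * (Θ * (μ / 32) * M / m)) * (m * ((univ.filter (fun i => y k i = a)).card : ℝ)) := by
          refine sum_le_sum fun k _ => ?_
          have := hN1 k
          gcongr
      _ = (Θ * (μ / 32) * M) * ∑ k, l k * ((univ.filter (fun i => y k i = a)).card : ℝ) := by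
          rw [mul_sum]
          refine sum_congr rfl fun k _ => ?_
          field_simp
      _ ≤ (Θ * (μ / 32) * M) * (1 / Θ) := by
          have := hload a
          gcongr
      _ = _ := by field_simp
  obtain ⟨T, hT1, hT2, hT3⟩ := h0 M hM V P I p hp hpd ((k : ι) × Fin (N k)) (fun j => y j.1) (by
      intro j
      obtain ⟨κ, hκ⟩ := (mem_filter.1 (hyH j.1)).2
      refine ⟨κ, _, ?_, hκ⟩
      intro r hr
      exact (mem_filter.1 hr).2) univ (by
      intro a
      refine le_trans (le_of_eq ?_) ((hld a).trans (le_of_eq (by ring)))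
      congr)
  refine ⟨(k : ι) × Fin (N k), inferInstance, T, ⟨fun j => hT1 j (mem_univ _),
    fun j j' => hT2 j (mem_univ _) j' (mem_univ _)⟩, ?_, ?_⟩
  · intro a
    refine le_trans ?_ (hld a)
    have := load_bd p hpd (fun j : (k : ι) × Fin (N k) => y j.1) univ m T (fun j hj => (hT1 j hj).1) hT3 a
    exact_mod_cast this
  · rw [Fintype.card_sigma]
    simp only [Fintype.card_fin]
    push_cast
    have h1 : Θ * (μ / 32) * M / m - (Fintype.card I + 1) ≤ ∑ k, (N k : ℝ) := by
      calc Θ * (μ / 32) * M / m - (Fintype.card I + 1 : ℝ) ≤ Θ * (μ / 32) * M / m - (Fintype.card ι : ℝ) := by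
            have : (Fintype.card ι : ℝ) ≤ Fintype.card I + 1 := by exact_mod_cast hc
            linarith
        _ = ∑ k, (l k * (Θ * (μ / 32) * M / m) - 1) := by
            rw [sum_sub_distrib, ← sum_mul, hl1]; simp
        _ ≤ _ := sum_le_sum fun k _ => hN2 k
    have h2 : 4 * m * (Θ * (μ / 32) * M / m) = μ / 32 * (1 - ε) * n := by
      rw [hΘ]; field_simp
    rw [← h2, ← mul_sub]
    exact mul_le_mul_of_nonneg_left h1 (by positivity)

def TileTo (ε μ x : ℝ) : Prop := ∀ m : ℕ, 0 < m → ∃ n0 : ℕ, ∀ (V : Type) [Fintype V],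
    n0 ≤ Fintype.card V → ∀ (P : Bool → (Fin 4 → V) → Prop),
    (∀ κ r, P κ r → Function.Injective r) → NonBad P ε μ →
    ∃ (ι : Type) (_ : Fintype ι) (T : ι → Bool × (Fin 4 → Finset V)), IsTiling P m T ∧
      x * Fintype.card V ≤ 4 * m * Fintype.card ι

theorem block_disj {V : Type} (P : Bool → (Fin 4 → V) → Prop)
    (hP : ∀ κ r, P κ r → Function.Injective r) (m : ℕ) (hm : 0 < m) (β : Bool × (Fin 4 → Finset V))
    (hβ : IsBlock P m β) (i i' : Fin 4) (h : i ≠ i') : Disjoint (β.2 i) (β.2 i') := by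
  classical
  rw [disjoint_left]
  intro v hv hv'
  have : ∀ i, ∃ z, z ∈ β.2 i := fun i => card_pos.1 (by rw [hβ.1]; exact hm)
  choose z hz using this
  have h1 := hβ.2 (Function.update (Function.update z i v) i' v) (by
    intro k
    by_cases hk : k = i'
    · subst hk; simpa using hv'
    · rw [Function.update_of_ne hk]
      by_cases hk : k = i
      · subst hk; simpa using hv
      · rw [Function.update_of_ne hk]; exact hz _)
  have := hP _ _ h1 (a₁ := i) (a₂ := i') (by rw [Function.update_of_ne h]; simp)
  exact h this

set_option maxHeartbeats 1000000 in
theorem tile_step (ε μ x : ℝ) (hε : 0 < ε) (hε1 : ε < 1) (hμ : 0 < μ) (hμ1 : μ ≤ 1)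
    (hx : x ≤ 1 - 2 * ε) (hS : TileTo ε μ x) : TileTo ε μ (x + μ / 64 * ε) := by
  classical
  intro m hm
  obtain ⟨M0, hM0⟩ := augment ε μ hε1 hμ m hm
  have hmR : (0:ℝ) < m := by exact_mod_cast hm
  obtain ⟨M1, hM1⟩ := exists_nat_gt (640 * m / (μ * ε))
  rw [div_lt_iff₀ (by positivity)] at hM1
  set M := max (max M0 M1) 1 with hMdef
  have hMM0 : M0 ≤ M := le_trans (le_max_left _ _) (le_max_left _ _)
  have hMM1 : (M1:ℝ) ≤ M := by exact_mod_cast le_trans (le_max_right _ _) (le_max_left _ _)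
  have hMp : 0 < M := by rw [hMdef]; exact lt_of_lt_of_le Nat.one_pos (le_max_right _ _)
  have hMR : (0:ℝ) < M := by exact_mod_cast hMp
  clear_value M
  have hM2 : 640 * m ≤ M * (μ * ε) := hM1.le.trans (by gcongr)
  obtain ⟨n1, hn1⟩ := hS M hMp
  obtain ⟨n2, hn2⟩ := exists_nat_gt (16 * (M:ℝ) / μ)
  obtain ⟨n3, hn3⟩ := exists_nat_gt (512 * (m:ℝ) / (μ * ε))
  rw [div_lt_iff₀ (by positivity)] at hn2 hn3
  refine ⟨max n1 (max n2 n3), fun V _ hV P hPi hP => ?_⟩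
  have hV1 : n1 ≤ Fintype.card V := le_trans (le_max_left _ _) hV
  have hV2 : (n2:ℝ) ≤ Fintype.card V := by
    exact_mod_cast le_trans (le_trans (le_max_left _ _) (le_max_right _ _)) hV
  have hV3 : (n3:ℝ) ≤ Fintype.card V := by
    exact_mod_cast le_trans (le_trans (le_max_right _ _) (le_max_right _ _)) hV
  set n : ℝ := (Fintype.card V : ℝ) with hndef
  have hn16 : 16 * (M:ℝ) ≤ μ * n := by nlinarith
  have hn512 : 512 * (m:ℝ) ≤ n * (μ * ε) := hn3.le.trans (by gcongr)
  obtain ⟨ι, _, T1, hT1, hcov⟩ := hn1 V hV1 P hPi hP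
  set U : Finset V := univ \ univ.biUnion (fun q : ι × Fin 4 => (T1 q.1).2 q.2) with hU
  obtain ⟨Q, hQ1, hQ2, hQ3⟩ := chunk M (U.card / M) U (Nat.mul_div_le _ _)
  have hT1d : ∀ q q' : ι × Fin 4, q ≠ q' → Disjoint ((T1 q.1).2 q.2) ((T1 q'.1).2 q'.2) := by
    rintro ⟨b, i⟩ ⟨b', i'⟩ hne
    by_cases hb : b = b'
    · subst hb
      exact block_disj P hPi M hMp _ (hT1.1 b) i i' (fun h => hne (by rw [h]))
    · exact hT1.2 b b' hb i i'
  obtain ⟨p, hpl, hpr⟩ : ∃ p : (ι × Fin 4) ⊕ Fin (U.card / M) → Finset V,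
      (∀ q, p (Sum.inl q) = (T1 q.1).2 q.2) ∧ (∀ k, p (Sum.inr k) = Q k) :=
    ⟨Sum.elim (fun q => (T1 q.1).2 q.2) Q, fun _ => rfl, fun _ => rfl⟩
  have hlr : ∀ q k, Disjoint (p (Sum.inl q)) (p (Sum.inr k)) := by
    intro q k
    rw [hpl, hpr]
    have : Disjoint (univ.biUnion (fun q : ι × Fin 4 => (T1 q.1).2 q.2)) U := disjoint_sdiff
    exact this.mono (subset_biUnion_of_mem (fun q : ι × Fin 4 => (T1 q.1).2 q.2) (mem_univ q)) (hQ1 k)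
  have hpc : ∀ a, (p a).card = M := by
    rintro (q | k)
    · rw [hpl]; exact (hT1.1 q.1).1 q.2
    · rw [hpr, hQ2]
  have hpd : ∀ a b, a ≠ b → Disjoint (p a) (p b) := by
    rintro (q | k) (q' | k') hne
    · rw [hpl, hpl]; exact hT1d q q' (fun h => hne (by rw [h]))
    · exact hlr q k'
    · exact (hlr q' k).symm
    · rw [hpr, hpr]; exact hQ3 k k' (fun h => hne (by rw [h]))
  have hUcard : (univ.biUnion (fun q : ι × Fin 4 => (T1 q.1).2 q.2)).card = Fintype.card ι * 4 * M := by
    rw [card_biUnion (fun q _ q' _ h => hT1d q q' h)]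
    rw [sum_congr rfl (fun q _ => (hT1.1 q.1).1 q.2)]
    simp
  have hcI : Fintype.card ((ι × Fin 4) ⊕ Fin (U.card / M)) = Fintype.card ι * 4 + U.card / M := by simp
  have hUle : Fintype.card ι * 4 * M ≤ Fintype.card V := by rw [← hUcard]; exact card_le_univ _
  have hUc2 : U.card = Fintype.card V - Fintype.card ι * 4 * M := by
    rw [hU, card_sdiff_of_subset (subset_univ _), hUcard, card_univ]
  have hI : Fintype.card V ≤ Fintype.card ((ι × Fin 4) ⊕ Fin (U.card / M)) * M + M := by
    rw [hcI]
    have h1 := Nat.lt_div_mul_add (a := U.card) hMp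
    rw [add_mul]
    omega
  have hI2 : Fintype.card ((ι × Fin 4) ⊕ Fin (U.card / M)) * M ≤ Fintype.card V := by
    rw [hcI, add_mul]
    have h1 := Nat.div_mul_le_self U.card M
    omega
  obtain ⟨J, _, T, hT, hTl, hTc⟩ := hM0 M hMM0 hMp V P hP hn16 _ p hpc hpd hI
  set Us := univ.biUnion (fun j => univ.biUnion (fun i => (T j).2 i)) with hUs
  set h : ℕ := ⌊(1 - μ / 32) * M / m⌋₊ with hh
  have hτ : 0 < 1 - μ / 32 := by linarith
  have hh1 : (h:ℝ) ≤ (1 - μ / 32) * M / m := Nat.floor_le (by positivity)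
  have hh2 : (1 - μ / 32) * M / m - 1 ≤ h := (Nat.sub_one_lt_floor _).le
  clear_value h
  have hrest : ∀ q : ι × Fin 4, m * h ≤ (p (Sum.inl q) \ Us).card := by
    intro q
    have h1 := hTl (Sum.inl q)
    have h2 : (p (Sum.inl q) \ Us).card + (p (Sum.inl q) ∩ Us).card = M := by
      rw [card_sdiff_add_card_inter, hpc]
    have h3 : ((p (Sum.inl q) \ Us).card:ℝ) + ((p (Sum.inl q) ∩ Us).card : ℝ) = M := by exact_mod_cast h2
    rw [le_div_iff₀ hmR] at hh1
    have : (m:ℝ) * h ≤ ((p (Sum.inl q) \ Us).card:ℝ) := by nlinarith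
    exact_mod_cast this
  have hch := fun q => chunk m h _ (hrest q)
  choose R hR1 hR2 hR3 using hch
  have hRp : ∀ q k, R q k ⊆ p (Sum.inl q) := fun q k => (hR1 q k).trans sdiff_subset
  have hRU : ∀ q k, Disjoint (R q k) Us := fun q k => (sdiff_disjoint).mono_left (hR1 q k)
  have hTU : ∀ j i, (T j).2 i ⊆ Us := by
    intro j i v hv
    exact mem_biUnion.2 ⟨j, mem_univ _, mem_biUnion.2 ⟨i, mem_univ _, hv⟩⟩
  refine ⟨J ⊕ (ι × Fin h), inferInstance, Sum.elim T (fun b => ((T1 b.1).1, fun i => R (b.1, i) b.2)), ⟨?_, ?_⟩, ?_⟩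
  · rintro (j | ⟨b, k⟩)
    · exact hT.1 j
    · refine ⟨fun i => hR2 _ _, fun z hz => (hT1.1 b).2 z fun i => ?_⟩
      have := hRp (b, i) k (hz i)
      rwa [hpl] at this
  · rintro (j | ⟨b, k⟩) (j' | ⟨b', k'⟩) hne i i'
    · exact hT.2 j j' (fun h => hne (by rw [h])) i i'
    · exact ((hRU (b', i') k').mono_right (hTU j i)).symm
    · exact ((hRU (b, i) k).mono_right (hTU j' i'))
    · show Disjoint (R (b, i) k) (R (b', i') k')
      by_cases hq : (b, i) = (b', i')
      · rw [Prod.mk.injEq] at hq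
        obtain ⟨rfl, rfl⟩ := hq
        exact hR3 _ _ _ (fun h => hne (by rw [h]))
      · exact (hpd _ _ (fun h => hq (Sum.inl_injective h))).mono (hRp _ _) (hRp _ _)
  · rw [Fintype.card_sum, Fintype.card_prod, Fintype.card_fin]
    push_cast
    have e1 : ((Fintype.card ((ι × Fin 4) ⊕ Fin (U.card / M)) : ℕ) : ℝ) * M ≤ n := by
      rw [hndef]; exact_mod_cast hI2
    have e2 : (Fintype.card ι : ℝ) * 4 * M ≤ n := by rw [hndef]; exact_mod_cast hUle
    set cI : ℝ := ((Fintype.card ((ι × Fin 4) ⊕ Fin (U.card / M)) : ℕ) : ℝ)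
    set b : ℝ := (Fintype.card ι : ℝ)
    set cJ : ℝ := (Fintype.card J : ℝ)
    have hb0 : 0 ≤ b := by positivity
    have hn0 : 0 ≤ n := by positivity
    rw [sub_le_iff_le_add, div_le_iff₀ hmR] at hh2
    have e3 : b * ((1 - μ / 32) * M) ≤ b * ((h + 1) * m) := by gcongr
    -- small terms
    have e4 : 640 * (m * cI) ≤ n * (μ * ε) := by
      have : 640 * m * cI ≤ M * (μ * ε) * cI := by gcongr
      have h' : cI * M * (μ * ε) ≤ n * (μ * ε) := by gcongr
      linarith
    have e5 : 640 * (m * (4 * b)) ≤ n * (μ * ε) := by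
      have : 640 * m * (4 * b) ≤ M * (μ * ε) * (4 * b) := by gcongr
      have h' : b * 4 * M * (μ * ε) ≤ n * (μ * ε) := by gcongr
      linarith
    have e6 : (1 - μ / 32) * (x * n) ≤ (1 - μ / 32) * (4 * M * b) := by gcongr
    have e7 : μ / 32 * n * x ≤ μ / 32 * n * (1 - 2 * ε) := by gcongr
    nlinarith

theorem tiling (ε μ : ℝ) (hε : 0 < ε) (hε1 : ε < 1) (hμ : 0 < μ) (hμ1 : μ ≤ 1) :
    TileTo ε μ (1 - 2 * ε) := by
  have h0 : ∀ j : ℕ, ∃ x, min (1 - 2 * ε) (j * (μ / 64 * ε)) ≤ x ∧ TileTo ε μ x := by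
    intro j
    induction j with
    | zero =>
      refine ⟨0, by simp, fun m hm => ⟨0, fun V _ _ P _ _ => ?_⟩⟩
      refine ⟨Empty, inferInstance, fun e => e.elim, ⟨fun e => e.elim, fun e => e.elim⟩, by simp⟩
    | succ j ih =>
      obtain ⟨x, hx1, hx2⟩ := ih
      by_cases hx : x ≤ 1 - 2 * ε
      · refine ⟨_, ?_, tile_step ε μ x hε hε1 hμ hμ1 hx hx2⟩
        have : 0 < μ / 64 * ε := by positivity
        rcases min_le_iff.1 hx1 with h | h
        · exact (min_le_left _ _).trans (by linarith)
        · refine (min_le_right _ _).trans ?_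
          push_cast; linarith
      · exact ⟨x, (min_le_left _ _).trans (by linarith), hx2⟩
  obtain ⟨j, hj⟩ := exists_nat_gt (1 / (μ / 64 * ε))
  rw [div_lt_iff₀ (by positivity)] at hj
  obtain ⟨x, hx1, hx2⟩ := h0 j
  rw [min_eq_left (by linarith)] at hx1
  intro m hm
  obtain ⟨n0, hn0⟩ := hx2 m hm
  refine ⟨n0, fun V _ hV P h1 h2 => ?_⟩
  obtain ⟨ι, i1, T, hT, hc⟩ := hn0 V hV P h1 h2
  refine ⟨ι, i1, T, hT, le_trans ?_ hc⟩
  gcongr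

open Classical in
theorem marg {V : Type} [Fintype V] (k t : ℕ) (j : Fin k → Fin t) (hj : Function.Injective j)
    (S : Finset (Fin k → V)) :
    ((univ.filter (fun f : Fin t → V => f ∘ j ∈ S)).card : ℝ) * (Fintype.card V : ℝ)^k ≤
      S.card * (Fintype.card V : ℝ)^t := by
  have hkt : k ≤ t := by simpa using Fintype.card_le_of_injective j hj
  have h1 : ∀ x : Fin k → V, (univ.filter (fun f : Fin t → V => f ∘ j = x)).card ≤ (Fintype.card V)^(t - k) := by
    intro x
    have hsub : univ.filter (fun f : Fin t → V => f ∘ j = x) ⊆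
        Fintype.piFinset (fun a => if h : ∃ i, j i = a then ({x h.choose} : Finset V) else univ) := by
      intro f hf
      rw [mem_filter] at hf
      rw [Fintype.mem_piFinset]
      intro a
      split_ifs with h
      · rw [mem_singleton, ← hf.2]
        show f a = f (j h.choose)
        rw [h.choose_spec]
      · exact mem_univ _
    refine (card_le_card hsub).trans ?_
    rw [Fintype.card_piFinset]
    have : ∀ a, (if h : ∃ i, j i = a then ({x h.choose} : Finset V) else univ).card =
        if a ∈ univ.image j then 1 else Fintype.card V := by
      intro a
      by_cases h : ∃ i, j i = a
      · rw [dif_pos h, if_pos (by simpa using h)]; simp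
      · rw [dif_neg h, if_neg (by simpa using h)]; simp
    simp_rw [this]
    rw [prod_ite]
    simp only [prod_const, one_pow, one_mul]
    refine le_of_eq ?_
    congr 1
    rw [show (univ.filter (fun a => a ∉ univ.image j)) = univ \ univ.image j by ext; simp]
    rw [card_sdiff_of_subset (subset_univ _), card_image_of_injective _ hj]
    simp
  have h2 : (univ.filter (fun f : Fin t → V => f ∘ j ∈ S)).card ≤ S.card * (Fintype.card V)^(t - k) := by
    have hsub : univ.filter (fun f : Fin t → V => f ∘ j ∈ S) ⊆
        S.biUnion (fun x => univ.filter (fun f : Fin t → V => f ∘ j = x)) := by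
      intro f hf
      rw [mem_filter] at hf
      rw [mem_biUnion]
      exact ⟨_, hf.2, by simp⟩
    refine (card_le_card hsub).trans (card_biUnion_le.trans ((sum_le_sum fun x _ => h1 x).trans ?_))
    simp
  calc _ ≤ ((S.card * (Fintype.card V)^(t - k) : ℕ) : ℝ) * (Fintype.card V : ℝ)^k := by
        gcongr
    _ = _ := by push_cast; rw [mul_assoc, ← pow_add, Nat.sub_add_cancel hkt]

/-- fraction version -/
theorem marg' {V : Type} [Fintype V] (hV : 0 < Fintype.card V) (k t : ℕ) (j : Fin k → Fin t) (hj : Function.Injective j)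
    (Q : (Fin k → V) → Prop) (γ : ℝ) [DecidablePred Q] [DecidablePred fun f : Fin t → V => Q (f ∘ j)]
    (h : ((univ.filter Q).card : ℝ) ≤ γ * (Fintype.card V : ℝ)^k) :
    ((univ.filter (fun f : Fin t → V => Q (f ∘ j))).card : ℝ) ≤ γ * (Fintype.card V : ℝ)^t := by
  have hn : (0:ℝ) < Fintype.card V := by exact_mod_cast hV
  have h1 := marg k t j hj (univ.filter Q)
  have h2 : (0:ℝ) < (Fintype.card V : ℝ)^k := by positivity
  have h3 : ((univ.filter (fun f : Fin t → V => Q (f ∘ j))).card : ℝ) * (Fintype.card V : ℝ)^k ≤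
      γ * (Fintype.card V : ℝ)^t * (Fintype.card V : ℝ)^k := by
    calc _ ≤ ((univ.filter Q).card : ℝ) * (Fintype.card V : ℝ)^t := by
          refine le_trans (le_of_eq ?_) h1
          congr 3
          ext f; simp
      _ ≤ (γ * (Fintype.card V : ℝ)^k) * (Fintype.card V : ℝ)^t := by gcongr
      _ = _ := by ring
  exact le_of_mul_le_mul_right h3 h2

theorem chernoff {V : Type} [Fintype V] (ε : ℝ) (hε : 0 < ε) (hε1 : ε < 1) (q : ℕ)
    (w : V → ℝ) (hw0 : ∀ v, 0 ≤ w v) (hw1 : ∀ v, w v ≤ 1)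
    (hws : ∑ v, w v ≤ (1 - ε) * (Fintype.card V : ℝ) / 4) :
    ((univ.filter (fun f : Fin (4 * q) → V => (q:ℝ) - 10 ≤ ∑ k, w (f k))).card : ℝ) ≤
      Real.exp (5 - q * (ε^2 / 4)) * (Fintype.card V : ℝ)^(4 * q) := by
  set n : ℝ := (Fintype.card V : ℝ) with hn
  have hn0 : 0 ≤ n := by positivity
  have h1 : ∑ f : Fin (4 * q) → V, Real.exp (ε / 2 * ∑ k, w (f k)) = (∑ v, Real.exp (ε / 2 * w v))^(4 * q) := by
    have := Finset.sum_pow' (univ : Finset V) (fun v => Real.exp (ε / 2 * w v)) (4 * q)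
    rw [this]
    rw [Fintype.piFinset_univ]
    refine sum_congr rfl fun f _ => ?_
    rw [mul_sum, Real.exp_sum]
  have h2 : ∑ v, Real.exp (ε / 2 * w v) ≤ n * Real.exp ((ε / 2 + (ε/2)^2) * ((1 - ε) / 4)) := by
    have h3 : ∀ v, Real.exp (ε / 2 * w v) ≤ 1 + (ε / 2 + (ε/2)^2) * w v := by
      intro v
      have := hw0 v
      have := hw1 v
      have hy0 : 0 ≤ ε / 2 * w v := by positivity
      have hy1 : ε / 2 * w v ≤ 1 := by nlinarith
      have h4 := Real.abs_exp_sub_one_sub_id_le (x := ε / 2 * w v) (by rw [abs_of_nonneg hy0]; exact hy1)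
      have h5 := (abs_le.1 h4).2
      have h6 : (ε / 2 * w v)^2 ≤ (ε/2)^2 * w v := by
        rw [mul_pow]
        have : (w v)^2 ≤ w v := by nlinarith
        gcongr
      linarith
    calc _ ≤ ∑ v, (1 + (ε / 2 + (ε/2)^2) * w v) := sum_le_sum fun v _ => h3 v
      _ = n + (ε / 2 + (ε/2)^2) * ∑ v, w v := by rw [sum_add_distrib, ← mul_sum]; simp [hn]
      _ ≤ n + (ε / 2 + (ε/2)^2) * ((1 - ε) * n / 4) := by gcongr
      _ = n * ((ε / 2 + (ε/2)^2) * ((1 - ε) / 4) + 1) := by ring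
      _ ≤ _ := by
        gcongr
        exact Real.add_one_le_exp _
  have h3 : ((univ.filter (fun f : Fin (4 * q) → V => (q:ℝ) - 10 ≤ ∑ k, w (f k))).card : ℝ) *
      Real.exp (ε / 2 * (q - 10)) ≤ ∑ f : Fin (4 * q) → V, Real.exp (ε / 2 * ∑ k, w (f k)) := by
    rw [← nsmul_eq_mul, ← sum_const]
    refine le_trans (sum_le_sum fun f hf => ?_) (sum_le_univ_sum_of_nonneg (s := univ.filter (fun f : Fin (4 * q) → V => (q:ℝ) - 10 ≤ ∑ k, w (f k))) fun f => (Real.exp_pos _).le)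
    rw [mem_filter] at hf
    rw [Real.exp_le_exp]
    have := hf.2
    gcongr
  have h4 : (∑ v, Real.exp (ε / 2 * w v))^(4 * q) ≤ n^(4*q) * Real.exp (q * ((ε / 2 + (ε/2)^2) * (1 - ε))) := by
    refine (pow_le_pow_left₀ (sum_nonneg fun v _ => (Real.exp_pos _).le) h2 _).trans (le_of_eq ?_)
    rw [mul_pow, ← Real.exp_nat_mul]
    congr 2
    push_cast; ring
  rw [h1] at h3
  have h5 := h3.trans h4
  have h6 : ((univ.filter (fun f : Fin (4 * q) → V => (q:ℝ) - 10 ≤ ∑ k, w (f k))).card : ℝ) ≤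
      n^(4*q) * Real.exp (q * ((ε / 2 + (ε/2)^2) * (1 - ε))) / Real.exp (ε / 2 * (q - 10)) := by
    rwa [le_div_iff₀ (Real.exp_pos _)]
  refine h6.trans ?_
  rw [mul_div_assoc, ← Real.exp_sub, mul_comm]
  refine mul_le_mul_of_nonneg_right (Real.exp_le_exp.2 ?_) (by positivity)
  have hq : (0:ℝ) ≤ q := by positivity
  have : (ε / 2 + (ε/2)^2) * (1 - ε) ≤ ε / 2 - ε^2/4 := by nlinarith [pow_pos hε 3]
  have := mul_le_mul_of_nonneg_left this hq
  linarith

open Classical in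
theorem rich_adj {V : Type} [Fintype V] (hV : 0 < Fintype.card V) (Col : (Fin 4 → V) → Prop) (i : Fin 4)
    (c : ℝ) (F : Finset (Fin 5 → V))
    (hF : ∀ x, x ∈ F ↔ Col (x ∘ Fin.castSucc) ∧ Col (Function.update (x ∘ Fin.castSucc) i (x (Fin.last 4))))
    (x : Fin 5 → V)
    (hx : c * (Fintype.card V : ℝ)^5 ≤ ((univ.filter (fun x' => ∀ A, mix x x' A ∈ F)).card : ℝ)) :
    c * (Fintype.card V : ℝ)^4 ≤ ((univ.filter (fun s => Gm Col (x ∘ Fin.castSucc) s ∧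
      Gm Col (Function.update (x ∘ Fin.castSucc) i (x (Fin.last 4))) s)).card : ℝ) := by
  have hn : (0:ℝ) < Fintype.card V := by exact_mod_cast hV
  have key : ∀ x', (∀ A, mix x x' A ∈ F) → Gm Col (x ∘ Fin.castSucc) (x' ∘ Fin.castSucc) ∧
      Gm Col (Function.update (x ∘ Fin.castSucc) i (x (Fin.last 4))) (x' ∘ Fin.castSucc) := by
    intro x' hx'
    have h1 : Gm Col (x ∘ Fin.castSucc) (x' ∘ Fin.castSucc) := by
      intro A
      have := ((hF _).1 (hx' (Fin.snoc A false : Fin 5 → Bool))).1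
      convert this using 1
      ext k; simp [mix]
    refine ⟨h1, ?_⟩
    intro A
    by_cases hA : A i = true
    · convert h1 A using 1
      ext k
      by_cases hk : k = i
      · subst hk; simp [mix, hA]
      · simp [mix, Function.update_of_ne hk]
    · have := ((hF _).1 (hx' (Fin.snoc A false : Fin 5 → Bool))).2
      convert this using 1
      ext k
      by_cases hk : k = i
      · subst hk; simp [mix, hA, -Fin.reduceLast]
      · simp [mix, Function.update_of_ne hk]
  have hcard : (univ.filter (fun x' => ∀ A, mix x x' A ∈ F)).card ≤
      (univ.filter (fun s => Gm Col (x ∘ Fin.castSucc) s ∧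
      Gm Col (Function.update (x ∘ Fin.castSucc) i (x (Fin.last 4))) s)).card * Fintype.card V := by
    rw [← card_univ (α := V), ← card_product]
    refine card_le_card_of_injOn (fun x' => (x' ∘ Fin.castSucc, x' (Fin.last 4))) ?_ ?_
    · intro x' hx'
      have := key x' (by simpa using hx')
      simp only [coe_product, Set.mem_prod, mem_coe, mem_filter, mem_univ, true_and, and_true]
      exact this
    · intro a _ b _ hab
      simp only [Prod.mk.injEq] at hab
      ext k
      refine Fin.lastCases hab.2 (fun k => congrFun hab.1 k) k
  have h2 : ((univ.filter (fun x' => ∀ A, mix x x' A ∈ F)).card : ℝ) ≤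
      ((univ.filter (fun s => Gm Col (x ∘ Fin.castSucc) s ∧
      Gm Col (Function.update (x ∘ Fin.castSucc) i (x (Fin.last 4))) s)).card : ℝ) * Fintype.card V := by
    exact_mod_cast hcard
  have h3 := hx.trans h2
  have : c * (Fintype.card V : ℝ)^5 = c * (Fintype.card V : ℝ)^4 * Fintype.card V := by ring
  rw [this] at h3
  exact le_of_mul_le_mul_right h3 hn

def ColK {V : Type} [DecidableEq V] (c : Finset V → Bool) (κ : Bool) (r : Fin 4 → V) : Prop :=
  Function.Injective r ∧ c (univ.image r) = κ

theorem enum4 {α : Type} [DecidableEq α] (S : Finset α) (hS : S.card = 4) :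
    ∃ j : Fin 4 → α, univ.image j = S := by
  refine ⟨fun i => ((S.equivFinOfCardEq hS).symm i : α), ?_⟩
  ext a
  simp only [mem_image, mem_univ, true_and]
  constructor
  · rintro ⟨i, rfl⟩; exact ((S.equivFinOfCardEq hS).symm i).2
  · intro ha; exact ⟨S.equivFinOfCardEq hS ⟨a, ha⟩, by simp⟩

theorem inj_of_image4 {α : Type} [DecidableEq α] (S : Finset α) (hS : S.card = 4) (j : Fin 4 → α)
    (hj : univ.image j = S) : Function.Injective j := by
  have : (univ.image j).card = (univ : Finset (Fin 4)).card := by rw [hj, hS]; simp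
  have := card_image_iff.1 this
  intro a b h
  exact this (by simp) (by simp) h

theorem good_core {V : Type} [Fintype V] [DecidableEq V] (c : Finset V → Bool) (q : ℕ) (hq : 10 ≤ q)
    (K : ℕ) (hK : 0 < K) (lab : Bool → (Fin 4 → V) → Fin K) (Typ : Bool → (Fin 4 → V) → Prop)
    (w : (Bool → Fin K) → V → ℝ) (hw : ∀ l v, 0 ≤ w l v) (f : Fin (4 * q) → V)
    (g1 : Function.Injective f)
    (g2 : ∀ κ, ∀ j : Fin 4 → Fin (4 * q), Function.Injective j → ColK c κ (f ∘ j) → Typ κ (f ∘ j))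
    (g3 : ∀ κ i, ∀ j : Fin 5 → Fin (4 * q), Function.Injective j →
      ColK c κ ((f ∘ j) ∘ Fin.castSucc) →
      ColK c κ (Function.update ((f ∘ j) ∘ Fin.castSucc) i ((f ∘ j) (Fin.last 4))) →
      Typ κ ((f ∘ j) ∘ Fin.castSucc) →
      Typ κ (Function.update ((f ∘ j) ∘ Fin.castSucc) i ((f ∘ j) (Fin.last 4))) →
      lab κ ((f ∘ j) ∘ Fin.castSucc) =
        lab κ (Function.update ((f ∘ j) ∘ Fin.castSucc) i ((f ∘ j) (Fin.last 4))))
    (g4 : ∀ l, ∀ j : Fin 4 → Fin (4 * q), Function.Injective j →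
      (∃ κ, Typ κ (f ∘ j) ∧ lab κ (f ∘ j) = l κ) → 1 ≤ ∑ i, w l ((f ∘ j) i))
    (g5 : ∀ l, ∑ k, w l (f k) < q - 10) : False := by
  have himg : ∀ j : Fin 4 → Fin (4 * q), univ.image (f ∘ j) = (univ.image j).image f := by
    intro j; rw [image_image]
  obtain ⟨lab', hlab'⟩ : ∃ lab' : Finset (Fin (4 * q)) → Set (Fin K), ∀ S x, x ∈ lab' S ↔
      ∃ j : Fin 4 → Fin (4 * q), univ.image j = S ∧ lab (c (S.image f)) (f ∘ j) = x :=
    ⟨fun S => {x | ∃ j : Fin 4 → Fin (4 * q), univ.image j = S ∧ lab (c (S.image f)) (f ∘ j) = x},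
      fun S x => Iff.rfl⟩
  have hcol : ∀ S : Finset (Fin (4 * q)), S.card = 4 → ∀ j : Fin 4 → Fin (4 * q), univ.image j = S →
      ColK c (c (S.image f)) (f ∘ j) := by
    intro S hS j hj
    exact ⟨g1.comp (inj_of_image4 S hS j hj), by rw [himg, hj]⟩
  have hsub : ∀ a b c' d e : Fin (4 * q), a ≠ b → a ≠ c' → b ≠ c' → d ≠ a → d ≠ b → d ≠ c' →
      e ≠ a → e ≠ b → e ≠ c' → d ≠ e → c (({a, b, c', d} : Finset _).image f) = c (({a, b, c', e} : Finset _).image f) →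
      lab' {a, b, c', d} ⊆ lab' {a, b, c', e} := by
    intro a b c' d e hab hac hbc hda hdb hdc hea heb hec hde hc x hx
    have hSd : ({a, b, c', d} : Finset (Fin (4 * q))).card = 4 := by
      rw [card_insert_of_notMem, card_insert_of_notMem, card_insert_of_notMem, card_singleton] <;>
        simp [hab, hac, hbc, hda.symm, hdb.symm, hdc.symm]
    have hSe : ({a, b, c', e} : Finset (Fin (4 * q))).card = 4 := by
      rw [card_insert_of_notMem, card_insert_of_notMem, card_insert_of_notMem, card_singleton] <;>
        simp [hab, hac, hbc, hea.symm, heb.symm, hec.symm]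
    rw [hlab'] at hx ⊢
    obtain ⟨j, hj, hjx⟩ := hx
    have hji := inj_of_image4 _ hSd j hj
    have : d ∈ univ.image j := by rw [hj]; simp
    obtain ⟨i, -, hi⟩ := mem_image.1 this
    have hj' : univ.image (Function.update j i e) = {a, b, c', e} := by
      have hmem : ∀ v, (∃ k, j k = v) ↔ v = a ∨ v = b ∨ v = c' ∨ v = d := by
        intro v
        have : v ∈ univ.image j ↔ v ∈ ({a, b, c', d} : Finset _) := by rw [hj]
        simpa using this
      have hin : ∀ v, v ≠ d → (v = a ∨ v = b ∨ v = c') → ∃ k, Function.update j i e k = v := by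
        intro v hvd hv
        obtain ⟨k, hk⟩ := (hmem v).2 (by tauto)
        refine ⟨k, ?_⟩
        rw [Function.update_of_ne, hk]
        rintro rfl
        exact hvd (hk.symm.trans hi)
      ext v
      simp only [mem_image, mem_univ, true_and, mem_insert, mem_singleton]
      constructor
      · rintro ⟨k, rfl⟩
        by_cases hk : k = i
        · subst hk; simp
        · rw [Function.update_of_ne hk]
          rcases (hmem (j k)).1 ⟨k, rfl⟩ with h | h | h | h
          · exact Or.inl h
          · exact Or.inr (Or.inl h)
          · exact Or.inr (Or.inr (Or.inl h))
          · exact absurd (hji (h.trans hi.symm)) hk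
      · rintro (h | h | h | h)
        · exact hin v (by rw [h]; exact hda.symm) (by tauto)
        · exact hin v (by rw [h]; exact hdb.symm) (by tauto)
        · exact hin v (by rw [h]; exact hdc.symm) (by tauto)
        · exact ⟨i, by simp [h]⟩
    refine ⟨Function.update j i e, hj', ?_⟩
    rw [← hjx, ← hc]
    set κ := c (({a, b, c', d} : Finset _).image f) with hκ
    have hc1 : ColK c κ (f ∘ j) := hcol _ hSd j hj
    have hc2 : ColK c κ (f ∘ Function.update j i e) := by rw [hc]; exact hcol _ hSe _ hj'
    have hej : ∀ k, j k ≠ e := by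
      intro k hk
      have : e ∈ univ.image j := mem_image.2 ⟨k, mem_univ _, hk⟩
      rw [hj] at this
      simp [hea, heb, hec, hde.symm] at this
    have hj5 : Function.Injective (Fin.snoc j e : Fin 5 → Fin (4 * q)) := by
      rw [Fin.snoc_injective_iff]
      exact ⟨hji, by rintro ⟨k, hk⟩; exact hej k hk⟩
    have e1 : (f ∘ (Fin.snoc j e : Fin 5 → Fin (4 * q))) ∘ Fin.castSucc = f ∘ j := by
      ext k; simp
    have e2 : (f ∘ (Fin.snoc j e : Fin 5 → Fin (4 * q))) (Fin.last 4) = f e := by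
      simp [-Fin.reduceLast]
    have e3 : Function.update (f ∘ j) i (f e) = f ∘ Function.update j i e := by
      rw [Function.comp_update]
    have h := g3 κ i _ hj5
    rw [e1, e2, e3] at h
    refine (h hc1 hc2 (g2 κ j hji hc1) (g2 κ _ (inj_of_image4 _ hSe _ hj') hc2)).symm
  obtain ⟨L, hL⟩ := core_thm q (by simp) hq (fun S : Finset (Fin (4 * q)) => c (S.image f)) lab' (by
    intro a b c' d e hab hac hbc hda hdb hdc hea heb hec hc
    by_cases hde : d = e
    · rw [hde]
    · exact Set.Subset.antisymm
        (hsub a b c' d e hab hac hbc hda hdb hdc hea heb hec hde hc)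
        (hsub a b c' e d hab hac hbc hea heb hec hda hdb hdc (Ne.symm hde) hc.symm))
  have : ∀ κ, ∃ x : Fin K, (L κ).Nonempty → x ∈ L κ := by
    intro κ
    by_cases h : (L κ).Nonempty
    · exact ⟨h.some, fun _ => h.some_mem⟩
    · exact ⟨⟨0, hK⟩, fun h' => absurd h' h⟩
  choose l hl using this
  have := hL (fun k => w l (f k)) (fun k => hw _ _) (by
    intro S hS hLS
    obtain ⟨j0, hj0⟩ := enum4 S hS
    have hne : (L (c (S.image f))).Nonempty := ⟨_, by rw [← hLS, hlab']; exact ⟨j0, hj0, rfl⟩⟩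
    have h1 := hl _ hne
    rw [← hLS, hlab'] at h1
    obtain ⟨j, hj, hjl⟩ := h1
    have hji := inj_of_image4 S hS j hj
    have h2 := g4 l j hji ⟨_, g2 _ j hji (hcol S hS j hj), hjl⟩
    rw [← hj, sum_image (fun a _ b _ h => hji h)]
    exact h2)
  linarith [g5 l]

theorem ubound {X Y : Type} [Fintype X] (Q : X → Y → Prop) (γ : ℝ)
    (h : ∀ x, ∃ B : Finset Y, (∀ f, Q x f → f ∈ B) ∧ (B.card : ℝ) ≤ γ) :
    ∃ B : Finset Y, (∀ x f, Q x f → f ∈ B) ∧ (B.card : ℝ) ≤ Fintype.card X * γ := by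
  classical
  choose B hB1 hB2 using h
  refine ⟨univ.biUnion B, fun x f hf => mem_biUnion.2 ⟨x, mem_univ _, hB1 x f hf⟩, ?_⟩
  calc _ ≤ ((∑ x : X, (B x).card : ℕ) : ℝ) := by exact_mod_cast card_biUnion_le
    _ = ∑ x : X, ((B x).card : ℝ) := by push_cast; rfl
    _ ≤ ∑ x : X, γ := sum_le_sum fun x _ => hB2 x
    _ = _ := by simp

theorem ubound_j {V X : Type} [Fintype V] [Fintype X] (hV : 0 < Fintype.card V) (n : ℝ)
    (hn : n = Fintype.card V) (k t : ℕ)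
    (Q : X → (Fin k → V) → Prop) (γ : ℝ) (hγ : 0 ≤ γ)
    (h : ∀ x, ∃ B : Finset (Fin k → V), (∀ f, Q x f → f ∈ B) ∧ (B.card : ℝ) ≤ γ * n^k) :
    ∃ B : Finset (Fin t → V), (∀ x, ∀ j : Fin k → Fin t, Function.Injective j → ∀ f, Q x (f ∘ j) → f ∈ B) ∧
      (B.card : ℝ) ≤ (Fintype.card X * (t:ℝ)^k * γ) * n^t := by
  classical
  subst hn
  obtain ⟨B, hB1, hB2⟩ := ubound (X := X × (Fin k → Fin t)) (Y := Fin t → V)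
    (fun p f => Function.Injective p.2 ∧ Q p.1 (f ∘ p.2)) (γ * (Fintype.card V : ℝ)^t) (by
      intro p
      by_cases hp : Function.Injective p.2
      · obtain ⟨B, hB1, hB2⟩ := h p.1
        have := marg' hV k t p.2 hp (fun x => x ∈ B) γ (by
          refine le_trans (le_of_eq ?_) hB2
          simp)
        refine ⟨_, fun f hf => ?_, this⟩
        rw [mem_filter]
        exact ⟨mem_univ _, hB1 _ hf.2⟩
      · refine ⟨∅, fun f hf => absurd hf.1 hp, ?_⟩
        rw [card_empty]
        push_cast; positivity)
  refine ⟨B, fun x j hj f hf => hB1 (x, j) f ⟨hj, hf⟩, hB2.trans (le_of_eq ?_)⟩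
  simp; ring

theorem params (ε : ℝ) (hε : 0 < ε) : ∃ q : ℕ, 10 ≤ q ∧ ∃ δ : ℝ, 0 < δ ∧ δ ≤ 1 ∧
    δ = 1 / (48 * ((4 * q : ℕ):ℝ)^5) ∧
    ∃ K : ℕ, 4 / δ^32 < K ∧ (K:ℝ)^2 * Real.exp (5 - q * (ε^2 / 4)) ≤ 1 / 4 := by
  obtain ⟨A, hA⟩ : ∃ A : ℝ, A = 48 * 4^5 := ⟨_, rfl⟩
  have hA1 : 1 ≤ A := by rw [hA]; norm_num
  set b : ℝ := ε^2 / 4 with hb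
  have hb0 : 0 < b := by positivity
  have ht : Filter.Tendsto (fun q : ℕ => ((q:ℝ) * b)^320 * Real.exp (-((q:ℝ) * b))) Filter.atTop (nhds 0) :=
    (Real.tendsto_pow_mul_exp_neg_atTop_nhds_zero 320).comp
      (tendsto_natCast_atTop_atTop.atTop_mul_const hb0)
  set C : ℝ := 25 * A^64 * Real.exp 5 with hC
  have hC0 : 0 < C := by positivity
  have hev := ht.eventually (gt_mem_nhds (show (0:ℝ) < b^320 / (4 * C) by positivity))
  obtain ⟨q, hq, hq10⟩ := (hev.and (Filter.eventually_ge_atTop 10)).exists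
  have hq0 : (0:ℝ) < q := by exact_mod_cast (by omega : 0 < q)
  have hq1 : (1:ℝ) ≤ q := by exact_mod_cast (by omega : 1 ≤ q)
  have hδ : (1:ℝ) / (48 * ((4 * q : ℕ):ℝ)^5) = 1 / (A * q^5) := by
    rw [hA]; push_cast; ring
  have hAq : 1 ≤ A * (q:ℝ)^5 := one_le_mul_of_one_le_of_one_le hA1 (one_le_pow₀ hq1)
  refine ⟨q, hq10, _, ?_, ?_, rfl, ?_⟩
  · rw [hδ]; positivity
  · rw [hδ, div_le_one (by positivity)]; exact hAq
  · rw [hδ]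
    have h4 : 4 / (1 / (A * (q:ℝ)^5))^32 = 4 * (A^32 * (q:ℝ)^160) := by
      rw [div_pow, one_pow, div_div_eq_mul_div, div_one, mul_pow, ← pow_mul]
    rw [h4]
    have hB : 1 ≤ A^32 * (q:ℝ)^160 := one_le_mul_of_one_le_of_one_le (one_le_pow₀ hA1) (one_le_pow₀ hq1)
    refine ⟨⌊4 * (A^32 * (q:ℝ)^160)⌋₊ + 1, by push_cast; exact Nat.lt_floor_add_one _, ?_⟩
    have hK : ((⌊4 * (A^32 * (q:ℝ)^160)⌋₊ + 1 : ℕ) : ℝ) ≤ 5 * (A^32 * (q:ℝ)^160) := by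
      push_cast
      have := Nat.floor_le (show 0 ≤ 4 * (A^32 * (q:ℝ)^160) by positivity)
      linarith
    have hK2 : ((⌊4 * (A^32 * (q:ℝ)^160)⌋₊ + 1 : ℕ) : ℝ)^2 ≤ 25 * A^64 * (q:ℝ)^320 := by
      refine (pow_le_pow_left₀ (by positivity) hK 2).trans (le_of_eq ?_)
      ring
    refine (mul_le_mul_of_nonneg_right hK2 (Real.exp_pos _).le).trans ?_
    rw [sub_eq_add_neg, Real.exp_add]
    rw [mul_pow, lt_div_iff₀ (by positivity)] at hq
    have hb3 : 0 < b^320 := by positivity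
    have h5 : b^320 * (25 * A^64 * (q:ℝ)^320 * (Real.exp 5 * Real.exp (-((q:ℝ) * b)))) ≤ b^320 * (1/4) := by
      rw [hC] at hq
      nlinarith
    exact le_of_mul_le_mul_left h5 hb3

open Classical in
set_option maxHeartbeats 1000000 in
theorem sampling (ε : ℝ) (hε : 0 < ε) (hε1 : ε < 1) : ∃ δ : ℝ, 0 < δ ∧ δ ≤ 1 ∧ ∃ K : ℕ, 4 / δ^32 < K ∧
    ∃ μ : ℝ, 0 < μ ∧ μ ≤ 1 ∧ ∃ n0 : ℕ, ∀ (V : Type) [Fintype V], n0 ≤ Fintype.card V →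
    0 < Fintype.card V →
    ∀ (c : Finset V → Bool) (lab : Bool → (Fin 4 → V) → Fin K) (Typ : Bool → (Fin 4 → V) → Prop),
    (∀ κ, ((univ.filter (fun r => ColK c κ r ∧ ¬ Typ κ r)).card : ℝ) ≤ 2 * δ * (Fintype.card V : ℝ)^4) →
    (∀ κ r r', Typ κ r → Typ κ r' → δ^32 * (Fintype.card V : ℝ)^4 ≤
      ((univ.filter (fun s => Gm (ColK c κ) r s ∧ Gm (ColK c κ) r' s)).card : ℝ) → lab κ r = lab κ r') →
    ∃ l : Bool → Fin K, NonBad (fun κ r => Typ κ r ∧ lab κ r = l κ) ε μ := by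
  obtain ⟨q, hq10, δ, hδ, hδ1, hδe, K, hK, hKe⟩ := params ε hε
  have hK0 : (0:ℝ) < K := lt_trans (by positivity) hK
  have hK0' : 0 < K := by exact_mod_cast hK0
  set t := 4 * q with ht
  have ht0 : 0 < t := by omega
  have htR : (0:ℝ) < t := by exact_mod_cast ht0
  have htR1 : (1:ℝ) ≤ t := by exact_mod_cast ht0
  have hK1 : (1:ℝ) ≤ K := by exact_mod_cast hK0'
  obtain ⟨μ, hμ⟩ : ∃ μ : ℝ, μ = 1 / (8 * K^2 * (t:ℝ)^4) := ⟨_, rfl⟩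
  have hμ0 : 0 < μ := by rw [hμ]; positivity
  refine ⟨δ, hδ, hδ1, K, hK, μ, hμ0, ?_, 4 * t^2, ?_⟩
  · rw [hμ, div_le_one (by positivity)]
    have h1 : (1:ℝ) ≤ K^2 := one_le_pow₀ hK1
    have h2 : (1:ℝ) ≤ (t:ℝ)^4 := one_le_pow₀ htR1
    nlinarith
  intro V _ hn0 hV c lab Typ hfew hlab
  set n : ℝ := (Fintype.card V : ℝ) with hn
  have hnp : 0 < n := by rw [hn]; exact_mod_cast hV
  by_contra hcon
  push Not at hcon
  have hex : ∀ l : Bool → Fin K, ∃ w : V → ℝ, (∀ v, 0 ≤ w v) ∧ (∀ v, w v ≤ 1) ∧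
      ∑ v, w v ≤ (1 - ε) * n / 4 ∧
      ((univ.filter (fun r : Fin 4 → V => (∃ κ, Typ κ r ∧ lab κ r = l κ) ∧ ∑ i, w (r i) < 1)).card : ℝ) ≤ μ * n^4 := by
    intro l
    have := hcon l
    unfold NonBad at this
    push Not at this
    obtain ⟨w, hw0, hws, hwc⟩ := this
    refine ⟨fun v => min (w v) 1, fun v => le_min (hw0 v) zero_le_one, fun v => min_le_right _ _,
      (sum_le_sum fun v _ => min_le_left _ _).trans hws, le_trans ?_ hwc⟩
    norm_cast
    refine card_le_card ?_
    intro r hr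
    simp only [mem_filter, mem_univ, true_and] at hr ⊢
    refine ⟨hr.1, ?_⟩
    have h1 : ∀ i, min (w (r i)) 1 < 1 := by
      intro i
      refine lt_of_le_of_lt ?_ hr.2
      exact single_le_sum (f := fun i => min (w (r i)) 1) (fun i _ => le_min (hw0 _) zero_le_one) (mem_univ i)
    have h2 : ∀ i, min (w (r i)) 1 = w (r i) := by
      intro i
      rcases min_choice (w (r i)) 1 with h | h
      · exact h
      · exact absurd h (h1 i).ne
    have := hr.2
    simp only [h2] at this
    exact this
  choose w hw0 hw1 hws hwc using hex
  obtain ⟨F, hF⟩ : ∃ F : Bool → Fin 4 → Finset (Fin 5 → V), ∀ κ i x, x ∈ F κ i ↔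
      ColK c κ (x ∘ Fin.castSucc) ∧ ColK c κ (Function.update (x ∘ Fin.castSucc) i (x (Fin.last 4))) :=
    ⟨fun κ i => univ.filter (fun x => ColK c κ (x ∘ Fin.castSucc) ∧
      ColK c κ (Function.update (x ∘ Fin.castSucc) i (x (Fin.last 4)))), fun κ i x => by simp [-Fin.reduceLast]⟩
  obtain ⟨E1, D1, B1⟩ := ubound_j (X := Unit) hV n hn 2 t (fun _ (x : Fin 2 → V) => x 0 = x 1) (1 / n) (by positivity) (by
    intro _
    refine ⟨univ.image (fun v : V => fun _ => v), ?_, ?_⟩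
    · intro x hx
      rw [mem_image]
      refine ⟨x 0, mem_univ _, ?_⟩
      ext k
      fin_cases k
      · rfl
      · exact hx
    · have : (univ.image (fun v : V => fun _ : Fin 2 => v)).card ≤ Fintype.card V := by
        rw [← card_univ]; exact card_image_le
      have h2 : ((univ.image (fun v : V => fun _ : Fin 2 => v)).card : ℝ) ≤ n := by rw [hn]; exact_mod_cast this
      refine le_trans h2 (le_of_eq ?_)
      field_simp)
  obtain ⟨E2, D2, B2⟩ := ubound_j (X := Bool) hV n hn 4 t (fun κ (r : Fin 4 → V) => ColK c κ r ∧ ¬ Typ κ r) (2 * δ) (by positivity)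
    (fun κ => ⟨_, fun r hr => mem_filter.2 ⟨mem_univ _, hr⟩, hfew κ⟩)
  obtain ⟨E3, D3, B3⟩ := ubound_j (X := Bool × Fin 4) hV n hn 5 t (fun p (x : Fin 5 → V) => x ∈ F p.1 p.2 ∧
      ((univ.filter (fun x' => ∀ A, mix x x' A ∈ F p.1 p.2)).card : ℝ) < δ ^ (2 ^ 5) * n ^ 5) δ hδ.le (by
    intro p
    exact ⟨_, fun x hx => mem_filter.2 hx, supersat_rich hV 5 (F p.1 p.2) δ hδ⟩)
  obtain ⟨E4, D4, B4⟩ := ubound_j (X := Bool → Fin K) hV n hn 4 t (fun l (r : Fin 4 → V) => (∃ κ, Typ κ r ∧ lab κ r = l κ) ∧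
      ∑ i, w l (r i) < 1) μ hμ0.le (fun l => ⟨_, fun r hr => mem_filter.2 ⟨mem_univ _, hr⟩, hwc l⟩)
  obtain ⟨E5, D5, B5⟩ := ubound (X := Bool → Fin K) (Y := Fin t → V) (fun l f => (q:ℝ) - 10 ≤ ∑ k, w l (f k))
    (Real.exp (5 - q * (ε^2 / 4)) * n^t) (fun l => ⟨_, fun r hr => mem_filter.2 ⟨mem_univ _, hr⟩,
      chernoff ε hε hε1 q (w l) (hw0 l) (hw1 l) (hws l)⟩)
  have htot : ((E1 ∪ E2 ∪ E3 ∪ E4 ∪ E5).card : ℝ) < n^t := by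
    have hc : (E1 ∪ E2 ∪ E3 ∪ E4 ∪ E5).card ≤ E1.card + E2.card + E3.card + E4.card + E5.card := by
      have := card_union_le (E1 ∪ E2 ∪ E3 ∪ E4) E5
      have := card_union_le (E1 ∪ E2 ∪ E3) E4
      have := card_union_le (E1 ∪ E2) E3
      have := card_union_le E1 E2
      omega
    have hc' : ((E1 ∪ E2 ∪ E3 ∪ E4 ∪ E5).card : ℝ) ≤ E1.card + E2.card + E3.card + E4.card + E5.card := by
      exact_mod_cast hc
    have hnt : 0 < n^t := by positivity
    have c1 : (E1.card : ℝ) ≤ 1/4 * n^t := by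
      refine B1.trans ?_
      refine mul_le_mul_of_nonneg_right ?_ hnt.le
      have : (4 * (t:ℝ)^2) ≤ n := by rw [hn]; exact_mod_cast hn0
      simp only [Fintype.card_unit, Nat.cast_one, one_mul]
      rw [mul_one_div, div_le_iff₀ hnp]
      linarith
    have hδt : (t:ℝ)^5 * δ = 1 / 48 := by
      rw [hδe]; field_simp
    have c2 : (E2.card : ℝ) ≤ 1/12 * n^t := by
      refine B2.trans ?_
      refine mul_le_mul_of_nonneg_right ?_ hnt.le
      simp only [Fintype.card_bool]
      have h1 : (t:ℝ)^4 ≤ (t:ℝ)^5 := pow_le_pow_right₀ htR1 (by norm_num)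
      have h2 : (t:ℝ)^4 * δ ≤ (t:ℝ)^5 * δ := by gcongr
      push_cast
      linarith
    have c3 : (E3.card : ℝ) ≤ 1/6 * n^t := by
      refine B3.trans ?_
      refine mul_le_mul_of_nonneg_right ?_ hnt.le
      simp only [Fintype.card_prod, Fintype.card_bool, Fintype.card_fin]
      push_cast
      linarith
    have c4 : (E4.card : ℝ) ≤ 1/8 * n^t := by
      refine B4.trans ?_
      refine mul_le_mul_of_nonneg_right ?_ hnt.le
      simp only [Fintype.card_fun, Fintype.card_bool, Fintype.card_fin]
      push_cast
      rw [hμ]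
      refine le_of_eq ?_
      field_simp
    have c5 : (E5.card : ℝ) ≤ 1/4 * n^t := by
      refine B5.trans ?_
      simp only [Fintype.card_fun, Fintype.card_bool, Fintype.card_fin]
      push_cast
      rw [← mul_assoc]
      exact mul_le_mul_of_nonneg_right hKe hnt.le
    linarith
  have hexf : ∃ f, f ∉ E1 ∪ E2 ∪ E3 ∪ E4 ∪ E5 := by
    by_contra h
    push Not at h
    have : E1 ∪ E2 ∪ E3 ∪ E4 ∪ E5 = univ := eq_univ_of_forall h
    rw [this, card_univ] at htot
    simp only [Fintype.card_fun, Fintype.card_fin] at htot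
    push_cast at htot
    exact lt_irrefl _ htot
  obtain ⟨f, hf⟩ := hexf
  simp only [mem_union, not_or] at hf
  obtain ⟨⟨⟨⟨f1, f2⟩, f3⟩, f4⟩, f5⟩ := hf
  refine good_core c q hq10 K hK0' lab Typ w hw0 f ?_ ?_ ?_ ?_ ?_
  · intro a b hab
    by_contra hne
    refine f1 (D1 () ![a, b] ?_ f (by simpa using hab))
    intro x y hxy
    fin_cases x <;> fin_cases y <;> simp_all
  · intro κ j hj hc
    by_contra hT
    exact f2 (D2 κ j hj f ⟨hc, hT⟩)
  · intro κ i j hj hc1 hc2 hT1 hT2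
    refine hlab κ _ _ hT1 hT2 ?_
    have hr : δ^32 * n^5 ≤ ((univ.filter (fun x' => ∀ A, mix (f ∘ j) x' A ∈ F κ i)).card : ℝ) := by
      by_contra hlt
      push Not at hlt
      exact f3 (D3 (κ, i) j hj f ⟨(hF κ i _).2 ⟨hc1, hc2⟩, hlt⟩)
    exact rich_adj hV (ColK c κ) i (δ^32) (F κ i) (hF κ i) (f ∘ j) hr
  · intro l j hj hk
    by_contra hlt
    push Not at hlt
    exact f4 (D4 l j hj f ⟨hk, hlt⟩)
  · intro l
    by_contra hlt
    push Not at hlt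
    exact f5 (D5 l f hlt)

theorem cyc_tight {V : Type} [DecidableEq V] (c : Finset V → Bool) (κ : Bool) (a : Fin 4 → V)
    (t : List (Fin 4 → V)) (hch : List.IsChain (Gm (ColK c κ)) (a :: t ++ [a]))
    (hpw : (a :: t).Pairwise rowDisj) :
    IsTightCycleSetOn 4 (fun e => c e = κ) ((a :: t).toFinset.biUnion (fun r => univ.image r)) ∧
    ∀ r ∈ (a :: t), ColK c κ r := by
  obtain ⟨R, hR⟩ : ∃ R, R = a :: t := ⟨_, rfl⟩
  obtain ⟨len, hlen⟩ : ∃ len, len = R.length := ⟨_, rfl⟩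
  have hlen0 : 0 < len := by rw [hlen, hR]; simp
  rw [← hR] at hch hpw ⊢
  obtain ⟨row, hrow⟩ : ∃ row : ℕ → Fin 4 → V, ∀ x, row x = R.getD (x % len) a := ⟨_, fun _ => rfl⟩
  have hrowlt : ∀ x, (h : x < len) → row x = R[x]'(hlen ▸ h) := by
    intro x h
    rw [hrow, Nat.mod_eq_of_lt h, List.getD_eq_getElem _ _ (hlen ▸ h)]
  have hrow0 : row 0 = a := by rw [hrowlt 0 hlen0]; simp [hR]
  have hrowper : ∀ x, row (x % len) = row x := by intro x; rw [hrow, hrow, Nat.mod_mod]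
  have hG : ∀ x, Gm (ColK c κ) (row x) (row (x + 1)) := by
    intro x
    rw [← hrowper x, ← hrowper (x + 1)]
    have hx := Nat.mod_lt x hlen0
    have hch' := List.isChain_iff_getElem.1 hch (x % len) (by simp; omega)
    rw [List.getElem_append_left (by omega)] at hch'
    rw [hrowlt _ hx]
    by_cases hx1 : x % len + 1 < len
    · rw [List.getElem_append_left (by omega)] at hch'
      have : (x + 1) % len = x % len + 1 := by
        rw [Nat.add_mod]
        by_cases h1 : 1 < len
        · rw [Nat.mod_eq_of_lt h1, Nat.mod_eq_of_lt hx1]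
        · omega
      rw [this, hrowlt _ hx1]
      exact hch'
    · have hxe : x % len + 1 = len := by omega
      rw [List.getElem_append_right (by omega)] at hch'
      have : (x + 1) % len = 0 := by
        rw [← Nat.mod_add_mod, hxe, Nat.mod_self]
      rw [this, hrow0]
      simpa using hch'
  have hC : ∀ x, ColK c κ (row x) := by
    intro x
    have := hG x (fun _ => false)
    have e : mix (row x) (row (x + 1)) (fun _ => false) = row x := by ext; simp [mix]
    rwa [e] at this
  have hRrow : ∀ r, r ∈ R ↔ ∃ x < len, row x = r := by
    intro r
    rw [List.mem_iff_getElem]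
    constructor
    · rintro ⟨x, hx, rfl⟩
      exact ⟨x, hlen ▸ hx, hrowlt x (hlen ▸ hx)⟩
    · rintro ⟨x, hx, rfl⟩
      exact ⟨x, hlen ▸ hx, (hrowlt x hx).symm⟩
  have hdis : ∀ x y, x < len → y < len → x ≠ y → rowDisj (row x) (row y) := by
    have h1 : ∀ x y, x < len → y < len → x < y → rowDisj (row x) (row y) := by
      intro x y hx hy hxy
      rw [hrowlt x hx, hrowlt y hy]
      exact List.pairwise_iff_getElem.1 hpw x y _ _ hxy
    intro x y hx hy hxy
    rcases lt_or_gt_of_ne hxy with h | h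
    · exact h1 x y hx hy h
    · intro i j hij
      exact h1 y x hy hx h j i hij.symm
  refine ⟨?_, ?_⟩
  swap
  · intro r hr
    obtain ⟨x, -, rfl⟩ := (hRrow r).1 hr
    exact hC x
  have hcard : (R.toFinset.biUnion (fun r => univ.image r)).card = 4 * len := by
    have : R.toFinset.biUnion (fun r => univ.image r) = (range len).biUnion (fun x => univ.image (row x)) := by
      ext v
      simp only [mem_biUnion, List.mem_toFinset, mem_range]
      constructor
      · rintro ⟨r, hr, hv⟩
        obtain ⟨x, hx, rfl⟩ := (hRrow r).1 hr
        exact ⟨x, hx, hv⟩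
      · rintro ⟨x, hx, hv⟩
        exact ⟨row x, (hRrow _).2 ⟨x, hx, rfl⟩, hv⟩
    rw [this, card_biUnion]
    · rw [sum_congr rfl (fun x _ => card_image_of_injective _ (hC x).1)]
      simp [mul_comm]
    · intro x hx y hy hxy
      show Disjoint (univ.image (row x)) (univ.image (row y))
      rw [disjoint_left]
      intro v hv hv'
      obtain ⟨i, -, rfl⟩ := mem_image.1 hv
      obtain ⟨j, -, hj⟩ := mem_image.1 hv'
      exact hdis x y (mem_range.1 hx) (mem_range.1 hy) hxy i j hj.symm
  right
  rw [hcard]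
  obtain ⟨f, hf⟩ : ∃ f : ℕ → V, ∀ x (b : Fin 4), f (4 * x + b) = row x b := by
    refine ⟨fun i => row (i / 4) ⟨i % 4, Nat.mod_lt _ (by norm_num)⟩, ?_⟩
    intro x b
    have h1 : (4 * x + (b:ℕ)) / 4 = x := by omega
    have h2 : (⟨(4 * x + (b:ℕ)) % 4, Nat.mod_lt _ (by norm_num)⟩ : Fin 4) = b := by
      ext; simp
    simp only [h1, h2]
  have hdec : ∀ i, ∃ x, ∃ b : Fin 4, i = 4 * x + (b:ℕ) := fun i =>
    ⟨i / 4, ⟨i % 4, Nat.mod_lt _ (by norm_num)⟩, by simp; omega⟩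
  have hrowmem : ∀ x b, row x b ∈ R.toFinset.biUnion (fun r => univ.image r) := by
    intro x b
    refine mem_biUnion.2 ⟨row x, List.mem_toFinset.2 ((hRrow _).2 ⟨x % len, Nat.mod_lt _ hlen0, hrowper x⟩), ?_⟩
    exact mem_image_of_mem _ (mem_univ _)
  refine ⟨f, ?_, ?_, ?_, ?_, ?_⟩
  · intro i
    obtain ⟨x, b, rfl⟩ := hdec i
    rw [show 4 * x + (b:ℕ) + 4 * len = 4 * (x + len) + (b:ℕ) by ring, hf, hf, ← hrowper (x + len),
      Nat.add_mod_right, hrowper]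
  · intro i
    obtain ⟨x, b, rfl⟩ := hdec i
    rw [hf]; exact hrowmem x b
  · intro i j hi hj hij
    obtain ⟨x, b, rfl⟩ := hdec i
    obtain ⟨y, d, rfl⟩ := hdec j
    rw [hf, hf] at hij
    by_cases hxy : x = y
    · subst hxy
      rw [(hC x).1 hij]
    · exact absurd hij (hdis x y (by omega) (by omega) hxy b d)
  · intro v hv
    obtain ⟨r, hr, hv⟩ := mem_biUnion.1 hv
    obtain ⟨b, -, rfl⟩ := mem_image.1 hv
    obtain ⟨x, -, rfl⟩ := (hRrow r).1 (List.mem_toFinset.1 hr)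
    exact ⟨4 * x + b, hf x b⟩
  · intro i
    obtain ⟨x, b, rfl⟩ := hdec i
    have h1 := (hG x (fun k => decide (k < b))).2
    rw [← h1]
    show c _ = c _
    congr 1
    have f0 : ∀ y, f (4 * y) = row y 0 := fun y => hf y 0
    have f1 : ∀ y, f (4 * y + 1) = row y 1 := fun y => hf y 1
    have f2 : ∀ y, f (4 * y + 2) = row y 2 := fun y => hf y 2
    have f3 : ∀ y, f (4 * y + 3) = row y 3 := fun y => hf y 3
    have f4 : f (4 * x + 4) = row (x + 1) 0 := f0 (x + 1)
    have f5 : f (4 * x + 5) = row (x + 1) 1 := f1 (x + 1)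
    have f6 : f (4 * x + 6) = row (x + 1) 2 := f2 (x + 1)
    have hu : (univ : Finset (Fin 4)) = {0, 1, 2, 3} := by decide
    have hr : range 4 = {0, 1, 2, 3} := by decide
    rw [hu, hr]
    ext v
    simp only [mem_image, mem_insert, mem_singleton, exists_eq_or_imp, exists_eq_left]
    fin_cases b <;> simp [mix, add_assoc, f0, f1, f2, f3, f4, f5, f6] <;> tauto

open Classical in
theorem conn_greedy {V J : Type} [Fintype V] (L : ℕ) (η : ℝ)
    (G : J → (Fin 4 → V) → (Fin 4 → V) → Prop) (r r' : J → Fin 4 → V) (Res : Finset V)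
    (s : Finset J)
    (H : ∀ j ∈ s, ∀ X0 : Finset V, (X0.card : ℝ) ≤ η → ∃ l : List (Fin 4 → V),
      List.IsChain (G j) (r j :: (l ++ [r' j])) ∧ (∀ z ∈ l, ∀ i, z i ∉ X0) ∧
      l.Pairwise rowDisj ∧ l.length ≤ L)
    (hs : (Res.card : ℝ) + 4 * L * s.card ≤ η) :
    ∃ C : J → List (Fin 4 → V), (∀ j ∈ s,
      List.IsChain (G j) (r j :: (C j ++ [r' j])) ∧ (∀ z ∈ C j, ∀ i, z i ∉ Res) ∧
      (C j).Pairwise rowDisj ∧ (C j).length ≤ L) ∧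
      ∀ j ∈ s, ∀ j' ∈ s, j ≠ j' → ∀ z ∈ C j, ∀ z' ∈ C j', rowDisj z z' := by
  induction s using Finset.induction_on with
  | empty => exact ⟨fun _ => [], by simp, by simp⟩
  | insert a s ha ih =>
    rw [card_insert_of_notMem ha] at hs
    push_cast at hs
    have hL : (0:ℝ) ≤ 4 * L := by positivity
    obtain ⟨C, hC1, hC2⟩ := ih (fun j hj => H j (mem_insert_of_mem hj)) (by nlinarith)
    obtain ⟨X0, hX0⟩ : ∃ X0, X0 = Res ∪ s.biUnion (fun j => (C j).toFinset.biUnion (fun z => univ.image z)) :=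
      ⟨_, rfl⟩
    have hcard : (X0.card : ℝ) ≤ η := by
      have h1 : X0.card ≤ Res.card + s.card * (L * 4) := by
        rw [hX0]
        refine (card_union_le _ _).trans (Nat.add_le_add_left ?_ _)
        refine card_biUnion_le_card_mul _ _ _ (fun j hj => ?_)
        refine (card_biUnion_le_card_mul _ _ 4 (fun z _ => ?_)).trans ?_
        · exact card_image_le.trans (by simp)
        · exact Nat.mul_le_mul_right _ ((List.toFinset_card_le _).trans (hC1 j hj).2.2.2)
      have h2 : (X0.card : ℝ) ≤ Res.card + s.card * (L * 4) := by exact_mod_cast h1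
      nlinarith
    obtain ⟨l, hl1, hl2, hl3, hl4⟩ := H a (mem_insert_self _ _) X0 hcard
    have hdis : ∀ j ∈ s, ∀ z ∈ C j, ∀ z' ∈ l, rowDisj z z' := by
      intro j hj z hz z' hz' i i' hii
      apply hl2 z' hz' i'
      rw [hX0, ← hii]
      refine mem_union_right _ (mem_biUnion.2 ⟨j, hj, mem_biUnion.2 ⟨z, by simpa using hz, ?_⟩⟩)
      exact mem_image_of_mem _ (mem_univ _)
    have hCj : ∀ j ∈ s, Function.update C a l j = C j := by
      intro j hj
      rw [Function.update_of_ne]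
      rintro rfl; exact ha hj
    refine ⟨Function.update C a l, ?_, ?_⟩
    · intro j hj
      rcases mem_insert.1 hj with rfl | hj
      · rw [Function.update_self]
        refine ⟨hl1, fun z hz i hi => hl2 z hz i ?_, hl3, hl4⟩
        rw [hX0]; exact mem_union_left _ hi
      · rw [hCj j hj]; exact hC1 j hj
    · intro j hj j' hj' hne
      rcases mem_insert.1 hj with rfl | hjs
      · rcases mem_insert.1 hj' with rfl | hj'
        · exact absurd rfl hne
        · rw [Function.update_self, hCj j' hj']
          intro z hz z' hz' i i' hii
          exact hdis j' hj' z' hz' z hz i' i hii.symm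
      · rcases mem_insert.1 hj' with rfl | hj'
        · rw [Function.update_self, hCj j hjs]
          exact hdis j hjs
        · rw [hCj j hjs, hCj j' hj']
          exact hC2 j hjs j' hj' hne

theorem chain_flat {α : Type*} (G : α → α → Prop) (hd : ℕ → α) (tl : ℕ → List α) (S : ℕ)
    (h : ∀ i < S, List.IsChain G (hd i :: tl i ++ [hd (i + 1)])) :
    List.IsChain G ((List.range S).flatMap (fun i => hd i :: tl i) ++ [hd S]) := by
  induction S with
  | zero => simp
  | succ S ih =>
    have h1 := ih (fun i hi => h i (by omega))
    have h2 := h S (by omega)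
    rw [List.range_succ, List.flatMap_append]
    have := List.IsChain.append_overlap (l₁ := (List.range S).flatMap (fun i => hd i :: tl i))
      (l₂ := [hd S]) (l₃ := tl S ++ [hd (S + 1)]) h1 (by simpa using h2) (by simp)
    simpa using this

open Classical in
theorem assemble {V : Type} [Fintype V] (c : Finset V → Bool) (m' L : ℕ) (S : Bool → ℕ)
    (row : Bool → ℕ → ℕ → Fin 4 → V)
    (hG : ∀ κ i k k', i < S κ → k < m' + 2 → k' < m' + 2 →
      Gm (ColK c κ) (row κ i k) (row κ i k'))
    (hinj : ∀ κ κ' i i' k k' x x', i < S κ → i' < S κ' → k < m' + 2 → k' < m' + 2 →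
      row κ i k x = row κ' i' k' x' → κ = κ' ∧ i = i' ∧ k = k' ∧ x = x')
    (C : Bool → ℕ → List (Fin 4 → V))
    (hC1 : ∀ κ i, i < S κ →
      List.IsChain (Gm (ColK c κ)) (row κ i (m' + 1) :: (C κ i ++ [row κ ((i + 1) % S κ) 0])))
    (hC2 : ∀ κ i, i < S κ → ∀ z ∈ C κ i, ∀ x κ' i' x', i' < S κ' →
      z x ≠ row κ' i' 0 x' ∧ z x ≠ row κ' i' (m' + 1) x')
    (hC3 : ∀ κ i, i < S κ → (C κ i).Pairwise rowDisj)
    (hC4 : ∀ κ i, i < S κ → (C κ i).length ≤ L)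
    (hC5 : ∀ κ i κ' i', i < S κ → i' < S κ' → (κ, i) ≠ (κ', i') →
      ∀ z ∈ C κ i, ∀ z' ∈ C κ' i', rowDisj z z') :
    ∃ V1 V2 : Finset V, Disjoint V1 V2 ∧
      IsTightCycleSetOn 4 (fun e => c e = true) V1 ∧
      IsTightCycleSetOn 4 (fun e => c e = false) V2 ∧
      4 * (m' + 2) * (S true + S false) ≤ (V1 ∪ V2).card + 16 * L * (S true + S false) := by
  obtain ⟨s, hs⟩ : ∃ s : Finset (Bool × ℕ), s = univ.biUnion (fun κ => (range (S κ)).image (fun i => (κ, i))) :=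
    ⟨_, rfl⟩
  have hsm : ∀ κ i, (κ, i) ∈ s ↔ i < S κ := by
    intro κ i; rw [hs]; cases κ <;> simp
  have hscard : s.card = S true + S false := by
    rw [hs, card_biUnion]
    · rw [sum_congr rfl (fun κ _ => card_image_of_injective _ (fun i j h => (Prod.mk.inj h).2))]
      simp
    · intro x _ y _ hxy
      show Disjoint _ _
      rw [disjoint_left]
      intro v hv hv'
      obtain ⟨i, -, rfl⟩ := mem_image.1 hv
      obtain ⟨j, -, hj⟩ := mem_image.1 hv'
      exact hxy (Prod.mk.inj hj).1.symm
  obtain ⟨Cv, hCv⟩ : ∃ Cv : Finset V, Cv = s.biUnion (fun j => (C j.1 j.2).toFinset.biUnion (fun z => univ.image z)) :=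
    ⟨_, rfl⟩
  have hCvm : ∀ v, v ∈ Cv ↔ ∃ κ i, i < S κ ∧ ∃ z ∈ C κ i, ∃ x, z x = v := by
    intro v
    rw [hCv]
    simp only [mem_biUnion, List.mem_toFinset, mem_image, mem_univ, true_and, Prod.exists, hsm]
  have hCvc : Cv.card ≤ (S true + S false) * (L * 4) := by
    rw [hCv, ← hscard]
    refine card_biUnion_le_card_mul _ _ _ (fun j hj => ?_)
    refine (card_biUnion_le_card_mul _ _ 4 (fun z _ => ?_)).trans ?_
    · exact card_image_le.trans (by simp)
    · exact Nat.mul_le_mul_right _ ((List.toFinset_card_le _).trans (hC4 _ _ ((hsm j.1 j.2).1 hj)))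
  obtain ⟨good, hgood⟩ : ∃ good : Bool → ℕ → ℕ → Prop, ∀ κ i k, good κ i k ↔ ∀ x, row κ i k x ∉ Cv :=
    ⟨_, fun _ _ _ => Iff.rfl⟩
  have good0 : ∀ κ i, i < S κ → good κ i 0 ∧ good κ i (m' + 1) := by
    intro κ i hi
    rw [hgood, hgood]
    constructor
    · intro x hx
      obtain ⟨κ', i', hi', z, hz, x', h⟩ := (hCvm _).1 hx
      exact (hC2 κ' i' hi' z hz x' κ i x hi).1 h
    · intro x hx
      obtain ⟨κ', i', hi', z, hz, x', h⟩ := (hCvm _).1 hx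
      exact (hC2 κ' i' hi' z hz x' κ i x hi).2 h
  obtain ⟨fl, hfl⟩ : ∃ fl : Bool → ℕ → List ℕ, ∀ κ i, fl κ i = (List.range' 1 m').filter (fun k => decide (good κ i k)) :=
    ⟨_, fun _ _ => rfl⟩
  have hflm : ∀ κ i k, k ∈ fl κ i ↔ (1 ≤ k ∧ k < 1 + m') ∧ good κ i k := by
    intro κ i k
    rw [hfl]; simp [List.mem_range'_1]
  have hflnd : ∀ κ i, (fl κ i).Nodup := by
    intro κ i; rw [hfl]; exact (List.nodup_range').filter _
  obtain ⟨ks, hks⟩ : ∃ ks : Bool → ℕ → List ℕ, ∀ κ i, ks κ i = 0 :: (fl κ i ++ [m' + 1]) :=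
    ⟨_, fun _ _ => rfl⟩
  have hksm : ∀ κ i k, i < S κ → (k ∈ ks κ i ↔ k < m' + 2 ∧ good κ i k) := by
    intro κ i k hi
    have h0 := good0 κ i hi
    simp only [hks, List.mem_cons, List.mem_append, hflm, List.not_mem_nil, or_false]
    constructor
    · rintro (rfl | ⟨⟨h1, h2⟩, h3⟩ | rfl)
      · exact ⟨by omega, h0.1⟩
      · exact ⟨by omega, h3⟩
      · exact ⟨by omega, h0.2⟩
    · rintro ⟨h1, h2⟩
      by_cases hk0 : k = 0
      · left; exact hk0
      · by_cases hk1 : k = m' + 1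
        · right; right; exact hk1
        · right; left; exact ⟨by omega, h2⟩
  have hksnd : ∀ κ i, (ks κ i).Nodup := by
    intro κ i
    rw [hks, List.nodup_cons, List.nodup_append]
    refine ⟨?_, hflnd κ i, by simp, ?_⟩
    · simp [hflm]
    · intro a ha b hb
      rw [hflm] at ha
      simp at hb
      omega
  obtain ⟨tl, htl⟩ : ∃ tl : Bool → ℕ → List (Fin 4 → V), ∀ κ i, tl κ i =
      ((fl κ i).map (row κ i) ++ [row κ i (m' + 1)]) ++ C κ i := ⟨_, fun _ _ => rfl⟩
  have hseg : ∀ κ i, row κ i 0 :: tl κ i = (ks κ i).map (row κ i) ++ C κ i := by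
    intro κ i; rw [htl, hks]; simp
  have hsegm : ∀ κ i z, i < S κ → (z ∈ row κ i 0 :: tl κ i ↔
      (∃ k, k < m' + 2 ∧ good κ i k ∧ row κ i k = z) ∨ z ∈ C κ i) := by
    intro κ i z hi
    rw [hseg, List.mem_append, List.mem_map]
    simp only [hksm κ i _ hi, and_assoc]
  have hrc : ∀ κ i k κ' i' z, i' < S κ' → good κ i k → z ∈ C κ' i' → rowDisj (row κ i k) z := by
    intro κ i k κ' i' z hi' hg hz x x' h
    exact (hgood _ _ _).1 hg x ((hCvm _).2 ⟨κ', i', hi', z, hz, x', h.symm⟩)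
  have hcr : ∀ κ i k κ' i' z, i' < S κ' → good κ i k → z ∈ C κ' i' → rowDisj z (row κ i k) := by
    intro κ i k κ' i' z hi' hg hz x x' h
    exact hrc κ i k κ' i' z hi' hg hz x' x h.symm
  have hcross : ∀ κ i κ' i', i < S κ → i' < S κ' → (κ, i) ≠ (κ', i') →
      ∀ z ∈ row κ i 0 :: tl κ i, ∀ z' ∈ row κ' i' 0 :: tl κ' i', rowDisj z z' := by
    intro κ i κ' i' hi hi' hne z hz z' hz'
    rcases (hsegm κ i z hi).1 hz with ⟨k, hk, hg, rfl⟩ | hz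
    · rcases (hsegm κ' i' z' hi').1 hz' with ⟨k', hk', hg', rfl⟩ | hz'
      · intro x x' h
        have := hinj _ _ _ _ _ _ _ _ hi hi' hk hk' h
        exact hne (Prod.ext this.1 this.2.1)
      · exact hrc _ _ _ _ _ _ hi' hg hz'
    · rcases (hsegm κ' i' z' hi').1 hz' with ⟨k', hk', hg', rfl⟩ | hz'
      · exact hcr _ _ _ _ _ _ hi hg' hz
      · exact hC5 _ _ _ _ hi hi' hne z hz z' hz'
  have hsegpw : ∀ κ i, i < S κ → (row κ i 0 :: tl κ i).Pairwise rowDisj := by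
    intro κ i hi
    rw [hseg, List.pairwise_append]
    refine ⟨?_, hC3 κ i hi, ?_⟩
    · rw [List.pairwise_map]
      refine (List.Pairwise.imp_of_mem ?_ (hksnd κ i))
      intro k k' hk hk' hne x x' h
      exact hne (hinj _ _ _ _ _ _ _ _ hi hi ((hksm κ i k hi).1 hk).1 ((hksm κ i k' hi).1 hk').1 h).2.2.1
    · intro z hz z' hz'
      obtain ⟨k, hk, rfl⟩ := List.mem_map.1 hz
      exact hrc _ _ _ _ _ _ hi ((hksm κ i k hi).1 hk).2 hz'
  have hsegch : ∀ κ i, i < S κ → List.IsChain (Gm (ColK c κ))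
      (row κ i 0 :: tl κ i ++ [row κ ((i + 1) % S κ) 0]) := by
    intro κ i hi
    have h1 : List.IsChain (Gm (ColK c κ)) ((ks κ i).map (row κ i)) := by
      apply List.Pairwise.isChain
      rw [List.pairwise_map]
      refine (List.Pairwise.imp_of_mem ?_ (hksnd κ i))
      intro k k' hk hk' _
      exact hG κ i k k' hi ((hksm κ i k hi).1 hk).1 ((hksm κ i k' hi).1 hk').1
    have := List.IsChain.append_overlap (l₁ := row κ i 0 :: (fl κ i).map (row κ i))
      (l₂ := [row κ i (m' + 1)]) (l₃ := C κ i ++ [row κ ((i + 1) % S κ) 0])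
      (by rw [hks] at h1; simpa using h1) (by simpa using hC1 κ i hi) (by simp)
    rw [htl]; simpa using this
  obtain ⟨cyc, hcyc⟩ : ∃ cyc : Bool → List (Fin 4 → V), ∀ κ, cyc κ =
      (List.range (S κ)).flatMap (fun i => row κ i 0 :: tl κ i) := ⟨_, fun _ => rfl⟩
  have hcycm : ∀ κ z, z ∈ cyc κ ↔ ∃ i < S κ, z ∈ row κ i 0 :: tl κ i := by
    intro κ z; rw [hcyc, List.mem_flatMap]; simp only [List.mem_range]
  have hcycpw : ∀ κ, (cyc κ).Pairwise rowDisj := by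
    intro κ
    rw [hcyc, List.pairwise_flatMap]
    refine ⟨fun i hi => hsegpw κ i (List.mem_range.1 hi), ?_⟩
    refine List.Pairwise.imp_of_mem ?_ (List.nodup_range (n := S κ))
    intro i i' hi hi' hne
    exact hcross κ i κ i' (List.mem_range.1 hi) (List.mem_range.1 hi') (by simpa using hne)
  have htc : ∀ κ, IsTightCycleSetOn 4 (fun e => c e = κ) ((cyc κ).toFinset.biUnion (fun r => univ.image r)) := by
    intro κ
    rcases Nat.eq_zero_or_pos (S κ) with h0 | h0
    · left; rw [hcyc, h0]; simp
    · have hch := chain_flat (Gm (ColK c κ)) (fun i => row κ (i % S κ) 0) (fun i => tl κ (i % S κ)) (S κ)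
        (by
          intro i hi
          have := hsegch κ i hi
          simpa only [Nat.mod_eq_of_lt hi] using this)
      have he : (List.range (S κ)).flatMap (fun i => row κ (i % S κ) 0 :: tl κ (i % S κ)) = cyc κ := by
        rw [hcyc]
        simp only [List.flatMap]
        congr 1
        apply List.map_congr_left
        intro i hi
        rw [Nat.mod_eq_of_lt (List.mem_range.1 hi)]
      simp only [he, Nat.mod_self] at hch
      have hne : ∃ t, cyc κ = row κ 0 0 :: t := by
        obtain ⟨q, hq⟩ : ∃ q, S κ = q + 1 := ⟨S κ - 1, by omega⟩
        rw [hcyc, hq, List.range_succ_eq_map]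
        exact ⟨_, by rw [List.flatMap_cons, List.cons_append]⟩
      obtain ⟨t, ht⟩ := hne
      have hp := hcycpw κ
      rw [ht] at hch hp ⊢
      exact (cyc_tight c κ (row κ 0 0) t hch hp).1
  obtain ⟨W, hW⟩ : ∃ W : Bool → Finset V, ∀ κ, W κ = (cyc κ).toFinset.biUnion (fun r => univ.image r) :=
    ⟨_, fun _ => rfl⟩
  have hWm : ∀ κ v, v ∈ W κ ↔ ∃ i < S κ, ∃ z ∈ row κ i 0 :: tl κ i, ∃ x, z x = v := by
    intro κ v
    rw [hW]
    simp only [mem_biUnion, List.mem_toFinset, hcycm, mem_image, mem_univ, true_and]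
    constructor
    · rintro ⟨z, ⟨i, hi, hz⟩, x, hx⟩; exact ⟨i, hi, z, hz, x, hx⟩
    · rintro ⟨i, hi, z, hz, x, hx⟩; exact ⟨z, ⟨i, hi, hz⟩, x, hx⟩
  refine ⟨W true, W false, ?_, by rw [hW]; exact htc true, by rw [hW]; exact htc false, ?_⟩
  · rw [disjoint_left]
    intro v hv hv'
    obtain ⟨i, hi, z, hz, x, hx⟩ := (hWm _ _).1 hv
    obtain ⟨i', hi', z', hz', x', hx'⟩ := (hWm _ _).1 hv'
    exact hcross _ _ _ _ hi hi' (by simp) z hz z' hz' x x' (hx.trans hx'.symm)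
  · obtain ⟨Q, hQ⟩ : ∃ Q : Finset ((Bool × ℕ) × (ℕ × Fin 4)), Q = s ×ˢ (range (m' + 2) ×ˢ univ) := ⟨_, rfl⟩
    have hQc : Q.card = (S true + S false) * ((m' + 2) * 4) := by
      rw [hQ, card_product, card_product, hscard]; simp
    have hQm : ∀ q, q ∈ Q ↔ q.1.2 < S q.1.1 ∧ q.2.1 < m' + 2 := by
      intro q
      rw [hQ, mem_product, mem_product]
      simp only [mem_range, mem_univ, and_true]
      rw [← hsm]
    obtain ⟨p, hp⟩ : ∃ p : (Bool × ℕ) × (ℕ × Fin 4) → Prop, ∀ q, p q ↔ good q.1.1 q.1.2 q.2.1 := ⟨_, fun _ => Iff.rfl⟩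
    have h1 := card_filter_add_card_filter_not (s := Q) p
    have h2 : (Q.filter p).card ≤ (W true ∪ W false).card := by
      refine card_le_card_of_injOn (fun q => row q.1.1 q.1.2 q.2.1 q.2.2) ?_ ?_
      · intro q hq
        obtain ⟨hq1, hq2⟩ := mem_filter.1 (mem_coe.1 hq)
        rw [hQm] at hq1
        rw [hp] at hq2
        have : row q.1.1 q.1.2 q.2.1 q.2.2 ∈ W q.1.1 :=
          (hWm _ _).2 ⟨q.1.2, hq1.1, _, (hsegm _ _ _ hq1.1).2 (Or.inl ⟨q.2.1, hq1.2, hq2, rfl⟩), q.2.2, rfl⟩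
        have hWW : ∀ κ v, v ∈ W κ → v ∈ W true ∪ W false := by
          intro κ v hv
          rw [mem_union]
          cases κ
          · right; exact hv
          · left; exact hv
        exact mem_coe.2 (hWW _ _ this)
      · intro q hq q' hq' h
        have hq1 := (hQm _).1 (mem_filter.1 (mem_coe.1 hq)).1
        have hq2 := (hQm _).1 (mem_filter.1 (mem_coe.1 hq')).1
        have := hinj _ _ _ _ _ _ _ _ hq1.1 hq2.1 hq1.2 hq2.2 h
        exact Prod.ext (Prod.ext this.1 this.2.1) (Prod.ext this.2.2.1 this.2.2.2)
    have h3 : (Q.filter (fun q => ¬ p q)).card ≤ (Cv ×ˢ (univ : Finset (Fin 4))).card := by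
      have hch : ∀ q : (Bool × ℕ) × (ℕ × Fin 4), ∃ x, ¬ p q → row q.1.1 q.1.2 q.2.1 x ∈ Cv := by
        intro q
        by_cases h : p q
        · exact ⟨0, fun h' => absurd h h'⟩
        · have h' := h
          rw [hp, hgood] at h
          push Not at h
          obtain ⟨x, hx⟩ := h
          exact ⟨x, fun _ => hx⟩
      choose xx hxx using hch
      refine card_le_card_of_injOn (fun q => (row q.1.1 q.1.2 q.2.1 (xx q), q.2.2)) ?_ ?_
      · intro q hq
        obtain ⟨hq1, hq2⟩ := mem_filter.1 (mem_coe.1 hq)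
        exact mem_coe.2 (mem_product.2 ⟨hxx q hq2, mem_univ _⟩)
      · intro q hq q' hq' h
        have hq1 := (hQm _).1 (mem_filter.1 (mem_coe.1 hq)).1
        have hq2 := (hQm _).1 (mem_filter.1 (mem_coe.1 hq')).1
        have h' := Prod.mk.inj h
        have := hinj _ _ _ _ _ _ _ _ hq1.1 hq2.1 hq1.2 hq2.2 h'.1
        exact Prod.ext (Prod.ext this.1 this.2.1) (Prod.ext this.2.2.1 h'.2)
    rw [card_product, card_univ, Fintype.card_fin] at h3
    rw [hQc] at h1
    nlinarith

theorem enum_fin {α : Type} [Nonempty α] (s : Finset α) :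
    ∃ g : ℕ → α, (∀ k < s.card, g k ∈ s) ∧ ∀ k k', k < s.card → k' < s.card → g k = g k' → k = k' := by
  classical
  obtain ⟨a⟩ := ‹Nonempty α›
  refine ⟨fun k => if h : k < s.card then (s.equivFin.symm ⟨k, h⟩ : α) else a, ?_, ?_⟩
  · intro k hk
    simp only [hk, dif_pos]
    exact (s.equivFin.symm ⟨k, hk⟩).2
  · intro k k' hk hk' h
    simp only [hk, hk', dif_pos] at h
    have := s.equivFin.symm.injective (Subtype.ext h)
    simpa using this

open Classical in
theorem main_aux (ε : ℝ) (hε : 0 < ε) (hε1 : ε < 1 / 2) :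
    ∃ n₁ : ℕ, ∀ (V : Type) [Fintype V], n₁ ≤ Fintype.card V → ∀ c : Finset V → Bool,
      ∃ V1 V2 : Finset V,
        Disjoint V1 V2 ∧
        IsTightCycleSetOn 4 (fun e => c e = true) V1 ∧
        IsTightCycleSetOn 4 (fun e => c e = false) V2 ∧
        (1 - 3 * ε) * (Fintype.card V : ℝ) ≤ ((V1 ∪ V2).card : ℝ) := by
  obtain ⟨δ, hδ, hδ1, K, hK, μ, hμ, hμ1, n0, hsamp⟩ := sampling ε hε (by linarith)
  obtain ⟨η, hη, L, n0', hrob⟩ := robust hδ hδ1 K hK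
  obtain ⟨m', hm'⟩ := exists_nat_ge ((2 + L) / η + 4 * L / ε)
  obtain ⟨n0'', htile⟩ := tiling ε μ hε (by linarith) hμ hμ1 (m' + 2) (by omega)
  refine ⟨max (max n0 n0') (max n0'' 1), ?_⟩
  intro V _ hn c
  obtain ⟨N, hN⟩ : ∃ N : ℝ, N = (Fintype.card V : ℝ) := ⟨_, rfl⟩
  have hV0 : 0 < Fintype.card V := by omega
  have hN0 : 0 < N := by rw [hN]; exact_mod_cast hV0
  have hrob' := fun κ => hrob V hV0 (ColK c κ)
  choose lab Typ hT1 hT2 hT3 hT4 using hrob'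
  obtain ⟨l, hl⟩ := hsamp V (by omega) hV0 c lab Typ hT2 hT3
  obtain ⟨P, hPdef⟩ : ∃ P : Bool → (Fin 4 → V) → Prop, P = (fun κ r => Typ κ r ∧ lab κ r = l κ) := ⟨_, rfl⟩
  rw [← hPdef] at hl
  have hP : ∀ κ r, P κ r → Typ κ r ∧ lab κ r = l κ := by rw [hPdef]; exact fun _ _ h => h
  have hPi : ∀ κ r, P κ r → Function.Injective r := fun κ r h => (hT1 κ r (hP κ r h).1).1
  obtain ⟨ι, hι, T, ⟨hB, hD⟩, hcov⟩ := htile V (by omega) P hPi hl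
  rw [← hN] at hcov
  have hιne : Nonempty ι := by
    rw [← Fintype.card_pos_iff]
    by_contra h
    have h0 : Fintype.card ι = 0 := by omega
    rw [h0] at hcov
    push_cast at hcov
    nlinarith
  have hVne : Nonempty V := Fintype.card_pos_iff.1 hV0
  -- enumerate
  choose en hen1 hen2 using fun (β : ι) (i : Fin 4) => enum_fin ((T β).2 i)
  have hcard : ∀ β i, ((T β).2 i).card = m' + 2 := fun β i => (hB β).1 i
  simp only [hcard] at hen1 hen2
  have hinj : ∀ β β' i i' k k', k < m' + 2 → k' < m' + 2 → en β i k = en β' i' k' →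
      β = β' ∧ i = i' ∧ k = k' := by
    intro β β' i i' k k' hk hk' h
    have h1 := hen1 β i k hk
    have h2 := hen1 β' i' k' hk'
    rw [← h] at h2
    by_cases hβ : β = β'
    · subst hβ
      by_cases hi : i = i'
      · subst hi
        exact ⟨rfl, rfl, hen2 β i k k' hk hk' h⟩
      · exact absurd h2 (disjoint_left.1 (block_disj P hPi (m' + 2) (by omega) (T β) (hB β) i i' hi) h1)
    · exact absurd h2 (disjoint_left.1 (hD β β' hβ i i') h1)
  have hPen : ∀ β (g : Fin 4 → ℕ), (∀ i, g i < m' + 2) → P (T β).1 (fun i => en β i (g i)) := by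
    intro β g hg
    exact (hB β).2 _ (fun i => hen1 β i (g i) (hg i))
  obtain ⟨F, hF⟩ : ∃ F : Bool → Finset ι, ∀ κ, F κ = univ.filter (fun β => (T β).1 = κ) := ⟨_, fun _ => rfl⟩
  choose blk hblk1 hblk2 using fun κ => enum_fin (F κ)
  obtain ⟨S, hS⟩ : ∃ S : Bool → ℕ, ∀ κ, S κ = (F κ).card := ⟨_, fun _ => rfl⟩
  simp only [← hS] at hblk1 hblk2
  have hcol : ∀ κ i, i < S κ → (T (blk κ i)).1 = κ := by
    intro κ i hi
    have := hblk1 κ i hi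
    rw [hF] at this
    exact (mem_filter.1 this).2
  have hSb : S true + S false = Fintype.card ι := by
    have := card_filter_add_card_filter_not (s := (univ : Finset ι)) (fun β => (T β).1 = true)
    rw [hS, hS, hF, hF, ← card_univ, ← this]
    congr 2
    ext β; simp
  obtain ⟨b, hb⟩ : ∃ b : ℕ, b = Fintype.card ι := ⟨_, rfl⟩
  rw [← hb] at hSb hcov
  have hbm : (b:ℝ) * (4 * (m' + 2)) ≤ N := by
    have : Fintype.card (ι × (Fin 4 × Fin (m' + 2))) ≤ Fintype.card V := by
      refine Fintype.card_le_of_injective (fun q => en q.1 q.2.1 q.2.2) ?_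
      intro q q' h
      have := hinj _ _ _ _ _ _ q.2.2.2 q'.2.2.2 h
      exact Prod.ext this.1 (Prod.ext this.2.1 (Fin.ext this.2.2))
    simp only [Fintype.card_prod, Fintype.card_fin, ← hb] at this
    rw [hN]
    exact_mod_cast this
  obtain ⟨row, hrow⟩ : ∃ row : Bool → ℕ → ℕ → Fin 4 → V, ∀ κ i k, row κ i k = fun x => en (blk κ i) x k :=
    ⟨_, fun _ _ _ => rfl⟩
  have hProw : ∀ κ i k, i < S κ → k < m' + 2 → P κ (row κ i k) := by
    intro κ i k hi hk
    have := hPen (blk κ i) (fun _ => k) (fun _ => hk)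
    rw [hcol κ i hi] at this
    rw [hrow]; exact this
  have hG : ∀ κ i k k', i < S κ → k < m' + 2 → k' < m' + 2 →
      Gm (ColK c κ) (row κ i k) (row κ i k') := by
    intro κ i k k' hi hk hk' A
    have := hPen (blk κ i) (fun x => if A x then k' else k) (fun x => by by_cases h : A x <;> simp [h, hk, hk'])
    rw [hcol κ i hi] at this
    have h2 := hT1 κ _ (hP κ _ this).1
    have he : mix (row κ i k) (row κ i k') A = fun x => en (blk κ i) x (if A x then k' else k) := by
      ext x
      rw [hrow, hrow]
      by_cases h : A x <;> simp [mix, h]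
    rw [he]; exact h2
  have hrinj : ∀ κ κ' i i' k k' x x', i < S κ → i' < S κ' → k < m' + 2 → k' < m' + 2 →
      row κ i k x = row κ' i' k' x' → κ = κ' ∧ i = i' ∧ k = k' ∧ x = x' := by
    intro κ κ' i i' k k' x x' hi hi' hk hk' h
    rw [hrow, hrow] at h
    obtain ⟨h1, h2, h3⟩ := hinj _ _ _ _ _ _ hk hk' h
    have hκ : κ = κ' := by rw [← hcol κ i hi, ← hcol κ' i' hi', h1]
    subst hκ
    exact ⟨rfl, hblk2 κ i i' hi hi' h1, h3, h2⟩
  -- connectors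
  obtain ⟨s, hs⟩ : ∃ s : Finset (Bool × ℕ), s = univ.biUnion (fun κ => (range (S κ)).image (fun i => (κ, i))) :=
    ⟨_, rfl⟩
  have hsm : ∀ κ i, (κ, i) ∈ s ↔ i < S κ := by
    intro κ i; rw [hs]; cases κ <;> simp
  have hscard : s.card ≤ b := by
    rw [hs, ← hSb]
    refine card_biUnion_le.trans ?_
    rw [Fintype.sum_bool]
    exact Nat.add_le_add (card_image_le.trans (by simp)) (card_image_le.trans (by simp))
  obtain ⟨Res, hRes⟩ : ∃ Res : Finset V, Res = s.biUnion (fun j =>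
      univ.image (row j.1 j.2 0) ∪ univ.image (row j.1 j.2 (m' + 1))) := ⟨_, rfl⟩
  have hRescard : Res.card ≤ b * 8 := by
    rw [hRes]
    refine (card_biUnion_le_card_mul _ _ 8 (fun j _ => ?_)).trans (Nat.mul_le_mul_right _ hscard)
    refine (card_union_le _ _).trans ?_
    exact Nat.add_le_add (b := 4) (d := 4) (card_image_le.trans (by simp)) (card_image_le.trans (by simp))
  have hm1 : (2 + L) ≤ η * (m' + 2) := by
    have h1 : (0:ℝ) ≤ 4 * L / ε := by positivity
    have h2 : (2 + L) / η ≤ m' + 2 := by linarith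
    rw [div_le_iff₀ hη] at h2
    linarith
  have hm2 : 4 * L ≤ ε * (m' + 2) := by
    have h1 : (0:ℝ) ≤ (2 + L) / η := by positivity
    have h2 : 4 * L / ε ≤ m' + 2 := by linarith
    rw [div_le_iff₀ hε] at h2
    linarith
  have hb0 : (0:ℝ) ≤ b := by positivity
  have hsize : (Res.card : ℝ) + 4 * L * s.card ≤ η * N := by
    have h1 : (Res.card : ℝ) ≤ b * 8 := by exact_mod_cast hRescard
    have h2 : (s.card : ℝ) ≤ b := by exact_mod_cast hscard
    have h3 : 4 * (L:ℝ) * s.card ≤ 4 * L * b := by gcongr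
    have h4 : b * (2 + L) ≤ b * (η * (m' + 2)) := by gcongr
    have h5 : η * ((b:ℝ) * (4 * (m' + 2))) ≤ η * N := by gcongr
    nlinarith
  obtain ⟨C, hC1, hC2⟩ := conn_greedy L (η * N) (fun j : Bool × ℕ => Gm (ColK c j.1))
    (fun j => row j.1 j.2 (m' + 1)) (fun j => row j.1 ((j.2 + 1) % S j.1) 0) Res s (by
      rintro ⟨κ, i⟩ hj X0 hX0
      have hi := (hsm κ i).1 hj
      have hp1 := hP κ _ (hProw κ i (m' + 1) hi (by omega))
      have hp2 := hP κ _ (hProw κ ((i + 1) % S κ) 0 (Nat.mod_lt _ (by omega)) (by omega))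
      exact hT4 κ (by omega) _ _ hp1.1 hp2.1 (hp1.2.trans hp2.2.symm) X0 (by rw [← hN]; exact hX0)) hsize
  obtain ⟨V1, V2, hd, ht1, ht2, hc⟩ := assemble c m' L S row hG hrinj (fun κ i => C (κ, i))
    (fun κ i hi => (hC1 (κ, i) ((hsm κ i).2 hi)).1)
    (by
      intro κ i hi z hz x κ' i' x' hi'
      have := (hC1 (κ, i) ((hsm κ i).2 hi)).2.1 z hz x
      have hj' := (hsm κ' i').2 hi'
      constructor
      · intro h
        apply this
        rw [h, hRes]
        exact mem_biUnion.2 ⟨(κ', i'), hj', mem_union_left _ (mem_image_of_mem _ (mem_univ _))⟩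
      · intro h
        apply this
        rw [h, hRes]
        exact mem_biUnion.2 ⟨(κ', i'), hj', mem_union_right _ (mem_image_of_mem _ (mem_univ _))⟩)
    (fun κ i hi => (hC1 (κ, i) ((hsm κ i).2 hi)).2.2.1)
    (fun κ i hi => (hC1 (κ, i) ((hsm κ i).2 hi)).2.2.2)
    (fun κ i κ' i' hi hi' hne => hC2 (κ, i) ((hsm κ i).2 hi) (κ', i') ((hsm κ' i').2 hi') hne)
  refine ⟨V1, V2, hd, ht1, ht2, ?_⟩
  rw [hSb] at hc
  have hc' : 4 * ((m':ℝ) + 2) * b ≤ (V1 ∪ V2).card + 16 * L * b := by exact_mod_cast hc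
  rw [← hN]
  have h5 : b * (4 * L) ≤ b * (ε * (m' + 2)) := by gcongr
  have h6 : ε * ((b:ℝ) * (4 * (m' + 2))) ≤ ε * N := by gcongr
  push_cast at hcov
  nlinarith

theorem stmt1 (ε : ℝ) (hε : 0 < ε) :
    ∃ n₁ : ℕ, ∀ n : ℕ, n₁ ≤ n → ∀ c : Finset (Fin n) → Bool,
      ∃ V1 V2 : Finset (Fin n),
        Disjoint V1 V2 ∧
        IsTightCycleSetOn 4 (fun e => c e = true) V1 ∧
        IsTightCycleSetOn 4 (fun e => c e = false) V2 ∧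
        (n : ℝ) - ε * n ≤ ((V1 ∪ V2).card : ℝ) := by
  have h0 : 0 < min ε 1 / 4 := by positivity
  have h1 : min ε 1 / 4 < 1 / 2 := by
    have := min_le_right ε 1
    linarith
  obtain ⟨n₁, h⟩ := main_aux (min ε 1 / 4) h0 h1
  refine ⟨n₁, fun n hn c => ?_⟩
  obtain ⟨V1, V2, hd, ht1, ht2, hc⟩ := h (Fin n) (by simpa using hn) c
  refine ⟨V1, V2, hd, by convert ht1, by convert ht2, ?_⟩
  have h2 : ((1:ℝ) - 3 * (min ε 1 / 4)) * n ≤ ((V1 ∪ V2).card : ℝ) := by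
    rw [Fintype.card_fin] at hc
    convert hc
  have h3 := min_le_left ε 1
  have h4 : (0:ℝ) ≤ n := by positivity
  nlinarith
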